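/- The R_ℚ-module homomorphism S̄ = (S̄_p)_{p prime} : I_ℚ·RP′(ℚ)[1/2] → ⊕_{p prime} P(F_p)[1/2]{p} is an isomorphism of R_ℚ-modules. Consequently I_ℚ·RP′(ℚ)[1/2] ≅ ⊕_{p prime} ℤ/(p+1)′ as abelian groups, where m′ denotes the odd part of m. -/

import Mathlib

open scoped Classical

noncomputable section

variable (F : Type) [Field F]

/-- The group of square classes `G_F = F^× / (F^×)²`. -/
def SqCl (F : Type) [Field F] : Type :=
  Fˣ ⧸ (powMonoidHom 2 : Fˣ →* Fˣ).range

instance : CommGroup (SqCl F) := QuotientGroup.Quotient.commGroup _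

/-- The square class of a unit. -/
def sqc : Fˣ →* SqCl F := QuotientGroup.mk' _

/-- The group ring `R_F = ℤ[F^×/(F^×)²]`. -/
abbrev RF (F : Type) [Field F] : Type := MonoidAlgebra ℤ (SqCl F)

/-- `⟨x⟩ ∈ R_F`, the square class of a unit as an element of the group ring. -/
def cls (x : Fˣ) : RF F := MonoidAlgebra.of ℤ (SqCl F) (sqc F x)

/-- The free `R_F`-module on the set `F^×`. -/
abbrev FreeRP (F : Type) [Field F] : Type := Fˣ →₀ RF F

/-- The generator `[x]` of the free module. -/
def gen (x : Fˣ) : FreeRP F := Finsupp.single x 1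

/-- units from nonzero field elements -/
def U (x : F) (h : x ≠ 0) : Fˣ := Units.mk0 x h

variable {F}

theorem one_sub_ne {x : Fˣ} (hx : (x : F) ≠ 1) : (1 : F) - x ≠ 0 :=
  sub_ne_zero.mpr (Ne.symm hx)

theorem inv_sub_one_ne {x : Fˣ} (hx : (x : F) ≠ 1) : ((x : F)⁻¹ - 1) ≠ 0 :=
  sub_ne_zero.mpr (fun h => hx (by rwa [inv_eq_one] at h))

theorem one_sub_inv_ne {x : Fˣ} (hx : (x : F) ≠ 1) : (1 - (x : F)⁻¹) ≠ 0 :=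
  sub_ne_zero.mpr (fun h => hx (by rw [eq_comm, inv_eq_one] at h; exact h.symm ▸ rfl))

variable (F)

/-- The five term relation `S_{x,y}` as an element of the free module. -/
def FT (x y : Fˣ) (hx : (x : F) ≠ 1) (hy : (y : F) ≠ 1) : FreeRP F :=
  gen F x - gen F y + cls F x • gen F (y * x⁻¹)
    - cls F (U F ((x : F)⁻¹ - 1) (inv_sub_one_ne hx)) •
        gen F (U F ((1 - (x : F)⁻¹) / (1 - (y : F)⁻¹))
          (div_ne_zero (one_sub_inv_ne hx) (one_sub_inv_ne hy)))
    + cls F (U F (1 - (x : F)) (one_sub_ne hx)) •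
        gen F (U F ((1 - (x : F)) / (1 - (y : F)))
          (div_ne_zero (one_sub_ne hx) (one_sub_ne hy)))

/-- The set of five-term relations. -/
def ftRels : Set (FreeRP F) :=
  {w | ∃ (x y : Fˣ) (hx : (x : F) ≠ 1) (hy : (y : F) ≠ 1), w = FT F x y hx hy}

/-- The relations `ψ₁(x) = [x] + ⟨-1⟩[x⁻¹]`. -/
def psiRels : Set (FreeRP F) :=
  {w | ∃ x : Fˣ, w = gen F x + cls F (-1) • gen F x⁻¹}

/-- relations `⟨-1⟩[x] = [x]` -/
def minusRels : Set (FreeRP F) :=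
  {w | ∃ x : Fˣ, w = cls F (-1) • gen F x - gen F x}

/-- relations `[x⁻¹] = -[x]` -/
def invRels : Set (FreeRP F) :=
  {w | ∃ x : Fˣ, w = gen F x⁻¹ + gen F x}

/-- The module `qRP(F) = RP(F)/⟨ψ₁(x) : x ∈ F^×⟩`. -/
def qRP : Type := FreeRP F ⧸ Submodule.span (RF F) (ftRels F ∪ psiRels F)

instance : AddCommGroup (qRP F) := by unfold qRP; infer_instance
instance : Module (RF F) (qRP F) := by unfold qRP; infer_instance

/-- `[x] ∈ qRP(F)` -/
def qrp (x : Fˣ) : qRP F := Submodule.Quotient.mk (gen F x)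

/-- The module `RP′(F)`. -/
def RP' : Type :=
  FreeRP F ⧸ Submodule.span (RF F)
    ({gen F 1} ∪ ftRels F ∪ minusRels F ∪ invRels F)

instance : AddCommGroup (RP' F) := by unfold RP'; infer_instance
instance : Module (RF F) (RP' F) := by unfold RP'; infer_instance

/-- `[x] ∈ RP′(F)` -/
def rp (x : Fˣ) : RP' F := Submodule.Quotient.mk (gen F x)

/-- the submodule of `M` generated by the elements `(⟨a⟩ - χ(a))·m`. -/
def chiSub (χ : SqCl F →* ℤˣ) (M : Type) [AddCommGroup M] [Module (RF F) M] :
    Submodule (RF F) M :=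
  Submodule.span (RF F)
    {w | ∃ (a : Fˣ) (m : M), w = cls F a • m - ((χ (sqc F a) : ℤ)) • m}

/-- `M_χ` -/
def ChiQuot (χ : SqCl F →* ℤˣ) (M : Type) [AddCommGroup M] [Module (RF F) M] : Type :=
  M ⧸ chiSub F χ M

instance (χ : SqCl F →* ℤˣ) (M : Type) [AddCommGroup M] [Module (RF F) M] :
    AddCommGroup (ChiQuot F χ M) := by unfold ChiQuot; infer_instance
instance (χ : SqCl F →* ℤˣ) (M : Type) [AddCommGroup M] [Module (RF F) M] :
    Module (RF F) (ChiQuot F χ M) := by unfold ChiQuot; infer_instance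

/-- image of `m` in `M_χ` -/
def mkChi (χ : SqCl F →* ℤˣ) {M : Type} [AddCommGroup M] [Module (RF F) M] (m : M) :
    ChiQuot F χ M := Submodule.Quotient.mk m

/-- `M[1/2]`, as an `R_F`-module (localization at the powers of `2`). -/
def Loc2 (M : Type) [AddCommGroup M] [Module (RF F) M] : Type :=
  LocalizedModule (Submonoid.powers (2 : RF F)) M

instance (M : Type) [AddCommGroup M] [Module (RF F) M] : AddCommGroup (Loc2 F M) := by
  unfold Loc2; infer_instance
instance (M : Type) [AddCommGroup M] [Module (RF F) M] : Module (RF F) (Loc2 F M) := by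
  unfold Loc2; infer_instance

/-- the canonical map `M → M[1/2]` -/
def toLoc2 {M : Type} [AddCommGroup M] [Module (RF F) M] (m : M) : Loc2 F M :=
  LocalizedModule.mkLinearMap (Submonoid.powers (2 : RF F)) M m


/-- the square class of a field element (junk value `1` at `0`). -/
def sqv (a : F) : SqCl F := if h : a ≠ 0 then sqc F (U F a h) else 1

/-- `[a] ∈ RP′(F)` for a field element `a`, where `[0]` is assigned the value `c₀`. -/
def rpc (c₀ : RP' F) (a : F) : RP' F := if h : a ≠ 0 then rp F (U F a h) else c₀


section DiscreteValuationChar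

variable (F : Type) [Field F]

/-- The character `χ_v : G_F → {±1}`, `⟨a⟩ ↦ (-1)^{v(a)}`, associated to a
homomorphism `v : F^× → ℤ`. -/
def chiV (v : Fˣ → ℤ) (hv : ∀ x y : Fˣ, v (x * y) = v x + v y) : SqCl F →* ℤˣ :=
  QuotientGroup.lift _
    { toFun := fun x => (-1 : ℤˣ) ^ (v x)
      map_one' := by
        have h1 : v 1 = v 1 + v 1 := by simpa using (hv 1 1).symm
        have h0 : v 1 = 0 := by omega
        simp [h0]
      map_mul' := fun x y => by simp only [hv, zpow_add] }
    (by
      rintro w ⟨y, rfl⟩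
      show (-1 : ℤˣ) ^ (v (y ^ 2)) = 1
      have : v (y ^ 2) = v y + v y := by rw [pow_two]; exact hv y y
      rw [this, zpow_add]
      exact Int.units_mul_self _)

/-- The set `U_n = 1 + M_v^n ⊆ F^×` for a discrete valuation `v`. -/
def UnSet (v : Fˣ → ℤ) (n : ℕ) : Set Fˣ :=
  {u : Fˣ | (u : F) = 1 ∨ ∃ h : (u : F) - 1 ≠ 0, (n : ℤ) ≤ v (U F ((u : F) - 1) h)}

end DiscreteValuationChar

section PreBloch

variable (k : Type) [Field k]

/-- The plain five-term relation in the free abelian group on `k^×`. -/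
def FTZ (x y : kˣ) (hx : (x : k) ≠ 1) (hy : (y : k) ≠ 1) : kˣ →₀ ℤ :=
  Finsupp.single x 1 - Finsupp.single y 1 + Finsupp.single (y * x⁻¹) 1
    - Finsupp.single (U k ((1 - (x : k)⁻¹) / (1 - (y : k)⁻¹))
        (div_ne_zero (one_sub_inv_ne hx) (one_sub_inv_ne hy))) 1
    + Finsupp.single (U k ((1 - (x : k)) / (1 - (y : k)))
        (div_ne_zero (one_sub_ne hx) (one_sub_ne hy))) 1

/-- The pre-Bloch (scissors congruence) group `P(k)`: generators `[x]`, `x ∈ k^×`,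
relations `[1] = 0` and the five-term relations. -/
def PBloch : Type :=
  (kˣ →₀ ℤ) ⧸ Submodule.span ℤ
    ({Finsupp.single (1 : kˣ) (1 : ℤ)} ∪
      {w | ∃ (x y : kˣ) (hx : (x : k) ≠ 1) (hy : (y : k) ≠ 1), w = FTZ k x y hx hy})

instance : AddCommGroup (PBloch k) := by unfold PBloch; infer_instance

/-- `[x] ∈ P(k)` -/
def pb (x : kˣ) : PBloch k := Submodule.Quotient.mk (Finsupp.single x 1)

end PreBloch

section MainTheorem

/-- `v_p : ℚ^× → ℤ`, the `p`-adic valuation. -/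
def vP (p : Nat.Primes) (x : ℚˣ) : ℤ := padicValRat p (x : ℚ)

theorem vP_mul (p : Nat.Primes) (x y : ℚˣ) : vP p (x * y) = vP p x + vP p y := by
  haveI : Fact (p : ℕ).Prime := ⟨p.2⟩
  unfold vP
  rw [Units.val_mul]
  exact padicValRat.mul x.ne_zero y.ne_zero

/-- The character `χ_p : G_ℚ → {±1}`, `⟨a⟩ ↦ (-1)^{v_p(a)}`. -/
def chiP (p : Nat.Primes) : SqCl ℚ →* ℤˣ := chiV ℚ (vP p) (vP_mul p)

/-- The ring homomorphism `R_ℚ → ℤ` induced by a character `G_ℚ → {±1}`. -/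
def chiRing (χ : SqCl ℚ →* ℤˣ) : RF ℚ →+* ℤ :=
  ((MonoidAlgebra.lift ℤ ℤ (SqCl ℚ)) ((Units.coeHom ℤ).comp χ)).toRingHom

/-- The scissors congruence group `P(F_p)` of the prime field `F_p`, with the usual
conventions for `p = 2` (cyclic of order `3`) and `p = 3` (cyclic of order `4`,
generated by `[-1]`). -/
def PBp (p : Nat.Primes) : Type :=
  if (p : ℕ) = 2 then ZMod 3
  else if (p : ℕ) = 3 then ZMod 4
  else @PBloch (ZMod p) (@ZMod.instField p ⟨p.2⟩)

instance (p : Nat.Primes) : AddCommGroup (PBp p) := by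
  unfold PBp
  split
  · infer_instance
  · split
    · infer_instance
    · infer_instance

/-- The generator `[a] ∈ P(F_p)` attached to `a ∈ F_p` (with `[0] := 0` as a junk
value, `[1] = 0`, and, for `p = 3`, `[-1]` the distinguished generator of `ℤ/4`). -/
def pbK (p : Nat.Primes) : ZMod p → PBp p := by
  unfold PBp
  by_cases h2 : (p : ℕ) = 2
  · rw [if_pos h2]; exact fun _ => 0
  · rw [if_neg h2]
    by_cases h3 : (p : ℕ) = 3
    · rw [if_pos h3]
      exact fun a => if a = 1 then 0 else if a = -1 then 1 else 0
    · rw [if_neg h3]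
      letI : Fact (p : ℕ).Prime := ⟨p.2⟩
      exact fun a => if h : a ≠ 0 then pb (ZMod p) (Units.mk0 a h) else 0

/-- `P(F_p)[1/2]{p}`: the localization of `P(F_p)` away from `2`, equipped below with
the `R_ℚ`-module structure `⟨a⟩·m = (-1)^{v_p(a)}·m`. -/
def Twist (p : Nat.Primes) : Type := LocalizedModule (Submonoid.powers (2 : ℤ)) (PBp p)

instance (p : Nat.Primes) : AddCommGroup (Twist p) := by unfold Twist; infer_instance

noncomputable instance (p : Nat.Primes) : Module (RF ℚ) (Twist p) :=
  Module.compHom _ (chiRing (chiP p))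

/-- the canonical map `P(F_p) → P(F_p)[1/2]{p}` -/
def toTw (p : Nat.Primes) (m : PBp p) : Twist p :=
  LocalizedModule.mkLinearMap (Submonoid.powers (2 : ℤ)) (PBp p) m

/-- reduction of a rational number modulo `p` (the canonical ring map `ℚ → F_p`,
with junk values when `v_p < 0`). -/
def redQ (p : Nat.Primes) (a : ℚ) : ZMod p :=
  letI : Fact (p : ℕ).Prime := ⟨p.2⟩
  (a : ZMod p)

/-- The augmentation map `R_F → ℤ`. -/
def augRF (F : Type) [Field F] : RF F →+* ℤ :=
  ((MonoidAlgebra.lift ℤ ℤ (SqCl F)) 1).toRingHom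

/-- The augmentation ideal `I_F ⊆ R_F`. -/
def augIdeal (F : Type) [Field F] : Ideal (RF F) := RingHom.ker (augRF F)

/-- the odd part `m′ = 2^{-v₂(m)}·m` of a natural number `m` -/
def oddPart (m : ℕ) : ℕ := m / 2 ^ (m.factorization 2)

/-- The submodule `I_ℚ·RP′(ℚ)[1/2]`. -/
def IRPhalf : Submodule (RF ℚ) (Loc2 ℚ (RP' ℚ)) :=
  augIdeal ℚ • (⊤ : Submodule (RF ℚ) (Loc2 ℚ (RP' ℚ)))

end MainTheorem

end


structure Tw {F : Type*} [Field F] {A : Type*} [AddCommGroup A] (χ : F →*₀ ℤ) (b : F → A) :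
    Prop where
  nt : ∀ a : A, a + a = 0 → a = 0
  chi : ∀ x, x ≠ 0 → χ x = 1 ∨ χ x = -1
  chim : χ (-1) = 1
  b1 : b 1 = 0
  binv : ∀ x, x ≠ 0 → b x⁻¹ = - b x
  ft : ∀ x y, x ≠ 0 → x ≠ 1 → y ≠ 0 → y ≠ 1 →
    b x - b y + χ x • b (y / x) - (χ x * χ (1 - x)) • b ((1 - x⁻¹) / (1 - y⁻¹))
      + χ (1 - x) • b ((1 - x) / (1 - y)) = 0

namespace Tw

variable {F : Type*} [Field F] {A : Type*} [AddCommGroup A] {χ : F →*₀ ℤ} {b : F → A}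

theorem chin (h : Tw χ b) (x : F) : χ (-x) = χ x := by
  rw [neg_eq_neg_one_mul, map_mul, h.chim, one_mul]

theorem chisub (h : Tw χ b) (x y : F) : χ (x - y) = χ (y - x) := by
  rw [← h.chin, neg_sub]

theorem chisq (h : Tw χ b) {x : F} (hx : x ≠ 0) : χ x * χ x = 1 := by
  rcases h.chi x hx with e | e <;> rw [e] <;> norm_num

theorem chiinv (h : Tw χ b) (x : F) : χ x⁻¹ = χ x := by
  by_cases hx : x = 0
  · simp [hx]
  have h1 : χ x * χ x⁻¹ = 1 := by rw [← map_mul, mul_inv_cancel₀ hx, map_one]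
  rcases h.chi x hx with e | e <;> rw [e] at h1 ⊢ <;> omega

theorem chidiv (h : Tw χ b) (x y : F) : χ (x / y) = χ x * χ y := by
  rw [div_eq_mul_inv, map_mul, h.chiinv]

theorem nt0 (h : Tw χ b) {a c : A} (e : a + a = c + c) : a = c := by
  rw [← sub_eq_zero]; apply h.nt
  have : a - c + (a - c) = (a + a) - (c + c) := by abel
  rw [this, e, sub_self]

theorem bm1 (h : Tw χ b) : b (-1) = 0 := by
  apply h.nt
  have := h.binv (-1) (by simp)
  rw [show ((-1 : F))⁻¹ = -1 by norm_num] at this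
  nth_rewrite 1 [this]; simp

/-- swapped relation -/
theorem swp (h : Tw χ b) (x y : F) (hx : x ≠ 0) (hx1 : x ≠ 1) (hy : y ≠ 0) (hy1 : y ≠ 1) :
    (χ x - χ y) • b (y / x) - (χ x * χ (1 - x) - χ y * χ (1 - y)) • b ((1 - x⁻¹) / (1 - y⁻¹))
      + (χ (1 - x) - χ (1 - y)) • b ((1 - x) / (1 - y)) = 0 := by
  have e1 := h.ft x y hx hx1 hy hy1
  have e2 := h.ft y x hy hy1 hx hx1
  have i1 : b (x / y) = - b (y / x) := by
    rw [← h.binv _ (div_ne_zero hy hx), inv_div]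
  have hx2 : 1 - x⁻¹ ≠ 0 := sub_ne_zero.2 (fun e => hx1 (by rw [eq_comm, inv_eq_one] at e; exact e))
  have hy2 : 1 - y⁻¹ ≠ 0 := sub_ne_zero.2 (fun e => hy1 (by rw [eq_comm, inv_eq_one] at e; exact e))
  have hx3 : 1 - x ≠ 0 := sub_ne_zero.2 (Ne.symm hx1)
  have hy3 : 1 - y ≠ 0 := sub_ne_zero.2 (Ne.symm hy1)
  have i2 : b ((1 - y⁻¹) / (1 - x⁻¹)) = - b ((1 - x⁻¹) / (1 - y⁻¹)) := by
    rw [← h.binv _ (div_ne_zero hx2 hy2), inv_div]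
  have i3 : b ((1 - y) / (1 - x)) = - b ((1 - x) / (1 - y)) := by
    rw [← h.binv _ (div_ne_zero hx3 hy3), inv_div]
  rw [i1, i2, i3] at e2
  rw [← add_zero (0 : A)]
  nth_rewrite 1 [← e1]
  rw [← e2]
  module

theorem bC (h : Tw χ b) (h2 : (2 : F) ≠ 0) (x : F) (hx : x ≠ 0) (hx1 : x ≠ 1) :
    b x + b (1 - x) = b 2 := by
  have key : ∀ x y : F, x ≠ 0 → x ≠ 1 → y ≠ 0 → y ≠ 1 → b x + b (1 - x) = b y + b (1 - y) := by
    intro x y hx hx1 hy hy1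
    have hx3 : 1 - x ≠ 0 := sub_ne_zero.2 (Ne.symm hx1)
    have hy3 : 1 - y ≠ 0 := sub_ne_zero.2 (Ne.symm hy1)
    have hx4 : x - 1 ≠ 0 := sub_ne_zero.2 (hx1)
    have hy4 : y - 1 ≠ 0 := sub_ne_zero.2 (hy1)
    have e1 := h.ft x y hx hx1 hy hy1
    have e2 := h.ft (1 - y) (1 - x) hy3 (by simpa using hy) hx3 (by simpa using hx)
    have e3 := h.swp x y hx hx1 hy hy1
    have i1 : (1 - (1 - y)⁻¹) / (1 - (1 - x)⁻¹) = (1 - x⁻¹) / (1 - y⁻¹) := by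
      have : 1 - x⁻¹ = (x - 1) / x := by field_simp
      rw [this]
      have : 1 - y⁻¹ = (y - 1) / y := by field_simp
      rw [this]
      have : 1 - (1 - x)⁻¹ = x / (x - 1) := by
        field_simp; ring
      rw [this]
      have : 1 - (1 - y)⁻¹ = y / (y - 1) := by
        field_simp; ring
      rw [this]
      field_simp
    rw [i1, sub_sub_cancel, sub_sub_cancel] at e2
    have : b x + b (1 - x) - (b y + b (1 - y)) = 0 := by
      have e4 : (0 : A) = 0 - 0 - 0 := by simp
      rw [e4]
      nth_rewrite 1 [← e1]
      nth_rewrite 1 [← e2]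
      rw [← e3]
      module
    exact sub_eq_zero.1 this
  rw [key x 2 hx hx1 h2 (fun e => one_ne_zero (α := F) (by linear_combination e))]
  rw [show (1 : F) - 2 = -1 by norm_num, h.bm1, add_zero]

/-- `3C = 0` -/
theorem c3 (h : Tw χ b) (h2 : (2 : F) ≠ 0) : b 2 + b 2 + b 2 = 0 := by
  have e1 := h.bC h2 (2⁻¹) (inv_ne_zero h2) (by rw [Ne, inv_eq_one]; exact fun e => one_ne_zero (α := F) (by linear_combination e))
  rw [show (1 : F) - 2⁻¹ = 2⁻¹ by field_simp; ring, h.binv 2 h2] at e1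
  nth_rewrite 1 [← e1]; abel

/-- Claim 1 -/
theorem bN (h : Tw χ b) (h2 : (2 : F) ≠ 0) (s : F) (hs : χ s = -1) : b s = χ (1 - s) • b 2 := by
  have s0 : ∀ s : F, χ s = -1 → s ≠ 0 := by
    rintro s hs rfl; simp at hs
  have s1 : ∀ s : F, χ s = -1 → s ≠ 1 := by
    rintro s hs rfl; simp at hs
  have key : ∀ s w : F, χ s = -1 → χ w = 1 → χ (1 - s) • b s = χ (1 - s * w) • b (s * w) := by
    intro s w hs hw
    by_cases hw1 : w = 1
    · subst hw1; simp
    have hw0 : w ≠ 0 := by rintro rfl; simp at hw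
    have hsw : χ (s * w) = -1 := by rw [map_mul, hs, hw]; rfl
    have d1 : s * w - 1 ≠ 0 := sub_ne_zero.2 (s1 _ hsw)
    have d2 : w - 1 ≠ 0 := sub_ne_zero.2 hw1
    have d3 : s - 1 ≠ 0 := sub_ne_zero.2 (s1 _ hs)
    have d0 := s0 s hs
    set x := (w - 1) / (s * w - 1) with hx
    have ex : 1 - x = w * (s - 1) / (s * w - 1) := by
      rw [hx, eq_div_iff d1, sub_mul, div_mul_cancel₀ _ d1]; ring
    have ey : 1 - s * x = (s - 1) / (s * w - 1) := by
      rw [hx, eq_div_iff d1, sub_mul, mul_assoc, div_mul_cancel₀ _ d1]; ring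
    have x0 : x ≠ 0 := div_ne_zero d2 d1
    have x1 : 1 - x ≠ 0 := by rw [ex]; exact div_ne_zero (mul_ne_zero hw0 d3) d1
    have y1 : 1 - s * x ≠ 0 := by rw [ey]; exact div_ne_zero d3 d1
    have x1' : x ≠ 1 := fun e => x1 (by rw [e, sub_self])
    have y1' : s * x ≠ 1 := fun e => y1 (by rw [e, sub_self])
    have e := h.swp x (s * x) x0 x1' (mul_ne_zero d0 x0) y1'
    have f1 : s * x / x = s := by field_simp
    have f3 : (1 - x) / (1 - s * x) = w := by
      rw [ex, ey, div_div_div_cancel_right₀ d1, mul_div_assoc, div_self d3, mul_one]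
    have f2 : (1 - x⁻¹) / (1 - (s * x)⁻¹) = s * w := by
      have : 1 - x⁻¹ = - (1 - x) / x := by field_simp; ring
      rw [this]
      have : 1 - (s * x)⁻¹ = - (1 - s * x) / (s * x) := by field_simp; ring
      rw [this, ← f3]
      field_simp
    have cx : χ x = χ (w - 1) * χ (s * w - 1) := by rw [hx, h.chidiv]
    rw [f1, f2, f3, ex, ey] at e
    simp only [h.chidiv, map_mul, cx, hs, hw, one_mul] at e
    rw [h.chisub 1 s, h.chisub 1]
    rcases h.chi _ d1 with g1 | g1 <;> rcases h.chi _ d2 with g2 | g2 <;>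
      rcases h.chi _ d3 with g3 | g3 <;> rw [g1, g2, g3] at e <;> rw [g1, g3] <;>
      apply h.nt0 <;> first
        | linear_combination (norm := module) e
        | linear_combination (norm := module) (-1 : ℤ) • e
  -- the value of the constant
  have main : ∀ u : F, χ u = -1 → χ (1 - u) = -1 → χ (1 - u) • b u = b 2 := by
    intro u hu hu1
    have e1 := h.bC h2 u (s0 u hu) (s1 u hu)
    have e2 := key u ((1 - u) / u) hu (by rw [h.chidiv, hu, hu1]; rfl)
    rw [mul_div_cancel₀ _ (s0 u hu), sub_sub_cancel, hu1, hu] at e2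
    rw [hu1]
    simp only [neg_smul, one_smul, neg_inj] at e2 ⊢
    rw [← e2] at e1
    have e3 := h.c3 h2
    rw [← sub_eq_zero]
    have : -b u - b 2 = 0 - (b 2 + b 2 + b 2) + ((b 2 + b 2) - b u) := by abel
    apply h.nt
    have : -b u - b 2 + (-b u - b 2) = - (b 2 + b 2 + b 2) + (b 2 - (b u + b u)) := by abel
    rw [this, e3, e1]; simp
  have fin : χ (1 - s) • b s = b 2 := by
    rcases h.chi (1 - s) (sub_ne_zero.2 (s1 s hs).symm) with g | g
    · have hi : χ s⁻¹ = -1 := by rw [h.chiinv, hs]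
      have hi1 : χ (1 - s⁻¹) = -1 := by
        have : 1 - s⁻¹ = (s - 1) / s := by have := s0 s hs; field_simp
        rw [this, h.chidiv, h.chisub, g, hs]; rfl
      have := main _ hi hi1
      rw [hi1, h.binv s (s0 s hs)] at this
      rw [g]; simpa using this
    · exact main s hs g
  rcases h.chi (1 - s) (sub_ne_zero.2 (s1 s hs).symm) with g | g <;> rw [g] at fin ⊢
  · simpa using fin
  · rw [← fin]; simp

end Tw


namespace Tw

variable {F : Type*} [Field F] {A : Type*} [AddCommGroup A] {χ : F →*₀ ℤ} {b : F → A}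

theorem n0 {s : F} (hs : χ s = -1) : s ≠ 0 := by rintro rfl; simp at hs
theorem t0 {s : F} (hs : χ s = 1) : s ≠ 0 := by rintro rfl; simp at hs
theorem n1 {s : F} (hs : χ s = -1) : s ≠ 1 := by rintro rfl; simp at hs

theorem chioi (h : Tw χ b) {x : F} (hx : x ≠ 0) : χ (1 - x⁻¹) = χ (1 - x) * χ x := by
  rw [show 1 - x⁻¹ = (x - 1) / x by field_simp, h.chidiv, h.chisub]

theorem bT (h : Tw χ b) (h2 : (2 : F) ≠ 0) (t : F) (ht : χ t = 1) (ht1 : χ (1 - t) = -1) :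
    b t = 0 := by
  have e1 := h.bC h2 t (t0 ht) (fun e => by simp [e] at ht1)
  have e2 := h.bN h2 (1 - t) ht1
  rw [sub_sub_cancel, ht, one_smul] at e2
  rw [e2] at e1
  simpa using e1

theorem L4a (h : Tw χ b) (h2 : (2 : F) ≠ 0) (hC : b 2 ≠ 0) (x y : F) (hx : χ x = -1)
    (hx1 : χ (1 - x) = 1) (hy : χ y = -1) (hy1 : χ (1 - y) = 1) : χ (1 - x * y) ≠ -1 := by
  intro hxy
  have x0 := n0 hx
  have y0 := n0 hy
  have d1 : 1 - y ≠ 0 := t0 hy1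
  have d2 : 1 - x ≠ 0 := t0 hx1
  have d3 : 1 - x * y ≠ 0 := n0 hxy
  have d4 : x * y - 1 ≠ 0 := by rw [← neg_sub]; exact neg_ne_zero.2 d3
  have d5 : y - 1 ≠ 0 := by rw [← neg_sub]; exact neg_ne_zero.2 d1
  have e := h.ft x y⁻¹ x0 (n1 hx) (inv_ne_zero y0) (fun e => n1 hy (inv_eq_one.1 e))
  rw [inv_inv] at e
  have b1 : b x = b 2 := by rw [h.bN h2 x hx, hx1, one_smul]
  have b2 : b y⁻¹ = - b 2 := by rw [h.binv y y0, h.bN h2 y hy, hy1, one_smul]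
  have b3 : b (y⁻¹ / x) = 0 := by
    apply h.bT h2
    · rw [h.chidiv, h.chiinv, hx, hy]; rfl
    · rw [show 1 - y⁻¹ / x = (x * y - 1) / (x * y) by field_simp, h.chidiv, h.chisub, hxy,
        map_mul, hx, hy]; rfl
  have b4 : b ((1 - x⁻¹) / (1 - y)) = b 2 := by
    rw [h.bN h2]
    · rw [show 1 - (1 - x⁻¹) / (1 - y) = (1 - x * y) / (x * (1 - y)) by
        field_simp; ring, h.chidiv, hxy, map_mul, hx, hy1]; simp
    · rw [h.chidiv, h.chioi x0, hx, hx1, hy1]; rfl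
  have b5 : b ((1 - x) / (1 - y⁻¹)) = - b 2 := by
    rw [h.bN h2]
    · rw [show (1 - x) / (1 - y⁻¹) = y * (1 - x) / (y - 1) by
        rw [show 1 - y⁻¹ = (y - 1) / y by field_simp]; field_simp,
        show 1 - y * (1 - x) / (y - 1) = (x * y - 1) / (y - 1) by field_simp; ring,
        h.chidiv, h.chisub, hxy, h.chisub, hy1]; simp
    · rw [h.chidiv, h.chioi y0, hx1, hy, hy1]; rfl
  rw [b1, b2, b3, b4, b5, hx, hx1] at e
  apply hC
  apply h.nt
  rw [← e]; module

theorem L4i (h : Tw χ b) (h2 : (2 : F) ≠ 0) (hC : b 2 = 0) (z x : F) (hz : χ z = 1)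
    (hz1 : χ (1 - z) = 1) (hx : χ x = -1) (hne : χ (1 - x) ≠ χ (z - x)) : b z = 0 := by
  have x0 := n0 hx
  have z0 := t0 hz
  have d1 : 1 - z ≠ 0 := t0 hz1
  have d2 : 1 - x ≠ 0 := sub_ne_zero.2 (n1 hx).symm
  have d5 : z - 1 ≠ 0 := by rw [← neg_sub]; exact neg_ne_zero.2 d1
  have d6 : z - x ≠ 0 := by
    rw [sub_ne_zero]; rintro rfl; rw [hz] at hx; norm_num at hx
  have z1 : z ≠ 1 := sub_ne_zero.1 d5
  have e := h.ft x z x0 (n1 hx) z0 z1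
  have N0 : ∀ s, χ s = -1 → b s = 0 := fun s hs => by rw [h.bN h2 s hs, hC, smul_zero]
  have b3 : b (z / x) = 0 := N0 _ (by rw [h.chidiv, hz, hx]; rfl)
  have cw' : χ ((1 - x⁻¹) / (1 - z⁻¹)) = - χ (1 - x) := by
    rw [h.chidiv, h.chioi x0, h.chioi z0, hx, hz, hz1]; ring
  have cw : χ ((1 - x) / (1 - z)) = χ (1 - x) := by
    rw [h.chidiv, hz1]; ring
  have cw1' : χ (1 - (1 - x⁻¹) / (1 - z⁻¹)) = - χ (z - x) := by
    rw [show 1 - z⁻¹ = (z - 1) / z by field_simp,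
      show 1 - (1 - x⁻¹) / ((z - 1) / z) = (z - x) / (x * (z - 1)) by field_simp; ring,
        h.chidiv, map_mul, hx, h.chisub z 1, hz1]; ring
  have cw1 : χ (1 - (1 - x) / (1 - z)) = χ (z - x) := by
    rw [show 1 - (1 - x) / (1 - z) = (x - z) / (1 - z) by field_simp; ring,
        h.chidiv, hz1, h.chisub]; ring
  have b4 : b ((1 - x⁻¹) / (1 - z⁻¹)) = 0 ∧ b ((1 - x) / (1 - z)) = 0 := by
    rcases h.chi _ d2 with g | g
    · have g' : χ (z - x) = -1 := by
        rcases h.chi _ d6 with g' | g'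
        · rw [g, g'] at hne; exact absurd rfl hne
        · exact g'
      exact ⟨N0 _ (by rw [cw', g]), h.bT h2 _ (by rw [cw, g]) (by rw [cw1, g'])⟩
    · have g' : χ (z - x) = 1 := by
        rcases h.chi _ d6 with g' | g'
        · exact g'
        · rw [g, g'] at hne; exact absurd rfl hne
      exact ⟨h.bT h2 _ (by rw [cw', g]; rfl) (by rw [cw1', g']), N0 _ (by rw [cw, g])⟩
  rw [b4.1, b4.2, b3, N0 x hx] at e
  simpa using e

theorem L4ii (h : Tw χ b) (h2 : (2 : F) ≠ 0) (hC : b 2 = 0) (k z : F) (hk : χ k = 1)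
    (hk1 : χ (1 - k) = -1) (z0 : z ≠ 0) (hb : b z ≠ 0) : b (k * z) ≠ 0 := by
  have N0 : ∀ s, χ s = -1 → b s = 0 := fun s hs => by rw [h.bN h2 s hs, hC, smul_zero]
  have hz : χ z = 1 := by
    rcases h.chi z z0 with g | g
    · exact g
    · exact absurd (N0 z g) hb
  have z1 : z ≠ 1 := fun e => hb (by rw [e, h.b1])
  have hz1 : χ (1 - z) = 1 := by
    rcases h.chi (1 - z) (sub_ne_zero.2 z1.symm) with g | g
    · exact g
    · exact absurd (h.bT h2 z hz g) hb
  have k0 := t0 hk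
  have k1 : k ≠ 1 := fun e => by simp [e] at hk1
  have bk : b k = 0 := h.bT h2 k hk hk1
  have main : ∀ k z : F, χ k = 1 → χ (1 - k) = -1 → χ z = 1 → χ (1 - k * z) = 1 →
      b (k * z) = b z := by
    intro k z hk hk1 hz hkz
    have k0 := t0 hk
    have z0 := t0 hz
    have k1 : k ≠ 1 := fun e => by simp [e] at hk1
    have kz1 : k * z ≠ 1 := fun e => by simp [e] at hkz
    have e := h.ft k (k * z) k0 k1 (mul_ne_zero k0 z0) kz1
    rw [h.bT h2 k hk hk1, N0 ((1 - k⁻¹) / (1 - (k * z)⁻¹)) (by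
        rw [h.chidiv, h.chioi k0, h.chioi (mul_ne_zero k0 z0), map_mul, hk, hk1, hkz, hz]; rfl),
      N0 ((1 - k) / (1 - k * z)) (by rw [h.chidiv, hk1, hkz]; rfl), hk,
      mul_div_cancel_left₀ _ k0] at e
    simp only [one_smul, smul_zero, add_zero, sub_zero, zero_sub] at e
    rw [← sub_eq_zero, ← neg_eq_zero, ← e]; abel
  by_cases c : k * z = 1
  · exfalso
    have : z = k⁻¹ := eq_inv_of_mul_eq_one_right c
    rw [this, h.binv k k0, bk] at hb
    simp at hb
  rcases h.chi (1 - k * z) (sub_ne_zero.2 (Ne.symm c)) with g | g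
  · rw [main k z hk hk1 hz g]; exact hb
  · have := main k⁻¹ (k * z) (by rw [h.chiinv, hk]) (by rw [h.chioi k0, hk, hk1]; rfl)
      (by rw [map_mul, hk, hz]; rfl) (by rw [inv_mul_cancel_left₀ k0, hz1])
    rw [inv_mul_cancel_left₀ k0] at this
    rw [← this]; exact hb

theorem L4 (h : Tw χ b) (h2 : (2 : F) ≠ 0) (z : F) (z0 : z ≠ 0) (hb : b z ≠ 0)
    (x y : F) (hx : χ x = -1)
    (hx1 : χ (1 - x) = 1) (hy : χ y = -1) (hy1 : χ (1 - y) = 1) : χ (1 - x * y) = 1 := by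
  have x0 := n0 hx
  have y0 := n0 hy
  have xy1 : x * y ≠ 1 := by
    intro e
    have : y = x⁻¹ := eq_inv_of_mul_eq_one_right e
    rw [this, h.chioi x0, hx, hx1] at hy1
    norm_num at hy1
  rcases h.chi (1 - x * y) (sub_ne_zero.2 xy1.symm) with g | g
  · exact g
  exfalso
  by_cases hC : b 2 = 0
  swap
  · exact h.L4a h2 hC x y hx hx1 hy hy1 g
  have N0 : ∀ s, χ s = -1 → b s = 0 := fun s hs => by rw [h.bN h2 s hs, hC, smul_zero]
  have hxy : χ (x * y) = 1 := by rw [map_mul, hx, hy]; rfl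
  have hk := h.L4ii h2 hC (x * y) z hxy g z0 hb
  have main : ∀ k u : F, k ≠ 0 → b k ≠ 0 → χ u = -1 → χ k = 1 ∧ χ (1 - u) = χ (k - u) := by
    intro k u k0 hb hu
    have hz : χ k = 1 := by
      rcases h.chi k k0 with g | g
      · exact g
      · exact absurd (N0 k g) hb
    have z1 : k ≠ 1 := fun e => hb (by rw [e, h.b1])
    have hz1 : χ (1 - k) = 1 := by
      rcases h.chi (1 - k) (sub_ne_zero.2 z1.symm) with g | g
      · exact g
      · exact absurd (h.bT h2 k hz g) hb
    by_contra hne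
    have : χ (1 - u) ≠ χ (k - u) := fun e => hne ⟨hz, e⟩
    exact hb (h.L4i h2 hC k u hz hz1 hu this)
  obtain ⟨c1, c2⟩ := main _ x (mul_ne_zero (mul_ne_zero x0 y0) z0) hk hx
  obtain ⟨c3, c4⟩ := main _ y⁻¹ z0 hb (by rw [h.chiinv, hy])
  rw [show x * y * z - x = x * y * (z - y⁻¹) by field_simp, map_mul, hxy, one_mul, hx1] at c2
  rw [← c2, h.chioi y0, hy, hy1] at c4
  norm_num at c4

end Tw


/-- abstract rigidity of the character -/
theorem chi_padic (χ : ℚ →*₀ ℤ) (hχ : ∀ x, x ≠ 0 → χ x = 1 ∨ χ x = -1) (hm : χ (-1) = 1)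
    (V : ∀ x y, χ x = -1 → χ (1 - x) = 1 → χ y = -1 → χ (1 - y) = 1 → χ (1 - x * y) = 1)
    (hne : ∃ x, χ x = -1) :
    ∃ p : ℕ, p.Prime ∧ ∀ x, x ≠ 0 → χ x = (((-1 : ℤˣ) ^ (padicValRat p x) : ℤˣ) : ℤ) := by
  have chin : ∀ x, χ (-x) = χ x := fun x => by
    rw [neg_eq_neg_one_mul, map_mul, hm, one_mul]
  have chisub : ∀ x y, χ (x - y) = χ (y - x) := fun x y => by rw [← chin, neg_sub]
  have chiinv : ∀ x, χ x⁻¹ = χ x := by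
    intro x
    by_cases hx : x = 0
    · simp [hx]
    have h1 : χ x * χ x⁻¹ = 1 := by rw [← map_mul, mul_inv_cancel₀ hx, map_one]
    rcases hχ x hx with e | e <;> rw [e] at h1 ⊢ <;> omega
  have chidiv : ∀ x y, χ (x / y) = χ x * χ y := fun x y => by
    rw [div_eq_mul_inv, map_mul, chiinv]
  obtain ⟨P, hP⟩ : ∃ P : ℚ → Prop, ∀ x, P x ↔ (χ x = -1 ∧ χ (1 - x) = 1) := ⟨_, fun _ => Iff.rfl⟩
  have V' : ∀ x y, P x → P y → χ (1 - x * y) = 1 := by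
    intro x y hx hy
    rw [hP] at hx hy
    exact V x y hx.1 hx.2 hy.1 hy.2
  have nz : ∀ {x}, P x → 1 - x ≠ 0 := by
    intro x hx e
    rw [hP, e] at hx; simp at hx
  have Pneg : ∀ x, P x → P (-x) := by
    intro x hx
    have h1 := V' x x hx hx
    rw [hP] at hx ⊢
    refine ⟨by rw [chin, hx.1], ?_⟩
    rw [show 1 - x * x = (1 - x) * (1 - -x) by ring, map_mul, hx.2, one_mul] at h1
    exact h1
  have Pq : ∀ x, P x → P (x / (x - 1)) := by
    intro x hx
    have h0 := nz hx
    have h0' : x - 1 ≠ 0 := by rw [← neg_sub]; exact neg_ne_zero.2 h0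
    rw [hP] at hx ⊢
    refine ⟨by rw [chidiv, hx.1, chisub, hx.2]; rfl, ?_⟩
    rw [show 1 - x / (x - 1) = (-1) / (x - 1) by field_simp; ring, chidiv, hm, chisub, hx.2]; rfl
  have Pm : ∀ x y, P x → P y → P (y * (1 - x)) := by
    intro x y hx hy
    have h1 := V' x _ hx (Pq _ hy)
    have h0 := nz hy
    have h0' : y - 1 ≠ 0 := by rw [← neg_sub]; exact neg_ne_zero.2 h0
    rw [hP] at hx hy ⊢
    refine ⟨by rw [map_mul, hy.1, hx.2]; rfl, ?_⟩
    rw [show 1 - y * (1 - x) = (1 - y) * (1 - x * (y / (y - 1))) by field_simp; ring, map_mul, h1,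
      hy.2]; rfl
  have Pd : ∀ x y, P x → P y → P (y / (1 - x)) := by
    intro x y hx hy
    have h1 := Pm _ y (Pq _ hx) hy
    have h0 := nz hx
    have h0' : x - 1 ≠ 0 := by rw [← neg_sub]; exact neg_ne_zero.2 h0
    convert h1 using 1
    rw [show 1 - x / (x - 1) = 1 / (1 - x) by field_simp; ring]; ring
  have two : ∀ x y, P x → P y → χ (1 - x - y) = 1 := by
    intro x y hx hy
    have h1 := Pd x y hx hy
    have h0 := nz hx
    rw [show 1 - x - y = (1 - x) * (1 - y / (1 - x)) by field_simp, map_mul, ((hP _).1 h1).2,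
      ((hP _).1 hx).2]; rfl
  have three : ∀ x y z, P x → P y → P z → χ (1 - x - y - z) = 1 := by
    intro x y z hx hy hz
    have h1 := two _ _ (Pd x y hx hy) (Pd x z hx hz)
    have h0 := nz hx
    rw [show 1 - x - y - z = (1 - x) * (1 - y / (1 - x) - z / (1 - x)) by field_simp, map_mul, h1,
      ((hP _).1 hx).2]; rfl
  have exn : ∃ n : ℕ, χ (n : ℚ) = -1 := by
    obtain ⟨x, hx⟩ := hne
    have x0 : x ≠ 0 := by rintro rfl; simp at hx
    rw [← Rat.num_div_den x, chidiv] at hx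
    have hna : χ (x.num : ℚ) = χ ((x.num.natAbs : ℕ) : ℚ) := by
      rcases Int.natAbs_eq x.num with e | e
      · nth_rewrite 1 [e]; simp only [Int.cast_natCast]
      · nth_rewrite 1 [e]; simp only [Int.cast_neg, Int.cast_natCast, chin]
    by_cases c : χ (x.den : ℚ) = -1
    · exact ⟨_, c⟩
    · have : χ (x.den : ℚ) = 1 := (hχ _ (by simp)).resolve_right c
      rw [this, mul_one, hna] at hx
      exact ⟨_, hx⟩
  classical
  set p := Nat.find exn with hp
  have hp1 : χ (p : ℚ) = -1 := Nat.find_spec exn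
  have hmin : ∀ m : ℕ, 1 ≤ m → m < p → χ (m : ℚ) = 1 := by
    intro m h1 hmp
    have := Nat.find_min exn hmp
    exact (hχ _ (by exact_mod_cast (by omega : m ≠ 0))).resolve_right this
  have p2 : 2 ≤ p := by
    by_contra hlt
    have : p = 0 ∨ p = 1 := by omega
    rcases this with e | e <;> rw [e] at hp1 <;> simp at hp1
  have pp : p.Prime := by
    rw [Nat.prime_def_lt]
    refine ⟨p2, fun m hm hd => ?_⟩
    obtain ⟨c, hc⟩ := hd
    by_contra m1
    have m0 : m ≠ 0 := by rintro rfl; omega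
    have c0 : c ≠ 0 := by rintro rfl; omega
    have hc' : c < p := by
      rw [hc]
      have : 2 ≤ m := by omega
      nlinarith [Nat.pos_of_ne_zero c0]
    rw [hc, Nat.cast_mul, map_mul, hmin m (by omega) hm, hmin c (by omega) hc'] at hp1
    norm_num at hp1
  have Pp : P p := by
    rw [hP]; refine ⟨hp1, ?_⟩
    rw [chisub]
    have := hmin (p - 1) (by omega) (by omega)
    rwa [Nat.cast_sub (by omega), Nat.cast_one] at this
  have Q : ∀ m : ℕ, ¬ p ∣ m → χ (m : ℚ) = 1 ∧ ∀ y, P y → P (m * y) := by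
    intro m
    induction m using Nat.strong_induction_on with
    | _ m ih =>
    intro hpm
    have m1 : 1 ≤ m := Nat.one_le_iff_ne_zero.2 (by rintro rfl; simp at hpm)
    have h1 : χ (m : ℚ) = 1 := by
      by_cases hlt : m < p
      · exact hmin m m1 hlt
      have hmp : p < m := lt_of_le_of_ne (not_lt.1 hlt) (by rintro e; apply hpm; rw [← e])
      have : Fact p.Prime := ⟨pp⟩
      have hmz : (m : ZMod p) ≠ 0 := by rwa [Ne, ZMod.natCast_eq_zero_iff]
      set j := ((m : ZMod p)⁻¹).val with hj
      have hjp : j < p := ZMod.val_lt _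
      have hj0 : j ≠ 0 := by rw [hj, Ne, ZMod.val_eq_zero]; exact inv_ne_zero hmz
      have hjm : ((j * m : ℕ) : ZMod p) = ((1 : ℕ) : ZMod p) := by
        rw [Nat.cast_mul, hj, ZMod.natCast_zmod_val, inv_mul_cancel₀ hmz, Nat.cast_one]
      have hge : 1 ≤ j * m := Nat.mul_pos (Nat.pos_of_ne_zero hj0) m1
      have hd : p ∣ j * m - 1 := by
        rw [← Nat.modEq_iff_dvd' hge]
        exact ((ZMod.natCast_eq_natCast_iff _ _ _).1 hjm).symm
      obtain ⟨c, hc⟩ := hd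
      have hc' : j * m = 1 + p * c := by omega
      have c1 : 1 ≤ c := by
        rcases Nat.eq_zero_or_pos c with e | e
        · rw [e] at hc'
          have : m ≤ j * m := Nat.le_mul_of_pos_left _ (Nat.pos_of_ne_zero hj0)
          omega
        · exact e
      have cm : c < m := by
        by_contra hle
        have h1 : p * m ≤ p * c := Nat.mul_le_mul_left _ (not_lt.1 hle)
        have h2 : j * m ≤ p * m := Nat.mul_le_mul_right _ hjp.le
        omega
      have key : χ (1 + (p : ℚ) * c) = 1 := by
        by_cases hpc : p ∣ c
        · have hpc' : ¬ p ∣ (c - 1) := by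
            intro hd
            have := (Nat.dvd_sub hpc hd)
            rw [Nat.sub_sub_self c1] at this
            exact pp.one_lt.ne' (Nat.dvd_one.1 this)
          have := (ih (c - 1) (by omega) hpc').2 p Pp
          have := two _ _ (Pneg _ this) (Pneg _ Pp)
          rw [Nat.cast_sub c1] at this
          rw [← this]; congr 1; push_cast; ring
        · have := (ih c cm hpc).2 p Pp
          have := ((hP _).1 (Pneg _ this)).2
          rw [← this]; congr 1; ring
      have : χ ((j * m : ℕ) : ℚ) = 1 := by rw [hc']; push_cast; exact key
      rw [Nat.cast_mul, map_mul, hmin j (by omega) hjp, one_mul] at this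
      exact this
    refine ⟨h1, fun y hy => ?_⟩
    have hN : χ (m * y) = -1 := by rw [map_mul, h1, ((hP _).1 hy).1]; rfl
    rw [hP]; refine ⟨hN, ?_⟩
    by_cases m1' : m = 1
    · subst m1'; simpa using ((hP _).1 hy).2
    by_cases hpm1 : p ∣ m - 1
    · have hm1 : p ≤ m - 1 := Nat.le_of_dvd (by omega) hpm1
      have hpm2 : ¬ p ∣ m - 2 := by
        intro hd
        have := Nat.dvd_sub hpm1 hd
        rw [show m - 1 - (m - 2) = 1 by omega] at this
        exact pp.one_lt.ne' (Nat.dvd_one.1 this)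
      have := three _ _ _ ((ih (m - 2) (by omega) hpm2).2 y hy) hy hy
      rw [Nat.cast_sub (by omega)] at this
      rw [← this]; congr 1; push_cast; ring
    · have := two _ _ ((ih (m - 1) (by omega) hpm1).2 y hy) hy
      rw [Nat.cast_sub (by omega)] at this
      rw [← this]; congr 1; push_cast; ring
  have : Fact p.Prime := ⟨pp⟩
  have hnat : ∀ n : ℕ, n ≠ 0 → χ (n : ℚ) = (-1) ^ (padicValNat p n) := by
    intro n hn
    obtain ⟨e, n', hn', rfl⟩ := Nat.exists_eq_pow_mul_and_not_dvd hn p pp.ne_one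
    have : n' ≠ 0 := by rintro rfl; simp at hn'
    rw [padicValNat.mul (pow_ne_zero _ pp.ne_zero) this, padicValNat.prime_pow,
      padicValNat.eq_zero_of_not_dvd hn', add_zero]
    push_cast
    rw [map_mul, map_pow, hp1, (Q n' hn').1, mul_one]
  refine ⟨p, pp, fun x hx => ?_⟩
  have hna : χ (x.num : ℚ) = χ ((x.num.natAbs : ℕ) : ℚ) := by
    rcases Int.natAbs_eq x.num with e | e
    · nth_rewrite 1 [e]; simp only [Int.cast_natCast]
    · nth_rewrite 1 [e]; simp only [Int.cast_neg, Int.cast_natCast, chin]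
  nth_rewrite 1 [← Rat.num_div_den x]
  rw [chidiv, hna, hnat _ (by simpa using hx), hnat _ x.den_nz, padicValRat_def, padicValInt,
    zpow_sub, zpow_natCast, zpow_natCast]
  push_cast
  simp


namespace Tw

variable {A : Type*} [AddCommGroup A] {χ : ℚ →*₀ ℤ} {b : ℚ → A}
variable {p : ℕ} [hpp : Fact p.Prime]

theorem nm_val {z : ℚ} (hz : z ≠ 0) : padicNorm p z = (p : ℚ) ^ (- padicValRat p z) :=
  padicNorm.eq_zpow_of_nonzero hz

theorem nm_lt {z : ℚ} (hz : z ≠ 0) : padicNorm p z < 1 ↔ 0 < padicValRat p z := by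
  have h1 : (1 : ℚ) < p := by exact_mod_cast hpp.out.one_lt
  rw [nm_val hz, zpow_lt_one_iff_right₀ h1]; omega

theorem nm_one {z : ℚ} (hz : z ≠ 0) : padicNorm p z = 1 ↔ padicValRat p z = 0 := by
  have h1 : (1 : ℚ) < p := by exact_mod_cast hpp.out.one_lt
  have h0 : (0 : ℚ) < p := by linarith
  rw [nm_val hz, zpow_eq_one_iff_right₀ h0.le h1.ne']; omega

theorem nm_one_ne {z : ℚ} (h : padicNorm p z = 1) : z ≠ 0 := by
  rintro rfl; simp at h

theorem nm_os {z : ℚ} (h : padicNorm p z < 1) : padicNorm p (1 - z) = 1 := by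
  rw [sub_eq_add_neg, padicNorm.add_eq_max_of_ne, padicNorm.neg, padicNorm.one, max_eq_left h.le]
  rw [padicNorm.neg, padicNorm.one]; exact h.ne'

theorem nm_sub {y z : ℚ} (h : padicNorm p y < 1) (h' : padicNorm p z < 1) :
    padicNorm p (y - z) < 1 :=
  lt_of_le_of_lt padicNorm.sub (max_lt h h')

theorem nm_sub' (y z : ℚ) : padicNorm p (y - z) = padicNorm p (z - y) := by
  rw [← padicNorm.neg, neg_sub]

section
variable (h : Tw χ b) (hχ : ∀ x, x ≠ 0 → χ x = (((-1 : ℤˣ) ^ (padicValRat p x) : ℤˣ) : ℤ))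
include h hχ

theorem chi_nm {z : ℚ} (hz : padicNorm p z = 1) : χ z = 1 := by
  rw [hχ z (nm_one_ne hz), (nm_one (nm_one_ne hz)).1 hz]; simp

theorem chi_odd {z : ℚ} (hz : z ≠ 0) (ho : Odd (padicValRat p z)) : χ z = -1 := by
  rw [hχ z hz, ho.neg_one_zpow]; rfl

theorem bpos {z : ℚ} (hz : z ≠ 0) (hv : padicNorm p z < 1) : b z = b 2 := by
  have odd : ∀ z : ℚ, z ≠ 0 → padicNorm p z < 1 → Odd (padicValRat p z) → b z = b 2 := by
    intro z hz hv ho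
    rw [h.bN two_ne_zero z (h.chi_odd hχ hz ho), h.chi_nm hχ (nm_os hv), one_smul]
  rcases Int.even_or_odd (padicValRat p z) with he | ho
  swap
  · exact odd z hz hv ho
  have p0 : (p : ℚ) ≠ 0 := by exact_mod_cast hpp.out.ne_zero
  have vp : padicValRat p (p : ℚ) = 1 := padicValRat.self hpp.out.one_lt
  have np : padicNorm p (p : ℚ) < 1 := padicNorm.padicNorm_p_lt_one_of_prime
  have p1 : (p : ℚ) ≠ 1 := by exact_mod_cast hpp.out.one_lt.ne'
  have z1 : z ≠ 1 := by rintro rfl; simp at hv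
  have zp : z ≠ p := by
    rintro rfl; rw [vp] at he; exact (by decide : ¬ Even (1 : ℤ)) he
  have e := h.ft p z p0 p1 hz z1
  have hvz := (nm_lt hz).1 hv
  have hz1 := nm_os hv
  have hp1 := nm_os np
  have d1 := nm_one_ne hz1
  have d2 := nm_one_ne hp1
  have d1' : z - 1 ≠ 0 := sub_ne_zero.2 z1
  have d2' : (p : ℚ) - 1 ≠ 0 := sub_ne_zero.2 p1
  have v1 : padicValRat p (1 - z) = 0 := (nm_one d1).1 hz1
  have v2 : padicValRat p (1 - (p : ℚ)) = 0 := (nm_one d2).1 hp1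
  have v1' : padicValRat p (z - 1) = 0 := by rw [← neg_sub, padicValRat.neg, v1]
  have v2' : padicValRat p ((p : ℚ) - 1) = 0 := by rw [← neg_sub, padicValRat.neg, v2]
  have w1 : padicValRat p (z / p) = padicValRat p z - 1 := by
    rw [padicValRat.div hz p0, vp]
  have w2 : padicValRat p ((1 - (p : ℚ)⁻¹) / (1 - z⁻¹)) = padicValRat p z - 1 := by
    rw [show (1 - (p : ℚ)⁻¹) / (1 - z⁻¹) = (z * (p - 1)) / (p * (z - 1)) by
      rw [show 1 - z⁻¹ = (z - 1) / z by field_simp, show 1 - (p : ℚ)⁻¹ = (p - 1) / p by field_simp]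
      field_simp]
    rw [padicValRat.div (mul_ne_zero hz d2') (mul_ne_zero p0 d1'), padicValRat.mul hz d2',
      padicValRat.mul p0 d1', v1', v2', vp]; ring
  have n1 : (1 - (p : ℚ)⁻¹) / (1 - z⁻¹) ≠ 0 := by
    rw [show 1 - z⁻¹ = (z - 1) / z by field_simp, show 1 - (p : ℚ)⁻¹ = (p - 1) / p by field_simp]
    exact div_ne_zero (div_ne_zero d2' p0) (div_ne_zero d1' hz)
  have hge : 0 < padicValRat p z - 1 := by
    obtain ⟨k, hk⟩ := he; omega
  have hodd : Odd (padicValRat p z - 1) := by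
    obtain ⟨k, hk⟩ := he; exact ⟨k - 1, by omega⟩
  rw [odd p p0 np (by rw [vp]; exact odd_one), odd (z / p) (div_ne_zero hz p0)
      ((nm_lt (div_ne_zero hz p0)).2 (by rw [w1]; exact hge)) (by rw [w1]; exact hodd),
    odd _ n1 ((nm_lt n1).2 (by rw [w2]; exact hge)) (by rw [w2]; exact hodd),
    h.chi_odd hχ p0 (by rw [vp]; exact odd_one), h.chi_nm hχ hp1,
    h.bT two_ne_zero ((1 - (p : ℚ)) / (1 - z)) (by
      rw [h.chidiv, h.chi_nm hχ hp1, h.chi_nm hχ hz1]; rfl) (by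
      rw [show 1 - (1 - (p : ℚ)) / (1 - z) = (p - z) / (1 - z) by field_simp; ring, h.chidiv,
        h.chi_nm hχ hz1, mul_one]
      apply h.chi_odd hχ (sub_ne_zero.2 zp.symm)
      have : (p : ℚ) - z = p * (1 - z / p) := by field_simp
      have nzp : padicNorm p (z / p) < 1 := (nm_lt (div_ne_zero hz p0)).2 (by rw [w1]; exact hge)
      have n3 := nm_os nzp
      rw [this, padicValRat.mul p0 (nm_one_ne n3), vp, (nm_one (nm_one_ne n3)).1 n3]
      exact odd_one)] at e
  rw [← sub_eq_zero, ← neg_eq_zero, ← e]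
  module

theorem bneg {z : ℚ} (hz : z ≠ 0) (hv : padicValRat p z < 0) : b z = - b 2 := by
  have := h.bpos hχ (inv_ne_zero hz) ((nm_lt (inv_ne_zero hz)).2 (by rw [padicValRat.inv]; omega))
  rw [h.binv z hz] at this
  rw [← this, neg_neg]

theorem bunit {u : ℚ} (hu : padicNorm p (1 - u) < 1) : b u = 0 := by
  by_cases u1 : u = 1
  · rw [u1, h.b1]
  have u0 : u ≠ 0 := by rintro rfl; simp at hu
  have e := h.bC two_ne_zero u u0 u1
  rw [h.bpos hχ (sub_ne_zero.2 (Ne.symm u1)) hu] at e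
  simpa using e

theorem bcong {x y : ℚ} (hx : padicNorm p x = 1) (hy : padicNorm p y = 1)
    (hxy : padicNorm p (x - y) < 1) : b x = b y := by
  by_cases c : padicNorm p (1 - x) < 1
  · rw [h.bunit hχ c, h.bunit hχ]
    have : 1 - y = (1 - x) - (y - x) := by ring
    rw [this]; exact nm_sub c (by rwa [nm_sub'])
  have c' : ¬ padicNorm p (1 - y) < 1 := by
    intro c'
    apply c
    have : 1 - x = (1 - y) - (x - y) := by ring
    rw [this]; exact nm_sub c' hxy
  have unit1 : ∀ z : ℚ, padicNorm p z = 1 → ¬ padicNorm p (1 - z) < 1 → padicNorm p (1 - z) = 1 := by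
    intro z hz hc
    apply le_antisymm _ (not_lt.1 hc)
    refine padicNorm.sub.trans ?_
    rw [hz, padicNorm.one, max_self]
  have nx := unit1 x hx c
  have ny := unit1 y hy c'
  have x0 := nm_one_ne hx
  have y0 := nm_one_ne hy
  have dx := nm_one_ne nx
  have dy := nm_one_ne ny
  have dy' : y - 1 ≠ 0 := by rw [← neg_sub]; exact neg_ne_zero.2 dy
  have x1 : x ≠ 1 := (sub_ne_zero.1 dx).symm
  have y1 : y ≠ 1 := (sub_ne_zero.1 dy).symm
  have e := h.ft x y x0 x1 y0 y1
  rw [h.bunit hχ (u := y / x) (by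
      rw [show 1 - y / x = (x - y) / x by field_simp, padicNorm.div, hx, div_one]; exact hxy),
    h.bunit hχ (u := (1 - x⁻¹) / (1 - y⁻¹)) (by
      rw [show 1 - y⁻¹ = (y - 1) / y by field_simp,
        show 1 - (1 - x⁻¹) / ((y - 1) / y) = (y - x) / (x * (y - 1)) by field_simp; ring,
        padicNorm.div, padicNorm.mul, nm_sub' y 1, ny, hx, one_mul, div_one, nm_sub']; exact hxy),
    h.bunit hχ (u := (1 - x) / (1 - y)) (by
      rw [show 1 - (1 - x) / (1 - y) = (x - y) / (1 - y) by field_simp; ring,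
        padicNorm.div, ny, div_one]; exact hxy)] at e
  rw [← sub_eq_zero, ← e]; module

/-- integer form -/
theorem bint (a c l : ℤ) (ha : ((a : ℤ) : ZMod p) ≠ 0) (hc : (c : ZMod p) ≠ 0)
    (he : (a : ZMod p) / c = l) : b ((a : ℚ) / c) = b l := by
  have na : padicNorm p (a : ℚ) = 1 := by
    rw [padicNorm.int_eq_one_iff, ← ZMod.intCast_zmod_eq_zero_iff_dvd]; exact ha
  have nc : padicNorm p (c : ℚ) = 1 := by
    rw [padicNorm.int_eq_one_iff, ← ZMod.intCast_zmod_eq_zero_iff_dvd]; exact hc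
  have nl : padicNorm p (l : ℚ) = 1 := by
    rw [padicNorm.int_eq_one_iff, ← ZMod.intCast_zmod_eq_zero_iff_dvd, ← he]
    exact div_ne_zero ha hc
  have c0 : (c : ℚ) ≠ 0 := nm_one_ne nc
  apply h.bcong hχ (by rw [padicNorm.div, na, nc, div_one]) nl
  rw [show (a : ℚ) / c - l = ((a - l * c : ℤ) : ℚ) / c by push_cast; field_simp,
    padicNorm.div, nc, div_one, padicNorm.int_lt_one_iff, ← ZMod.intCast_zmod_eq_zero_iff_dvd]
  push_cast
  rw [← he, div_mul_cancel₀ _ hc, sub_self]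

/-- b on residues -/
theorem bres (x : ℚ) (x0 : x ≠ 0) (hv : padicValRat p x = 0) :
    ((x : ZMod p)) ≠ 0 ∧ b x = b (((x : ZMod p).val : ℤ) : ℚ) := by
  have hn : ¬ ((x.num : ZMod p) = 0) ∧ ¬ ((x.den : ZMod p) = 0) := by
    rw [ZMod.intCast_zmod_eq_zero_iff_dvd, ZMod.natCast_eq_zero_iff]
    have hv' := hv
    rw [padicValRat_def] at hv'
    constructor
    · intro hd
      have h1 : padicValInt p x.num ≠ 0 := by
        rw [padicValInt]
        have : p ∣ x.num.natAbs := Int.natCast_dvd.1 hd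
        have := one_le_padicValNat_of_dvd (by simpa using x0) this
        omega
      have h2 : p ∣ x.den := by
        by_contra hnd
        rw [padicValNat.eq_zero_of_not_dvd hnd] at hv'
        omega
      have := Nat.dvd_gcd (Int.natCast_dvd.1 hd) h2
      rw [x.reduced] at this
      exact hpp.out.one_lt.ne' (Nat.dvd_one.1 this)
    · intro hd
      have h1 : padicValNat p x.den ≠ 0 := by
        have := one_le_padicValNat_of_dvd x.den_nz hd
        omega
      have h2 : p ∣ x.num.natAbs := by
        by_contra hnd
        rw [padicValInt, padicValNat.eq_zero_of_not_dvd hnd] at hv'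
        omega
      have := Nat.dvd_gcd h2 hd
      rw [x.reduced] at this
      exact hpp.out.one_lt.ne' (Nat.dvd_one.1 this)
  have hx : (x : ZMod p) = (x.num : ZMod p) / (x.den : ZMod p) := Rat.cast_def x
  refine ⟨by rw [hx]; exact div_ne_zero hn.1 hn.2, ?_⟩
  have := h.bint hχ x.num x.den ((x : ZMod p).val : ℤ) hn.1 (by simpa using hn.2) (by
    rw [Int.cast_natCast, Int.cast_natCast, ZMod.natCast_zmod_val]; exact hx.symm)
  rw [← this]
  congr 1
  rw [Int.cast_natCast, Rat.num_div_den]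

end
end Tw


theorem PBloch_lift {k : Type} [Field k] {A : Type*} [AddCommGroup A] (f : kˣ → A) (h1 : f 1 = 0)
    (hft : ∀ (x y : kˣ) (hx : (x : k) ≠ 1) (hy : (y : k) ≠ 1),
      f x - f y + f (y * x⁻¹) - f (U k ((1 - (x : k)⁻¹) / (1 - (y : k)⁻¹))
        (div_ne_zero (one_sub_inv_ne hx) (one_sub_inv_ne hy)))
      + f (U k ((1 - (x : k)) / (1 - (y : k)))
        (div_ne_zero (one_sub_ne hx) (one_sub_ne hy))) = 0) :
    ∃ φ : PBloch k →+ A, ∀ x, φ (pb k x) = f x := by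
  refine ⟨(Submodule.liftQ _ (Finsupp.linearCombination ℤ f) ?_ : _ →ₗ[ℤ] A).toAddMonoidHom, ?_⟩
  · rw [Submodule.span_le]
    rintro w (hw | ⟨x, y, hx, hy, rfl⟩)
    · rw [Set.mem_singleton_iff] at hw; subst hw
      simp [h1]
    · have := hft x y hx hy
      simp only [SetLike.mem_coe, LinearMap.mem_ker, FTZ, map_add, map_sub,
        Finsupp.linearCombination_single, one_smul]
      exact this
  · intro x
    show Finsupp.linearCombination ℤ f (Finsupp.single x 1) = f x
    simp

theorem PBloch_ind {k : Type} [Field k] {P : PBloch k → Prop} (h0 : P 0)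
    (ha : ∀ x y, P x → P y → P (x + y)) (hn : ∀ x, P x → P (-x)) (hg : ∀ x, P (pb k x))
    (z : PBloch k) : P z := by
  obtain ⟨z, rfl⟩ := Submodule.Quotient.mk_surjective _ z
  induction z using Finsupp.induction_linear with
  | zero => exact h0
  | add f g hf hg => exact ha _ _ hf hg
  | single x n =>
    have key : ∀ n : ℕ, P (Submodule.Quotient.mk (Finsupp.single x (n : ℤ))) := by
      intro n
      induction n with
      | zero => rw [Nat.cast_zero, Finsupp.single_zero]; exact h0
      | succ n ih =>
        rw [Nat.cast_succ, Finsupp.single_add]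
        exact ha _ _ ih (hg x)
    rcases Int.eq_nat_or_neg n with ⟨m, rfl | rfl⟩
    · exact key m
    · rw [Finsupp.single_neg]
      exact hn _ (key m)

theorem pb_one {k : Type} [Field k] : pb k 1 = 0 := by
  apply (Submodule.Quotient.mk_eq_zero _).2
  exact Submodule.subset_span (Or.inl rfl)

theorem pb_ft {k : Type} [Field k] (x y : kˣ) (hx : (x : k) ≠ 1) (hy : (y : k) ≠ 1) :
    pb k x - pb k y + pb k (y * x⁻¹) - pb k (U k ((1 - (x : k)⁻¹) / (1 - (y : k)⁻¹))
        (div_ne_zero (one_sub_inv_ne hx) (one_sub_inv_ne hy)))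
      + pb k (U k ((1 - (x : k)) / (1 - (y : k)))
        (div_ne_zero (one_sub_ne hx) (one_sub_ne hy))) = 0 := by
  have : (Submodule.Quotient.mk (FTZ k x y hx hy) : PBloch k) = 0 := by
    apply (Submodule.Quotient.mk_eq_zero _).2
    exact Submodule.subset_span (Or.inr ⟨x, y, hx, hy, rfl⟩)
  exact this

theorem RP'_ind {F : Type} [Field F] {P : RP' F → Prop} (h0 : P 0)
    (ha : ∀ x y, P x → P y → P (x + y)) (hn : ∀ x, P x → P (-x))
    (hg : ∀ (a x : Fˣ), P (cls F a • rp F x))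
    (z : RP' F) : P z := by
  obtain ⟨z, rfl⟩ := Submodule.Quotient.mk_surjective _ z
  induction z using Finsupp.induction_linear with
  | zero => exact h0
  | add f g hf hg => exact ha _ _ hf hg
  | single x r =>
    induction r using MonoidAlgebra.induction_linear with
    | zero => rw [Finsupp.single_zero]; exact h0
    | add f g hf hg =>
      rw [Finsupp.single_add]; exact ha _ _ hf hg
    | single g n =>
      obtain ⟨a, rfl⟩ := QuotientGroup.mk_surjective g
      have e1 : ∀ n : ℤ, (Submodule.Quotient.mk (Finsupp.single x
          (MonoidAlgebra.single (QuotientGroup.mk a : SqCl F) n : RF F)) : RP' F)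
          = n • (cls F a • rp F x) := by
        intro n
        have : (Finsupp.single x (MonoidAlgebra.single (QuotientGroup.mk a : SqCl F) n : RF F) : FreeRP F)
          = n • (cls F a • gen F x) := by
          rw [gen, Finsupp.smul_single, Finsupp.smul_single, smul_eq_mul, mul_one, cls,
            MonoidAlgebra.of_apply, MonoidAlgebra.smul_single, smul_eq_mul, mul_one]
          rfl
        rw [this]; rfl
      rw [e1]
      have key : ∀ n : ℕ, P ((n : ℤ) • (cls F a • rp F x)) := by
        intro n
        induction n with
        | zero => simpa using h0
        | succ n ih =>
          rw [Nat.cast_succ, add_smul, one_smul]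
          exact ha _ _ ih (hg a x)
      rcases Int.eq_nat_or_neg n with ⟨m, rfl | rfl⟩
      · exact key m
      · rw [neg_smul]
        exact hn _ (key m)

theorem rp_one {F : Type} [Field F] : rp F 1 = 0 := by
  apply (Submodule.Quotient.mk_eq_zero _).2
  exact Submodule.subset_span (Or.inl (Or.inl (Or.inl rfl)))

theorem rp_ft {k : Type} [Field k] (x y : kˣ) (hx : (x : k) ≠ 1) (hy : (y : k) ≠ 1) :
    rp k x - rp k y + cls k x • rp k (y * x⁻¹)
      - cls k (U k ((x : k)⁻¹ - 1) (inv_sub_one_ne hx)) • rp k (U k ((1 - (x : k)⁻¹) / (1 - (y : k)⁻¹))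
        (div_ne_zero (one_sub_inv_ne hx) (one_sub_inv_ne hy)))
      + cls k (U k (1 - (x : k)) (one_sub_ne hx)) • rp k (U k ((1 - (x : k)) / (1 - (y : k)))
        (div_ne_zero (one_sub_ne hx) (one_sub_ne hy))) = 0 := by
  have : (Submodule.Quotient.mk (FT k x y hx hy) : RP' k) = 0 := by
    apply (Submodule.Quotient.mk_eq_zero _).2
    exact Submodule.subset_span (Or.inl (Or.inl (Or.inr ⟨x, y, hx, hy, rfl⟩)))
  exact this

theorem rp_minus {k : Type} [Field k] (x : kˣ) : cls k (-1) • rp k x = rp k x := by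
  have : (Submodule.Quotient.mk (cls k (-1) • gen k x - gen k x) : RP' k) = 0 := by
    apply (Submodule.Quotient.mk_eq_zero _).2
    exact Submodule.subset_span (Or.inl (Or.inr ⟨x, rfl⟩))
  exact sub_eq_zero.1 this

theorem rp_inv {k : Type} [Field k] (x : kˣ) : rp k x⁻¹ = - rp k x := by
  have : (Submodule.Quotient.mk (gen k x⁻¹ + gen k x) : RP' k) = 0 := by
    apply (Submodule.Quotient.mk_eq_zero _).2
    exact Submodule.subset_span (Or.inr ⟨x, rfl⟩)
  exact eq_neg_of_add_eq_zero_left this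

/-- the map `ρ` -/
theorem exists_rho {A : Type*} [AddCommGroup A] {χ : ℚ →*₀ ℤ} {b : ℚ → A} {p : ℕ}
    [hpp : Fact p.Prime] (h : Tw χ b)
    (hχ : ∀ x, x ≠ 0 → χ x = (((-1 : ℤˣ) ^ (padicValRat p x) : ℤˣ) : ℤ)) :
    ∃ ρ : PBloch (ZMod p) →+ A, ∀ x : (ZMod p)ˣ,
      ρ (pb (ZMod p) x) = b (((x : ZMod p).val : ℤ) : ℚ) := by
  apply PBloch_lift
  · have : (((1 : (ZMod p)ˣ) : ZMod p)).val = 1 := by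
      rw [Units.val_one, ZMod.val_one]
    rw [this]; simpa using h.b1
  · intro x y hx hy
    set X : ℤ := ((x : ZMod p).val : ℤ) with hX
    set Y : ℤ := ((y : ZMod p).val : ℤ) with hY
    have cX : ((X : ℤ) : ZMod p) = x := by rw [hX, Int.cast_natCast, ZMod.natCast_zmod_val]
    have cY : ((Y : ℤ) : ZMod p) = y := by rw [hY, Int.cast_natCast, ZMod.natCast_zmod_val]
    have x0 : ((x : ZMod p)) ≠ 0 := x.ne_zero
    have y0 : ((y : ZMod p)) ≠ 0 := y.ne_zero
    have dx : (x : ZMod p) - 1 ≠ 0 := sub_ne_zero.2 hx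
    have dy : (y : ZMod p) - 1 ≠ 0 := sub_ne_zero.2 hy
    have dx' : 1 - (x : ZMod p) ≠ 0 := sub_ne_zero.2 hx.symm
    have dy' : 1 - (y : ZMod p) ≠ 0 := sub_ne_zero.2 hy.symm
    have X0 : (X : ℚ) ≠ 0 := by
      intro e; rw [Int.cast_eq_zero] at e; rw [e] at cX; exact x0 (by rw [← cX]; simp)
    have Y0 : (Y : ℚ) ≠ 0 := by
      intro e; rw [Int.cast_eq_zero] at e; rw [e] at cY; exact y0 (by rw [← cY]; simp)
    have X1 : (X : ℚ) ≠ 1 := by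
      intro e; rw [Int.cast_eq_one] at e; rw [e] at cX; exact hx (by rw [← cX]; simp)
    have Y1 : (Y : ℚ) ≠ 1 := by
      intro e; rw [Int.cast_eq_one] at e; rw [e] at cY; exact hy (by rw [← cY]; simp)
    have DX : (X : ℚ) - 1 ≠ 0 := sub_ne_zero.2 X1
    have DY : (Y : ℚ) - 1 ≠ 0 := sub_ne_zero.2 Y1
    have DX' : 1 - (X : ℚ) ≠ 0 := sub_ne_zero.2 X1.symm
    have DY' : 1 - (Y : ℚ) ≠ 0 := sub_ne_zero.2 Y1.symm
    have vcast : ∀ u : ZMod p, (((u.val : ℤ)) : ZMod p) = u := fun u => by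
      rw [Int.cast_natCast, ZMod.natCast_zmod_val]
    have e := h.ft X Y X0 X1 Y0 Y1
    have c1 : χ X = 1 := by
      apply h.chi_nm hχ
      rw [padicNorm.int_eq_one_iff, ← ZMod.intCast_zmod_eq_zero_iff_dvd, cX]; exact x0
    have c2 : χ (1 - (X : ℚ)) = 1 := by
      apply h.chi_nm hχ
      have : (1 - (X : ℚ)) = ((1 - X : ℤ) : ℚ) := by push_cast; ring
      rw [this, padicNorm.int_eq_one_iff, ← ZMod.intCast_zmod_eq_zero_iff_dvd]
      push_cast; rw [cX]; exact dx'
    have e1 : b (Y / X) = b ((((y * x⁻¹ : (ZMod p)ˣ) : ZMod p).val : ℤ) : ℚ) := by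
      apply h.bint hχ
      · rw [cY]; exact y0
      · rw [cX]; exact x0
      · rw [cX, cY, vcast, Units.val_mul, Units.val_inv_eq_inv_val, div_eq_mul_inv]
    have e2 : b ((1 - (X : ℚ)) / (1 - Y)) = b ((((U (ZMod p) ((1 - (x : ZMod p)) / (1 - (y : ZMod p)))
        (div_ne_zero (one_sub_ne hx) (one_sub_ne hy)) : (ZMod p)ˣ) : ZMod p).val : ℤ) : ℚ) := by
      have := h.bint hχ (1 - X) (1 - Y) (((U (ZMod p) ((1 - (x : ZMod p)) / (1 - (y : ZMod p)))
        (div_ne_zero (one_sub_ne hx) (one_sub_ne hy)) : (ZMod p)ˣ) : ZMod p).val : ℤ)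
        (by push_cast; rw [cX]; exact dx') (by push_cast; rw [cY]; exact dy')
        (by rw [vcast]; push_cast; rw [cX, cY]; rfl)
      rw [← this]; push_cast; rfl
    have e3 : b ((1 - (X : ℚ)⁻¹) / (1 - (Y : ℚ)⁻¹)) =
        b ((((U (ZMod p) ((1 - (x : ZMod p)⁻¹) / (1 - (y : ZMod p)⁻¹))
        (div_ne_zero (one_sub_inv_ne hx) (one_sub_inv_ne hy)) : (ZMod p)ˣ) : ZMod p).val : ℤ) : ℚ) := by
      have := h.bint hχ ((X - 1) * Y) (X * (Y - 1)) (((U (ZMod p)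
        ((1 - (x : ZMod p)⁻¹) / (1 - (y : ZMod p)⁻¹))
        (div_ne_zero (one_sub_inv_ne hx) (one_sub_inv_ne hy)) : (ZMod p)ˣ) : ZMod p).val : ℤ)
        (by push_cast; rw [cX, cY]; exact mul_ne_zero dx y0)
        (by push_cast; rw [cX, cY]; exact mul_ne_zero x0 dy)
        (by
          rw [vcast]; push_cast; rw [cX, cY]
          show _ = (1 - (x : ZMod p)⁻¹) / (1 - (y : ZMod p)⁻¹)
          rw [show 1 - (y : ZMod p)⁻¹ = (y - 1) / y by field_simp,
            show 1 - (x : ZMod p)⁻¹ = (x - 1) / x by field_simp]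
          field_simp)
      rw [← this]; push_cast
      congr 1
      rw [show 1 - (Y : ℚ)⁻¹ = (Y - 1) / Y by field_simp,
            show 1 - (X : ℚ)⁻¹ = (X - 1) / X by field_simp]
      field_simp
    rw [c1, c2, e1, e2, e3] at e
    simp only [one_smul, mul_one] at e
    exact e


abbrev PTx (p : Nat.Primes) (d2 : Decidable ((p : ℕ) = 2)) (d3 : Decidable ((p : ℕ) = 3)) : Type :=
  if (p : ℕ) = 2 then ZMod 3
  else if (p : ℕ) = 3 then ZMod 4
  else @PBloch (ZMod p) (@ZMod.instField p ⟨p.2⟩)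

noncomputable abbrev PIx (p : Nat.Primes) (d2 : Decidable ((p : ℕ) = 2)) (d3 : Decidable ((p : ℕ) = 3)) :
    AddCommGroup (PTx p d2 d3) := by
  unfold PTx
  split
  · infer_instance
  · split
    · infer_instance
    · infer_instance

noncomputable def pbKx (p : Nat.Primes) (d2 : Decidable ((p : ℕ) = 2)) (d3 : Decidable ((p : ℕ) = 3)) :
    ZMod p → PTx p d2 d3 := by
  unfold PTx
  by_cases h2 : (p : ℕ) = 2
  · rw [if_pos h2]; exact fun _ => 0
  · rw [if_neg h2]
    by_cases h3 : (p : ℕ) = 3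
    · rw [if_pos h3]
      exact fun a => if a = 1 then 0 else if a = -1 then 1 else 0
    · rw [if_neg h3]
      letI : Fact (p : ℕ).Prime := ⟨p.2⟩
      exact fun a => if h : a ≠ 0 then pb (ZMod p) (Units.mk0 a h) else 0

theorem PBx_five (p : Nat.Primes) [Fact (p : ℕ).Prime] (h2 : (p : ℕ) ≠ 2) (h3 : (p : ℕ) ≠ 3)
    (d2 : Decidable ((p : ℕ) = 2)) (d3 : Decidable ((p : ℕ) = 3)) :
    letI := PIx p d2 d3
    ∃ e : PTx p d2 d3 ≃+ PBloch (ZMod p), ∀ (a : ZMod p) (ha : a ≠ 0),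
      e (pbKx p d2 d3 a) = pb (ZMod p) (Units.mk0 a ha) := by
  cases d2 with
  | isTrue h => exact absurd h h2
  | isFalse h =>
    cases d3 with
    | isTrue h => exact absurd h h3
    | isFalse h =>
      exact ⟨AddEquiv.refl (PBloch (ZMod p)), fun a ha => dif_pos ha⟩

theorem PBp_five (p : Nat.Primes) [Fact (p : ℕ).Prime] (h2 : (p : ℕ) ≠ 2) (h3 : (p : ℕ) ≠ 3) :
    ∃ e : PBp p ≃+ PBloch (ZMod p), ∀ (a : ZMod p) (ha : a ≠ 0),
      e (pbK p a) = pb (ZMod p) (Units.mk0 a ha) :=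
  PBx_five p h2 h3 _ _

theorem PBp_three (p : Nat.Primes) (h3 : (p : ℕ) = 3) : Nonempty (PBp p ≃+ ZMod 4) := by
  obtain ⟨p, hp⟩ := p
  simp only at h3
  subst h3
  exact ⟨AddEquiv.refl (ZMod 4)⟩

theorem PBp_two (p : Nat.Primes) (h2 : (p : ℕ) = 2) : ∃ e : PBp p ≃+ ZMod 3,
    ∀ a : ZMod p, pbK p a = 0 := by
  obtain ⟨p, hp⟩ := p
  simp only at h2
  subst h2
  exact ⟨AddEquiv.refl (ZMod 3), fun a => rfl⟩

theorem rho_p {A : Type*} [AddCommGroup A] {χ : ℚ →*₀ ℤ} {b : ℚ → A} (p : Nat.Primes)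
    (h : Tw χ b)
    (hχ : ∀ x, x ≠ 0 → χ x = (((-1 : ℤˣ) ^ (padicValRat p x) : ℤˣ) : ℤ))
    (C : PBp p) (hC : ∀ a : ZMod p, a ≠ 0 → a ≠ 1 → C = pbK p a + pbK p (1 - a))
    (hC2 : (p : ℕ) = 2 → C ≠ 0) :
    ∃ ρ : PBp p →+ A, ρ C = b 2 ∧ ∀ a : ZMod p, a ≠ 0 → ρ (pbK p a) = b ((a.val : ℤ) : ℚ) := by
  have fp : Fact (p : ℕ).Prime := ⟨p.2⟩
  by_cases p2 : (p : ℕ) = 2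
  · obtain ⟨e, he⟩ := PBp_two p p2
    have hb : ∀ a : ZMod p, a ≠ 0 → b ((a.val : ℤ) : ℚ) = 0 := by
      intro a ha
      have h1 : a.val < 2 := by rw [← p2]; exact ZMod.val_lt a
      have h0 : a.val ≠ 0 := by rwa [Ne, ZMod.val_eq_zero]
      have : a.val = 1 := by omega
      rw [this]; simpa using h.b1
    have c3 : (3 : ℤ) • b 2 = 0 := by
      have := h.c3 two_ne_zero
      rw [← this]; module
    let φ : ZMod 3 →+ A := ZMod.lift 3 ⟨zmultiplesHom A (b 2), by simpa using c3⟩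
    have hφ : φ 1 = b 2 := by
      have := ZMod.lift_coe 3 (⟨zmultiplesHom A (b 2), by simpa using c3⟩ :
        {f : ℤ →+ A // f (3 : ℕ) = 0}) 1
      simpa [φ] using this
    have hc : e C = 1 ∨ e C = -1 := by
      have : e C ≠ 0 := fun h0 => hC2 p2 (by simpa using h0)
      revert this
      generalize e C = c
      revert c; decide
    rcases hc with hc | hc
    · refine ⟨φ.comp e.toAddMonoidHom, ?_, fun a ha => by rw [he, hb a ha, map_zero]⟩
      simp [hc, hφ]
    · refine ⟨-(φ.comp e.toAddMonoidHom), ?_, fun a ha => by rw [he, hb a ha, map_zero]⟩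
      simp [hc, hφ]
  by_cases p3 : (p : ℕ) = 3
  · have hb2 : b 2 = 0 := by
      rw [← h.bm1]
      have n2 : padicNorm p ((2 : ℤ) : ℚ) = 1 := by
        rw [padicNorm.int_eq_one_iff, p3]; decide
      have n3 : padicNorm p ((3 : ℤ) : ℚ) < 1 := by
        rw [padicNorm.int_lt_one_iff, p3]; decide
      push_cast at n2 n3
      apply h.bcong hχ n2
      · rw [padicNorm.neg, padicNorm.one]
      · rw [show (2 : ℚ) - -1 = 3 by norm_num]; exact n3
    refine ⟨0, by rw [hb2]; rfl, ?_⟩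
    intro a ha
    have h1 : a.val < 3 := by rw [← p3]; exact ZMod.val_lt a
    have h0 : a.val ≠ 0 := by rwa [Ne, ZMod.val_eq_zero]
    have : a.val = 1 ∨ a.val = 2 := by omega
    rcases this with e | e <;> rw [e]
    · simpa using h.b1.symm
    · simpa using hb2.symm
  obtain ⟨e, he⟩ := PBp_five p p2 p3
  obtain ⟨ρ, hρ⟩ := exists_rho h hχ
  have hp : ∀ a : ZMod p, a ≠ 0 → ρ (e (pbK p a)) = b ((a.val : ℤ) : ℚ) := by
    intro a ha; rw [he a ha, hρ]; rfl
  refine ⟨ρ.comp e.toAddMonoidHom, ?_, hp⟩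
  have pge : 5 ≤ (p : ℕ) := by
    have := p.2.two_le
    have h4 : (p : ℕ) ≠ 4 := fun e => by have := p.2; rw [e] at this; revert this; decide
    omega
  have i2 : ((2 : ℤ) : ZMod p) ≠ 0 := by
    rw [Ne, ZMod.intCast_zmod_eq_zero_iff_dvd]
    intro hd; have := Int.le_of_dvd (by norm_num) hd; omega
  have i1 : (2 : ZMod p) ≠ 1 := by
    intro e; have : (1 : ZMod p) = 0 := by linear_combination e
    exact one_ne_zero this
  have i2' : (2 : ZMod p) ≠ 0 := by simpa using i2
  rw [hC 2 i2' i1]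
  show ρ (e (_ + _)) = _
  rw [map_add, map_add, hp _ i2', hp _ (by rw [show (1 : ZMod p) - 2 = -1 by ring]; simp)]
  have e1 := h.bres hχ 2 two_ne_zero (by
    rw [← Tw.nm_one two_ne_zero]
    have := (padicNorm.int_eq_one_iff (p := p) 2).2 (by
      intro hd; have := Int.le_of_dvd (by norm_num) hd; omega)
    simpa using this)
  have e2 := h.bres hχ (-1) (by norm_num) (by rw [padicValRat.neg]; simp)
  rw [show ((2 : ℚ) : ZMod p) = 2 by simp] at e1
  rw [show ((-1 : ℚ) : ZMod p) = 1 - 2 by simp; ring] at e2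
  rw [← e1.2, ← e2.2, h.bm1, add_zero]


theorem chiRing_cls (p : Nat.Primes) (a : ℚˣ) :
    chiRing (chiP p) (cls ℚ a) = (((-1 : ℤˣ) ^ (padicValRat p (a : ℚ)) : ℤˣ) : ℤ) := by
  unfold chiRing cls
  show (MonoidAlgebra.lift ℤ ℤ (SqCl ℚ)) ((Units.coeHom ℤ).comp (chiP p)) _ = _
  rw [MonoidAlgebra.lift_of]
  rfl

theorem tw_smul (p : Nat.Primes) (r : RF ℚ) (t : Twist p) :
    r • t = (chiRing (chiP p) r) • t := by
  show ((chiRing (chiP p) r) • (t : LocalizedModule (Submonoid.powers (2 : ℤ)) (PBp p))) = _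
  exact int_smul_eq_zsmul _ _ _

theorem toTw_zero_iff (p : Nat.Primes) (y : PBp p) (h : toTw p y = 0) : ∃ k : ℕ, (2 ^ k : ℤ) • y = 0 := by
  have h' : (LocalizedModule.mk y 1 : LocalizedModule (Submonoid.powers (2 : ℤ)) (PBp p)) =
      LocalizedModule.mk 0 1 := by
    rw [LocalizedModule.zero_mk]; exact h
  rw [LocalizedModule.mk_eq] at h'
  obtain ⟨⟨_, k, rfl⟩, hk⟩ := h'
  refine ⟨k, ?_⟩
  simp only [smul_zero, one_smul] at hk
  exact hk

theorem toTw_add (p : Nat.Primes) (x y : PBp p) : toTw p (x + y) = toTw p x + toTw p y :=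
  map_add (LocalizedModule.mkLinearMap (Submonoid.powers (2 : ℤ)) (PBp p)) x y
theorem toTw_neg (p : Nat.Primes) (x : PBp p) : toTw p (-x) = - toTw p x :=
  map_neg (LocalizedModule.mkLinearMap (Submonoid.powers (2 : ℤ)) (PBp p)) x
theorem toTw_zero (p : Nat.Primes) : toTw p 0 = 0 :=
  map_zero (LocalizedModule.mkLinearMap (Submonoid.powers (2 : ℤ)) (PBp p))

theorem cls_mul (a c : ℚˣ) : cls ℚ (a * c) = cls ℚ a * cls ℚ c := by
  unfold cls; rw [map_mul, map_mul]

theorem cls_one : cls ℚ 1 = 1 := by unfold cls; rw [map_one, map_one]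

theorem cls_sq (a : ℚˣ) : cls ℚ a * cls ℚ a = 1 := by
  rw [← cls_mul, ← cls_one]
  unfold cls
  congr 1
  rw [map_one]
  exact (QuotientGroup.eq_one_iff _).2 ⟨a, by simp [pow_two]⟩

theorem aug_act {A : Type*} [AddCommGroup A] [Module (RF ℚ) A]
    (h : ∀ (u : ℚˣ) (a : A), cls ℚ u • a = a) (r : RF ℚ) (a : A) : r • a = (augRF ℚ r) • a := by
  induction r using MonoidAlgebra.induction_linear with
  | zero => simp
  | add f g hf hg => rw [add_smul, hf, hg, map_add, add_smul]
  | single g n =>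
    obtain ⟨u, rfl⟩ := QuotientGroup.mk_surjective g
    have e1 : (MonoidAlgebra.single (QuotientGroup.mk u : SqCl ℚ) n : RF ℚ) = n • cls ℚ u := by
      unfold cls
      rw [MonoidAlgebra.of_apply, MonoidAlgebra.smul_single, smul_eq_mul, mul_one]
      rfl
    have e2 : augRF ℚ (cls ℚ u) = 1 := by
      unfold augRF cls
      show (MonoidAlgebra.lift ℤ ℤ (SqCl ℚ)) 1 _ = _
      rw [MonoidAlgebra.lift_of]; rfl
    rw [e1, map_zsmul, e2, smul_assoc, h]; simp

theorem core (CC : ∀ p : Nat.Primes, PBp p)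
    (hCC : ∀ (p : Nat.Primes) (a : ZMod p), a ≠ 0 → a ≠ 1 →
      CC p = pbK p a + pbK p (1 - a))
    (hCC2 : ∀ p : Nat.Primes, (p : ℕ) = 2 → CC p ≠ 0)
    (Sfull : RP' ℚ →ₗ[RF ℚ] ∀ p : Nat.Primes, Twist p)
    (hS0 : ∀ (x : ℚˣ) (p : Nat.Primes), vP p x = 0 →
      Sfull (rp ℚ x) p = toTw p (pbK p (redQ p (x : ℚ))))
    (hSpos : ∀ (x : ℚˣ) (p : Nat.Primes), 0 < vP p x →
      Sfull (rp ℚ x) p = toTw p (CC p))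
    (hSneg : ∀ (x : ℚˣ) (p : Nat.Primes), vP p x < 0 →
      Sfull (rp ℚ x) p = -toTw p (CC p))
    (z : RP' ℚ) (hI : ∃ k : ℕ, (2 ^ k : RF ℚ) • z ∈ augIdeal ℚ • (⊤ : Submodule (RF ℚ) (RP' ℚ)))
    (hz : ∀ p, Sfull z p = 0) : ∃ k : ℕ, (2 ^ k : RF ℚ) • z = 0 := by
  by_contra hcon
  push Not at hcon
  have hdis : Disjoint ((Ideal.torsionOf (RF ℚ) (RP' ℚ) z : Ideal (RF ℚ)) : Set (RF ℚ))
      (Submonoid.powers (2 : RF ℚ) : Set (RF ℚ)) := by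
    rw [Set.disjoint_left]
    rintro r hr ⟨k, rfl⟩
    exact hcon k ((Ideal.mem_torsionOf_iff _ _).1 hr)
  obtain ⟨q, hq, hle, hqd⟩ := Ideal.exists_le_prime_disjoint _ _ hdis
  have q2 : (2 : RF ℚ) ∉ q := fun h => Set.disjoint_left.1 hqd h ⟨1, by simp⟩
  have q2k : ∀ k : ℕ, (2 ^ k : RF ℚ) ∉ q := fun k h => Set.disjoint_left.1 hqd h ⟨k, rfl⟩
  let Nq : Submodule (RF ℚ) (RP' ℚ) :=
    { carrier := {m | ∃ s, s ∉ q ∧ s • m = 0}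
      zero_mem' := ⟨1, fun h => hq.ne_top ((Ideal.eq_top_iff_one _).2 h), by simp⟩
      add_mem' := by
        rintro x y ⟨s, hs, hx⟩ ⟨t, ht, hy⟩
        refine ⟨s * t, fun h => (hq.mem_or_mem h).elim hs ht, ?_⟩
        rw [smul_add, mul_comm s t, mul_smul, hx, mul_comm t s, mul_smul, hy]; simp
      smul_mem' := by
        rintro r x ⟨s, hs, hx⟩
        refine ⟨s, hs, ?_⟩
        rw [smul_comm, hx, smul_zero] }
  have tf : ∀ (r : RF ℚ) (a : RP' ℚ ⧸ Nq), r ∉ q → r • a = 0 → a = 0 := by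
    intro r a hr ha
    obtain ⟨m, rfl⟩ := Nq.mkQ_surjective a
    rw [← map_smul, Submodule.mkQ_apply, Submodule.Quotient.mk_eq_zero] at ha
    obtain ⟨s, hs, h⟩ := ha
    rw [Submodule.mkQ_apply, Submodule.Quotient.mk_eq_zero]
    exact ⟨s * r, fun h => (hq.mem_or_mem h).elim hs hr, by rw [mul_smul, h]⟩
  have z0 : Nq.mkQ z ≠ 0 := by
    rw [Submodule.mkQ_apply, Ne, Submodule.Quotient.mk_eq_zero]
    rintro ⟨s, hs, h⟩
    exact hs (hle ((Ideal.mem_torsionOf_iff _ _).2 h))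
  have nt : ∀ a : RP' ℚ ⧸ Nq, a + a = 0 → a = 0 := by
    intro a ha
    exact tf 2 a q2 (by rw [two_smul]; exact ha)
  have hex : ∀ u : ℚˣ, ∃ ε : ℤ, (ε = 1 ∨ ε = -1) ∧ ∀ a : RP' ℚ ⧸ Nq, cls ℚ u • a = ε • a := by
    intro u
    have h0 : (cls ℚ u - 1) * (cls ℚ u + 1) = 0 := by
      have := cls_sq u; linear_combination this
    have h0' : (cls ℚ u - 1) * (cls ℚ u + 1) ∈ q := by rw [h0]; exact q.zero_mem
    by_cases c : cls ℚ u - 1 ∈ q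
    · have c' : cls ℚ u + 1 ∉ q := fun h => q2 (by
        have := q.sub_mem h c
        rwa [show cls ℚ u + 1 - (cls ℚ u - 1) = 2 by ring] at this)
      refine ⟨1, Or.inl rfl, fun a => ?_⟩
      have := tf (cls ℚ u + 1) ((cls ℚ u - 1) • a) c' (by rw [← mul_smul, mul_comm, h0, zero_smul])
      rw [sub_smul, one_smul, sub_eq_zero] at this
      rw [this, one_smul]
    · refine ⟨-1, Or.inr rfl, fun a => ?_⟩
      have := tf (cls ℚ u - 1) ((cls ℚ u + 1) • a) c (by rw [← mul_smul, h0, zero_smul])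
      rw [add_smul, one_smul] at this
      rw [neg_smul, one_smul]; exact eq_neg_of_add_eq_zero_left this
  choose ε hε hact using hex
  have uniq : ∀ s t : ℤ, (s = 1 ∨ s = -1) → (t = 1 ∨ t = -1) →
      s • Nq.mkQ z = t • Nq.mkQ z → s = t := by
    rintro s t (rfl | rfl) (rfl | rfl) h
    · rfl
    · exfalso; apply z0; apply nt
      rw [one_smul, neg_smul, one_smul] at h
      nth_rewrite 1 [h]; simp
    · exfalso; apply z0; apply nt
      rw [one_smul, neg_smul, one_smul] at h
      nth_rewrite 1 [← h]; simp
    · rfl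
  have pm : ∀ s t : ℤ, (s = 1 ∨ s = -1) → (t = 1 ∨ t = -1) → (s * t = 1 ∨ s * t = -1) := by
    rintro s t (rfl | rfl) (rfl | rfl) <;> simp
  have ε1 : ε 1 = 1 := uniq _ _ (hε 1) (Or.inl rfl) (by rw [← hact, cls_one, one_smul, one_smul])
  have εm : ∀ u v, ε (u * v) = ε u * ε v := by
    intro u v
    apply uniq _ _ (hε _) (pm _ _ (hε u) (hε v))
    rw [← hact, cls_mul, mul_smul, hact, hact, smul_smul]
  have εn : ε (-1) = 1 := by
    apply uniq _ _ (hε _) (Or.inl rfl)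
    rw [← hact, one_smul, ← map_smul]
    congr 1
    refine RP'_ind (P := fun z => cls ℚ (-1) • z = z) (smul_zero _) ?_ ?_ ?_ z
    · intro x y hx hy; rw [smul_add, hx, hy]
    · intro x hx; rw [smul_neg, hx]
    · intro a x; rw [smul_comm, rp_minus]
  let χ : ℚ →*₀ ℤ :=
    { toFun := fun x => if h : x ≠ 0 then ε (U ℚ x h) else 0
      map_zero' := by simp
      map_one' := by
        rw [dif_pos one_ne_zero, ← ε1]; congr 1; ext; rfl
      map_mul' := by
        intro x y
        by_cases hx : x ≠ 0
        swap
        · rw [not_not] at hx; simp [hx]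
        by_cases hy : y ≠ 0
        swap
        · rw [not_not] at hy; simp [hy]
        rw [dif_pos hx, dif_pos hy, dif_pos (mul_ne_zero hx hy), ← εm]
        congr 1; ext; rfl }
  have χu : ∀ (x : ℚ) (h : x ≠ 0), χ x = ε (U ℚ x h) := fun x h => dif_pos h
  let b : ℚ → RP' ℚ ⧸ Nq := fun x => if h : x ≠ 0 then Nq.mkQ (rp ℚ (U ℚ x h)) else 0
  have bu : ∀ (x : ℚ) (h : x ≠ 0), b x = Nq.mkQ (rp ℚ (U ℚ x h)) := fun x h => dif_pos h
  have T : Tw χ b :=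
    { nt := nt
      chi := fun x hx => by rw [χu x hx]; exact hε _
      chim := by
        rw [χu (-1) (by norm_num), ← εn]; congr 1; ext; rfl
      b1 := by
        rw [bu 1 one_ne_zero, show U ℚ 1 one_ne_zero = 1 by ext; rfl, rp_one, map_zero]
      binv := fun x hx => by
        rw [bu x hx, bu _ (inv_ne_zero hx), ← map_neg, ← rp_inv]; congr 2; ext; rfl
      ft := by
        intro x y x0 x1 y0 y1
        have e := congrArg Nq.mkQ (rp_ft (U ℚ x x0) (U ℚ y y0) x1 y1)
        rw [map_zero] at e
        simp only [map_add, map_sub, map_smul] at e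
        simp only [hact] at e
        rw [← e]
        have hx2 : 1 - x⁻¹ ≠ 0 := one_sub_inv_ne (x := U ℚ x x0) x1
        have hy2 : 1 - y⁻¹ ≠ 0 := one_sub_inv_ne (x := U ℚ y y0) y1
        have hx3 : 1 - x ≠ 0 := sub_ne_zero.2 x1.symm
        have hy3 : 1 - y ≠ 0 := sub_ne_zero.2 y1.symm
        have hx4 : x⁻¹ - 1 ≠ 0 := by rw [← neg_sub]; exact neg_ne_zero.2 hx2
        rw [bu x x0, bu y y0, bu _ (div_ne_zero y0 x0), bu _ (div_ne_zero hx2 hy2),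
          bu _ (div_ne_zero hx3 hy3), ← map_mul, show x * (1 - x) = x * x * (x⁻¹ - 1) by field_simp,
          map_mul, χu _ hx4, map_mul, χu x x0, χu _ hx3,
          show ε (U ℚ x x0) * ε (U ℚ x x0) = 1 by
            rcases hε (U ℚ x x0) with e | e <;> rw [e] <;> norm_num, one_mul,
          show U ℚ (y / x) (div_ne_zero y0 x0) = U ℚ y y0 * (U ℚ x x0)⁻¹ by
            ext; simp [U, div_eq_mul_inv]]
        rfl }
  have hne : ∃ x, χ x = -1 := by
    by_contra hno
    push Not at hno
    have triv : ∀ (u : ℚˣ) (a : RP' ℚ ⧸ Nq), cls ℚ u • a = a := by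
      intro u a
      have : ε u ≠ -1 := by
        have := hno (u : ℚ)
        rw [χu _ u.ne_zero] at this
        rwa [show U ℚ (u : ℚ) u.ne_zero = u by ext; rfl] at this
      rw [hact, (hε u).resolve_right this, one_smul]
    obtain ⟨k, hk⟩ := hI
    apply z0
    apply tf _ _ (q2k k)
    rw [← map_smul]
    refine Submodule.smul_induction_on (p := fun m => Nq.mkQ m = 0) hk ?_ ?_
    · intro r hr m _
      rw [map_smul, aug_act triv, show augRF ℚ r = 0 from hr, zero_smul]
    · intro x y hx hy; rw [map_add, hx, hy, add_zero]
  have hb : ∃ x, x ≠ 0 ∧ b x ≠ 0 := by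
    by_contra hno
    push Not at hno
    apply z0
    refine RP'_ind (P := fun z => Nq.mkQ z = 0) (map_zero _) ?_ ?_ ?_ z
    · intro x y hx hy; rw [map_add, hx, hy, add_zero]
    · intro x hx; rw [map_neg, hx, neg_zero]
    · intro a x
      have := hno x x.ne_zero
      rw [bu _ x.ne_zero, show U ℚ (x : ℚ) x.ne_zero = x by ext; rfl] at this
      rw [map_smul, this, smul_zero]
  obtain ⟨w, w0, hw⟩ := hb
  obtain ⟨p, pp, hχ⟩ := chi_padic χ T.chi T.chim
    (fun x y hx hx1 hy hy1 => T.L4 two_ne_zero w w0 hw x y hx hx1 hy hy1) hne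
  obtain ⟨P, rfl⟩ : ∃ P : Nat.Primes, (P : ℕ) = p := ⟨⟨p, pp⟩, rfl⟩
  have fp : Fact (P : ℕ).Prime := ⟨pp⟩
  obtain ⟨ρ, hρC, hρ⟩ := rho_p P T hχ (CC P) (hCC P) (hCC2 P)
  have main : ∀ m : RP' ℚ, ∃ y : PBp P, Sfull m P = toTw P y ∧ Nq.mkQ m = ρ y := by
    intro m
    refine RP'_ind (P := fun m => ∃ y : PBp P, Sfull m P = toTw P y ∧ Nq.mkQ m = ρ y) ?_ ?_ ?_ ?_ m
    · exact ⟨0, by rw [map_zero, toTw_zero]; rfl, by rw [map_zero, map_zero]⟩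
    · rintro x y ⟨s, hs, hs'⟩ ⟨t, ht, ht'⟩
      refine ⟨s + t, ?_, by rw [map_add, map_add, hs', ht']⟩
      rw [map_add, toTw_add, ← hs, ← ht]; rfl
    · rintro x ⟨s, hs, hs'⟩
      refine ⟨-s, ?_, by rw [map_neg, map_neg, hs']⟩
      rw [map_neg, toTw_neg, ← hs]; rfl
    · intro a x
      have hx0 : (x : ℚ) ≠ 0 := x.ne_zero
      have bx : Nq.mkQ (rp ℚ x) = b x := by
        rw [bu _ hx0]; congr 2; ext; rfl
      have h1 : ∃ y : PBp P, Sfull (rp ℚ x) P = toTw P y ∧ Nq.mkQ (rp ℚ x) = ρ y := by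
        rcases lt_trichotomy (vP P x) 0 with hv | hv | hv
        · refine ⟨-CC P, by rw [hSneg x P hv, toTw_neg], ?_⟩
          rw [map_neg, hρC, bx]
          exact T.bneg hχ hx0 hv
        · refine ⟨_, hS0 x P hv, ?_⟩
          obtain ⟨r0, r1⟩ := T.bres hχ x hx0 hv
          rw [bx, r1]
          exact (hρ _ r0).symm
        · refine ⟨CC P, hSpos x P hv, ?_⟩
          rw [hρC, bx]
          exact T.bpos hχ hx0 ((Tw.nm_lt hx0).2 hv)
      obtain ⟨y, hy, hy'⟩ := h1
      have ha := hχ (a : ℚ) a.ne_zero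
      rw [χu _ a.ne_zero, show U ℚ (a : ℚ) a.ne_zero = a by ext; rfl] at ha
      have hS : Sfull (cls ℚ a • rp ℚ x) P = ε a • toTw P y := by
        rw [map_smul, Pi.smul_apply, tw_smul, chiRing_cls, ← ha, hy]
      have hM : Nq.mkQ (cls ℚ a • rp ℚ x) = ε a • ρ y := by
        rw [map_smul, hact, hy']
      rcases hε a with e | e <;> rw [e] at hS hM
      · exact ⟨y, by rw [hS, one_smul], by rw [hM, one_smul]⟩
      · exact ⟨-y, by rw [hS, neg_smul, one_smul, toTw_neg], by rw [hM, neg_smul, one_smul, map_neg]⟩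
  obtain ⟨y, hy, hy'⟩ := main z
  rw [hz P] at hy
  obtain ⟨k, hk⟩ := toTw_zero_iff P y hy.symm
  apply z0
  apply tf _ _ (q2k k)
  have := congrArg ρ hk
  rw [map_zero, map_zsmul, ← hy'] at this
  rw [← this]
  have h2 : (2 ^ k : RF ℚ) = ((2 ^ k : ℤ) : RF ℚ) := by push_cast; rfl
  rw [h2, Int.cast_smul_eq_zsmul]


noncomputable abbrev tl2 : RP' ℚ →ₗ[RF ℚ] Loc2 ℚ (RP' ℚ) :=
  LocalizedModule.mkLinearMap (Submonoid.powers (2 : RF ℚ)) (RP' ℚ)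

theorem lm_inj {R M : Type*} [CommRing R] [AddCommGroup M] [Module R M] (r : R) (k : ℕ)
    (w : LocalizedModule (Submonoid.powers r) M) (h : (r ^ k) • w = 0) : w = 0 := by
  have := IsLocalizedModule.smul_injective (S := Submonoid.powers r)
    (LocalizedModule.mkLinearMap (Submonoid.powers r) M) ⟨r ^ k, k, rfl⟩
  apply this
  refine h.trans ?_
  simp

theorem lm_surj {R M : Type*} [CommRing R] [AddCommGroup M] [Module R M] (r : R)
    (w : LocalizedModule (Submonoid.powers r) M) : ∃ (k : ℕ) (m : M),
      (r ^ k) • w = LocalizedModule.mkLinearMap (Submonoid.powers r) M m := by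
  obtain ⟨⟨m, ⟨_, k, rfl⟩⟩, h⟩ := IsLocalizedModule.surj (Submonoid.powers r)
    (LocalizedModule.mkLinearMap (Submonoid.powers r) M) w
  exact ⟨k, m, h⟩

theorem lm_div {R M : Type*} [CommRing R] [AddCommGroup M] [Module R M] (r : R) (k : ℕ)
    (w : LocalizedModule (Submonoid.powers r) M) :
    ∃ w' : LocalizedModule (Submonoid.powers r) M, (r ^ k) • w' = w := by
  have := (Module.End.isUnit_iff _).1 (IsLocalizedModule.map_units (S := Submonoid.powers r)
    (LocalizedModule.mkLinearMap (Submonoid.powers r) M) ⟨r ^ k, k, rfl⟩)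
  obtain ⟨n', h⟩ := this.2 w
  exact ⟨n', h⟩

theorem loc2_two_inj (k : ℕ) (w : Loc2 ℚ (RP' ℚ)) (h : (2 ^ k : RF ℚ) • w = 0) : w = 0 :=
  lm_inj 2 k w h

theorem loc2_surj (n : Loc2 ℚ (RP' ℚ)) : ∃ (k : ℕ) (m : RP' ℚ), (2 ^ k : RF ℚ) • n = tl2 m :=
  lm_surj 2 n

theorem loc2_half (k : ℕ) (w : Loc2 ℚ (RP' ℚ)) (hw : w ∈ IRPhalf) :
    ∃ w' ∈ IRPhalf, (2 ^ k : RF ℚ) • w' = w := by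
  unfold IRPhalf at hw
  induction hw using Submodule.smul_induction_on' with
  | smul r hr n hn =>
    obtain ⟨n', hn'⟩ : ∃ n' : Loc2 ℚ (RP' ℚ), (2 ^ k : RF ℚ) • n' = n := by
      exact lm_div 2 k n
    exact ⟨r • n', Submodule.smul_mem_smul hr trivial, by rw [smul_comm, hn']⟩
  | add x hx y hy h1 h2 =>
    obtain ⟨a, ha, ha'⟩ := h1
    obtain ⟨b, hb, hb'⟩ := h2
    exact ⟨a + b, add_mem ha hb, by rw [smul_add, ha', hb']⟩

theorem irp_frac (w : Loc2 ℚ (RP' ℚ)) (hw : w ∈ IRPhalf) :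
    ∃ (k : ℕ) (z : RP' ℚ), z ∈ augIdeal ℚ • (⊤ : Submodule (RF ℚ) (RP' ℚ)) ∧
      (2 ^ k : RF ℚ) • w = tl2 z := by
  unfold IRPhalf at hw
  induction hw using Submodule.smul_induction_on' with
  | smul r hr n hn =>
    obtain ⟨k, m, h⟩ := loc2_surj n
    exact ⟨k, r • m, Submodule.smul_mem_smul hr trivial, by rw [smul_comm, h, map_smul]⟩
  | add x hx y hy h1 h2 =>
    obtain ⟨k, a, ha, ha'⟩ := h1
    obtain ⟨l, b, hb, hb'⟩ := h2
    refine ⟨k + l, (2 ^ l : RF ℚ) • a + (2 ^ k : RF ℚ) • b,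
      add_mem (Submodule.smul_mem _ _ ha) (Submodule.smul_mem _ _ hb), ?_⟩
    rw [map_add, map_smul, map_smul, ← ha', ← hb', smul_add, smul_smul, smul_smul, pow_add,
      mul_comm]

theorem irp_mem (z : RP' ℚ) (hz : z ∈ augIdeal ℚ • (⊤ : Submodule (RF ℚ) (RP' ℚ))) :
    toLoc2 ℚ z ∈ IRPhalf := by
  have : Submodule.map tl2 (augIdeal ℚ • (⊤ : Submodule (RF ℚ) (RP' ℚ))) ≤ IRPhalf := by
    rw [Submodule.map_smul'']
    exact Submodule.smul_mono le_rfl le_top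
  exact this ⟨z, hz, rfl⟩

noncomputable abbrev twMod (p : Nat.Primes) :
    Module ℤ (LocalizedModule (Submonoid.powers (2 : ℤ)) (PBp p)) :=
  OreLocalization.instModuleOfIsScalarTower

theorem tw_two_inj (p : Nat.Primes) (k : ℕ) (w : Twist p) (h : (2 ^ k : ℤ) • w = 0) : w = 0 := by
  apply lm_inj (2 : ℤ) k (w : LocalizedModule (Submonoid.powers (2 : ℤ)) (PBp p))
  exact (int_smul_eq_zsmul (twMod p) _ _).trans h

theorem tw_surj (p : Nat.Primes) (t : Twist p) : ∃ (k : ℕ) (y : PBp p), (2 ^ k : ℤ) • t = toTw p y := by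
  obtain ⟨k, m, h⟩ := lm_surj (2 : ℤ) (t : LocalizedModule (Submonoid.powers (2 : ℤ)) (PBp p))
  exact ⟨k, m, (int_smul_eq_zsmul (twMod p) _ _).symm.trans h⟩

theorem tw_smul2 (p : Nat.Primes) (k : ℕ) (t : Twist p) : (2 ^ k : RF ℚ) • t = (2 ^ k : ℤ) • t := by
  rw [tw_smul, map_pow]; congr 2
  exact map_ofNat _ 2

theorem toTw_zsmul (p : Nat.Primes) (n : ℤ) (x : PBp p) : toTw p (n • x) = n • toTw p x := by
  exact map_zsmul (AddMonoidHom.mk' (toTw p) (toTw_add p)) n x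

theorem surj_gen (p : Nat.Primes) (CC : ∀ p : Nat.Primes, PBp p)
    (hCC2 : ∀ p : Nat.Primes, (p : ℕ) = 2 → CC p ≠ 0)
    (Sfull : RP' ℚ →ₗ[RF ℚ] ∀ p : Nat.Primes, Twist p)
    (hS0 : ∀ (x : ℚˣ) (p : Nat.Primes), vP p x = 0 →
      Sfull (rp ℚ x) p = toTw p (pbK p (redQ p (x : ℚ))))
    (hSpos : ∀ (x : ℚˣ) (p : Nat.Primes), 0 < vP p x →
      Sfull (rp ℚ x) p = toTw p (CC p)) (y : PBp p) :
    ∃ z ∈ augIdeal ℚ • (⊤ : Submodule (RF ℚ) (RP' ℚ)), Sfull z p = (4 : ℤ) • toTw p y ∧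
      ∀ q, q ≠ p → Sfull z q = 0 := by
  have fp : Fact (p : ℕ).Prime := ⟨p.2⟩
  have p0 : ((p : ℕ) : ℚ) ≠ 0 := by exact_mod_cast p.2.ne_zero
  have key : ∀ x : ℚˣ, ∃ z ∈ augIdeal ℚ • (⊤ : Submodule (RF ℚ) (RP' ℚ)),
      Sfull z p = (4 : ℤ) • Sfull (rp ℚ x) p ∧ ∀ q, q ≠ p → Sfull z q = 0 := by
    intro x
    refine ⟨(2 * (1 - cls ℚ (Units.mk0 _ p0)) : RF ℚ) • rp ℚ x, Submodule.smul_mem_smul ?_ trivial, ?_, ?_⟩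
    · refine Ideal.mul_mem_left _ _ ?_
      rw [augIdeal, RingHom.mem_ker, map_sub, map_one]
      unfold augRF cls
      show 1 - (MonoidAlgebra.lift ℤ ℤ (SqCl ℚ)) 1 _ = _
      rw [MonoidAlgebra.lift_of]; simp
    · rw [map_smul, Pi.smul_apply, tw_smul, map_mul, map_sub, map_one, chiRing_cls]
      have : chiRing (chiP p) 2 = 2 := map_ofNat _ 2
      rw [this]
      simp
    · intro q hq
      have fq : Fact (q : ℕ).Prime := ⟨q.2⟩
      rw [map_smul, Pi.smul_apply, tw_smul, map_mul, map_sub, map_one, chiRing_cls]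
      have : padicValRat q (p : ℚ) = 0 := by
        rw [padicValRat.of_nat]
        have := padicValNat_primes (p := (q : ℕ)) (q := (p : ℕ)) (fun h => hq (Subtype.ext h))
        exact_mod_cast this
      simp [this]
  have hneg : ∀ y : PBp p, (∃ z ∈ augIdeal ℚ • (⊤ : Submodule (RF ℚ) (RP' ℚ)), Sfull z p = (4 : ℤ) • toTw p y ∧
      ∀ q, q ≠ p → Sfull z q = 0) → (∃ z ∈ augIdeal ℚ • (⊤ : Submodule (RF ℚ) (RP' ℚ)), Sfull z p = (4 : ℤ) • toTw p (-y) ∧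
      ∀ q, q ≠ p → Sfull z q = 0) := by
    rintro y ⟨z, h1, h2, h3⟩
    refine ⟨-z, neg_mem h1, ?_, ?_⟩
    · rw [map_neg, Pi.neg_apply, h2, toTw_neg, smul_neg]
    · intro q hq; rw [map_neg, Pi.neg_apply, h3 q hq, neg_zero]
  have hz0 : (∃ z ∈ augIdeal ℚ • (⊤ : Submodule (RF ℚ) (RP' ℚ)), Sfull z p = (4 : ℤ) • toTw p 0 ∧
      ∀ q, q ≠ p → Sfull z q = 0) := ⟨0, zero_mem _, by simp [toTw_zero], fun q _ => by simp⟩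
  by_cases p2 : (p : ℕ) = 2
  · obtain ⟨e, he⟩ := PBp_two p p2
    obtain ⟨z, h1, h2, h3⟩ := key (Units.mk0 _ p0)
    rw [hSpos (Units.mk0 _ p0) p (by simp [vP])] at h2
    have hC := hCC2 p p2
    have : y = 0 ∨ y = CC p ∨ y = - CC p := by
      rw [← e.injective.eq_iff, ← e.injective.eq_iff (a := y), ← e.injective.eq_iff (a := y), map_neg, map_zero]
      rw [Ne, ← e.injective.eq_iff, map_zero] at hC
      revert hC
      generalize e y = a
      generalize e (CC p) = b
      revert a b; decide
    rcases this with rfl | rfl | rfl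
    · exact hz0
    · exact ⟨z, h1, h2, h3⟩
    · exact hneg _ ⟨z, h1, h2, h3⟩
  by_cases p3 : (p : ℕ) = 3
  · obtain ⟨e⟩ := PBp_three p p3
    refine ⟨0, zero_mem _, ?_, fun q _ => by simp⟩
    rw [← toTw_zsmul]
    have : (4 : ℤ) • y = 0 := by
      apply e.injective
      rw [map_zsmul, map_zero]
      generalize e y = a
      revert a; decide
    rw [this, toTw_zero]; simp
  obtain ⟨e, he⟩ := PBp_five p p2 p3
  obtain ⟨y', rfl⟩ := e.symm.surjective y
  refine PBloch_ind (P := fun y' => ∃ z ∈ augIdeal ℚ • (⊤ : Submodule (RF ℚ) (RP' ℚ)), Sfull z p = (4 : ℤ) • toTw p (e.symm y') ∧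
      ∀ q, q ≠ p → Sfull z q = 0) ?_ ?_ ?_ ?_ y'
  · rw [map_zero]; exact hz0
  · rintro a b ⟨z, h1, h2, h3⟩ ⟨z', h1', h2', h3'⟩
    refine ⟨z + z', add_mem h1 h1', ?_, ?_⟩
    · rw [map_add, Pi.add_apply, h2, h2', map_add, toTw_add, smul_add]
    · intro q hq; rw [map_add, Pi.add_apply, h3 q hq, h3' q hq, add_zero]
  · intro a h
    rw [map_neg]; exact hneg _ h
  · intro a
    have a0 : (a : ZMod p) ≠ 0 := a.ne_zero
    have hv : (a : ZMod p).val ≠ 0 := by rwa [Ne, ZMod.val_eq_zero]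
    have hq : (((a : ZMod p).val : ℕ) : ℚ) ≠ 0 := by exact_mod_cast hv
    obtain ⟨z, h1, h2, h3⟩ := key (Units.mk0 _ hq)
    rw [hS0 (Units.mk0 _ hq) p] at h2
    · refine ⟨z, h1, ?_, h3⟩
      rw [h2]; congr 2
      rw [AddEquiv.eq_symm_apply]
      have : redQ p ((Units.mk0 _ hq : ℚˣ) : ℚ) = (a : ZMod p) := by
        unfold redQ
        rw [Units.val_mk0, Rat.cast_natCast, ZMod.natCast_zmod_val]
      rw [this, he _ a0]
      congr 1
      ext; rfl
    · simp only [vP, Units.val_mk0, padicValRat.of_nat]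
      rw [padicValNat.eq_zero_of_not_dvd]; · rfl
      intro hd
      exact absurd (Nat.le_of_dvd (Nat.pos_of_ne_zero hv) hd) (by simpa using ZMod.val_lt (a : ZMod p))

theorem Sbar_bij (CC : ∀ p : Nat.Primes, PBp p)
    (hCC : ∀ (p : Nat.Primes) (a : ZMod p), a ≠ 0 → a ≠ 1 →
      CC p = pbK p a + pbK p (1 - a))
    (hCC2 : ∀ p : Nat.Primes, (p : ℕ) = 2 → CC p ≠ 0)
    (Sfull : RP' ℚ →ₗ[RF ℚ] ∀ p : Nat.Primes, Twist p)
    (hS0 : ∀ (x : ℚˣ) (p : Nat.Primes), vP p x = 0 →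
      Sfull (rp ℚ x) p = toTw p (pbK p (redQ p (x : ℚ))))
    (hSpos : ∀ (x : ℚˣ) (p : Nat.Primes), 0 < vP p x →
      Sfull (rp ℚ x) p = toTw p (CC p))
    (hSneg : ∀ (x : ℚˣ) (p : Nat.Primes), vP p x < 0 →
      Sfull (rp ℚ x) p = -toTw p (CC p))
    (Sbar : ↥IRPhalf →ₗ[RF ℚ] DirectSum Nat.Primes Twist)
    (hSbar : ∀ (z : RP' ℚ) (hz : toLoc2 ℚ (M := RP' ℚ) z ∈ IRPhalf) (p : Nat.Primes),
      Sbar ⟨toLoc2 ℚ z, hz⟩ p = Sfull z p) :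
    Function.Bijective Sbar := by
  constructor
  · rw [← LinearMap.ker_eq_bot, LinearMap.ker_eq_bot']
    rintro ⟨w, hw⟩ h
    obtain ⟨k, z, hz, e⟩ := irp_frac w hw
    have e2 : (⟨toLoc2 ℚ z, irp_mem z hz⟩ : ↥IRPhalf) = (2 ^ k : RF ℚ) • ⟨w, hw⟩ := Subtype.ext e.symm
    have h0 : ∀ p, Sfull z p = 0 := by
      intro p
      rw [← hSbar z (irp_mem z hz), e2, map_smul, h, smul_zero]; rfl
    obtain ⟨j, hj⟩ := core CC hCC hCC2 Sfull hS0 hSpos hSneg z ⟨0, by simpa using hz⟩ h0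
    have : (2 ^ (j + k) : RF ℚ) • w = 0 := by
      rw [pow_add, mul_smul, e, ← map_smul, hj, map_zero]
    exact Subtype.ext (loc2_two_inj _ _ this)
  · intro t
    induction t using DirectSum.induction_on with
    | zero => exact ⟨0, map_zero _⟩
    | add x y hx hy =>
      obtain ⟨a, rfl⟩ := hx
      obtain ⟨b, rfl⟩ := hy
      exact ⟨a + b, map_add _ _ _⟩
    | of p t =>
      obtain ⟨k, y, hk⟩ := tw_surj p t
      obtain ⟨z, h1, h2, h3⟩ := surj_gen p CC hCC2 Sfull hS0 hSpos y
      obtain ⟨w, hw, hw'⟩ := loc2_half (2 + k) _ (irp_mem z h1)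
      refine ⟨⟨w, hw⟩, ?_⟩
      have e2 : (⟨toLoc2 ℚ z, irp_mem z h1⟩ : ↥IRPhalf) = (2 ^ (2 + k) : RF ℚ) • ⟨w, hw⟩ := Subtype.ext hw'.symm
      ext q
      rw [← sub_eq_zero]
      apply tw_two_inj q (2 + k)
      have h4 := hSbar z (irp_mem z h1) q
      rw [e2, map_smul, DirectSum.smul_apply, tw_smul2] at h4
      rw [smul_sub, h4, sub_eq_zero]
      by_cases hq : q = p
      · subst hq
        rw [h2, DirectSum.of_eq_same, pow_add, mul_smul, hk]; norm_num
      · rw [h3 q hq, DirectSum.of_eq_of_ne _ _ _ hq, smul_zero]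


namespace Cyc

variable {n : ℕ} [NeZero n]

def ell (i j : ZMod n) : ℕ := (j - i).val

/-- carry cocycle -/
def ee (i j k : ZMod n) : ℕ := if ell i j + ell j k < n then 0 else 1

theorem ell_lt (i j : ZMod n) : ell i j < n := ZMod.val_lt _

theorem ell_cast (i j : ZMod n) : ((ell i j : ℕ) : ZMod n) = j - i := by
  unfold ell; rw [ZMod.natCast_zmod_val]

theorem ee_eq (i j k : ZMod n) : ell i j + ell j k = ell i k + n * ee i j k := by
  have h1 := ell_lt i j
  have h2 := ell_lt j k
  have h3 := ell_lt i k
  have h : ((ell i j + ell j k : ℕ) : ZMod n) = (ell i k : ℕ) := by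
    push_cast; rw [ell_cast, ell_cast, ell_cast]; ring
  rw [ZMod.natCast_eq_natCast_iff'] at h
  rw [Nat.mod_eq_of_lt h3] at h
  unfold ee
  split_ifs with h4
  · rw [Nat.mod_eq_of_lt h4] at h; omega
  · rw [Nat.mod_eq_sub_mod (by omega), Nat.mod_eq_of_lt (by omega)] at h; omega

theorem ee_cocycle (i j k l : ZMod n) : ee j k l + ee i j l = ee i k l + ee i j k := by
  have h1 := ee_eq j k l
  have h2 := ee_eq i j l
  have h3 := ee_eq i k l
  have h4 := ee_eq i j k
  have hn : 0 < n := Nat.pos_of_ne_zero (NeZero.ne n)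
  have : n * (ee j k l + ee i j l) = n * (ee i k l + ee i j k) := by
    rw [mul_add, mul_add]; omega
  exact Nat.eq_of_mul_eq_mul_left hn this

theorem ell_self (i : ZMod n) : ell i i = 0 := by simp [ell]

theorem ee_self_left (i j : ZMod n) : ee i i j = 0 := by
  unfold ee; rw [ell_self, zero_add, if_pos (ell_lt _ _)]

theorem ee_self_right (i j : ZMod n) : ee i j j = 0 := by
  unfold ee; rw [ell_self, add_zero, if_pos (ell_lt _ _)]

theorem ee_round (i j : ZMod n) (h : i ≠ j) : ee i j i = 1 := by
  have := ee_eq i j i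
  rw [ell_self, zero_add] at this
  have h0 : ell i j ≠ 0 := by
    unfold ell; rw [Ne, ZMod.val_eq_zero, sub_eq_zero]; exact fun e => h e.symm
  unfold ee at this ⊢
  split_ifs at this ⊢ with h4
  · omega
  · rfl

theorem ell_shift (i j c : ZMod n) : ell (i + c) (j + c) = ell i j := by
  unfold ell; congr 1; ring

theorem ee_shift (i j k c : ZMod n) : ee (i + c) (j + c) (k + c) = ee i j k := by
  unfold ee; rw [ell_shift, ell_shift]

/-- the basic cocycle -/
def cc (i j k l : ZMod n) : ZMod n := (j - i) * (ee j k l : ZMod n)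

theorem cc_shift (i j k l c : ZMod n) : cc (i + c) (j + c) (k + c) (l + c) = cc i j k l := by
  unfold cc; rw [ee_shift]; ring

theorem cc_cocycle (a b c d e : ZMod n) :
    cc b c d e - cc a c d e + cc a b d e - cc a b c e + cc a b c d = 0 := by
  unfold cc
  have := congrArg (Nat.cast (R := ZMod n)) (ee_cocycle b c d e)
  push_cast at this
  linear_combination (a - b) * this

variable {A : Type*} [AddCommGroup A]

theorem cyc_main (hn : 4 ≤ n) (B : ZMod n → ZMod n → ZMod n → ZMod n → A)
    (hE : ∀ i0 i1 i2 t t', i0 ≠ i1 → i0 ≠ i2 → i1 ≠ i2 → t ≠ t' →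
      B i1 i2 t t' - B i0 i2 t t' + B i0 i1 t t' = B i0 i1 i2 t' - B i0 i1 i2 t)
    (hI : ∀ i j k l c, B (i + c) (j + c) (k + c) (l + c) = B i j k l)
    (hZ : ∀ i j k, i ≠ j → i ≠ k → j ≠ k → B i j k k = 0) :
    ∃ (φ : ZMod n →+ A) (g : ZMod n → ZMod n → ZMod n → A),
      (∀ i j k c, g (i + c) (j + c) (k + c) = g i j k) ∧
      ∀ i j k l, i ≠ j → i ≠ k → j ≠ k →
        B i j k l = g j k l - g i k l + g i j l - g i j k + φ (cc i j k l) := by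
  have one_ne : ∀ t : ZMod n, t ≠ t + 1 := by
    intro t h
    have : Fact (1 < n) := ⟨by omega⟩
    exact one_ne_zero (α := ZMod n) (by linear_combination - h)
  let G : ZMod n → ZMod n → ZMod n → ℕ → A :=
    fun i j t m => ∑ s ∈ Finset.range m, B i j (t + s) (t + s + 1)
  have GE : ∀ i0 i1 i2 t (m : ℕ), i0 ≠ i1 → i0 ≠ i2 → i1 ≠ i2 →
      G i1 i2 t m - G i0 i2 t m + G i0 i1 t m = B i0 i1 i2 (t + m) - B i0 i1 i2 t := by
    intro i0 i1 i2 t m h1 h2 h3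
    induction m with
    | zero => simp [G]
    | succ m ih =>
      simp only [G, Finset.sum_range_succ] at ih ⊢
      have := hE i0 i1 i2 (t + m) (t + m + 1) h1 h2 h3 (one_ne _)
      rw [show (t + ((m + 1 : ℕ) : ZMod n)) = t + m + 1 by push_cast; ring]
      calc _ = _ := ?_
        _ = _ := congrArg₂ (· + ·) ih this
        _ = _ := by abel
      abel
  have Gadd : ∀ i j t (m l : ℕ), G i j t (m + l) = G i j t m + G i j (t + m) l := by
    intro i j t m l
    simp only [G, Finset.sum_range_add]
    congr 1
    apply Finset.sum_congr rfl
    intro s _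
    push_cast
    rw [← add_assoc t]
  have GL0 : ∀ i j t, G i j t n = G i j 0 n := by
    have step : ∀ i j t, G i j (t + 1) n = G i j t n := by
      intro i j t
      have h1 := Gadd i j t 1 n
      have h2 := Gadd i j t n 1
      rw [add_comm 1 n, h2] at h1
      have h3 : G i j (t + (n : ℕ)) 1 = G i j t 1 := by simp
      rw [h3, Nat.cast_one, add_comm] at h1
      exact (add_left_cancel h1).symm
    intro i j t
    obtain ⟨m, rfl⟩ := ZMod.natCast_zmod_surjective t
    induction m with
    | zero => simp
    | succ m ih => push_cast; rw [step, ih]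
  have Gshift : ∀ i j t m c, G (i + c) (j + c) (t + c) m = G i j t m := by
    intro i j t m c
    apply Finset.sum_congr rfl
    intro s _
    rw [← hI i j (t + s) (t + s + 1) c]
    congr 1 <;> ring
  let f : ZMod n → A := fun x => G 0 x 0 n
  have Lf : ∀ i j t, G i j t n = f (j - i) := by
    intro i j t
    have := Gshift 0 (j - i) (t - i) n i
    rw [zero_add, sub_add_cancel, sub_add_cancel, GL0 0] at this
    exact this
  have f3 : ∀ x y, x ≠ 0 → y ≠ 0 → x + y ≠ 0 → f (x + y) = f x + f y := by
    intro x y hx hy hxy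
    have := GE 0 x (x + y) 0 n (Ne.symm hx) (Ne.symm hxy) (by simpa using hy)
    rw [Lf, Lf, Lf] at this
    simp only [ZMod.natCast_self, add_zero, sub_self, sub_zero, add_sub_cancel_left] at this
    rw [← sub_eq_zero]
    rw [← neg_eq_zero, ← this]; abel
  have cne : ∀ m : ℕ, 0 < m → m < n → (m : ZMod n) ≠ 0 := by
    intro m h0 h1 h
    rw [ZMod.natCast_eq_zero_iff] at h
    exact absurd (Nat.le_of_dvd h0 h) (by omega)
  have fm : ∀ m : ℕ, 0 < m → m < n → f m = m • f 1 := by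
    intro m h0 h1
    induction m with
    | zero => omega
    | succ m ih =>
      rcases Nat.eq_zero_or_pos m with rfl | hm
      · simp
      · have := f3 m 1 (cne m hm (by omega)) (by simpa using cne 1 (by omega) (by omega))
          (by exact_mod_cast cne (m + 1) (by omega) h1)
        push_cast
        rw [this, ih hm (by omega), succ_nsmul]
  have na : n • f 1 = 0 := by
    have h1 := f3 (n - 1 : ℕ) 2 (cne _ (by omega) (by omega)) (by simpa using cne 2 (by omega) (by omega))
      (by
        have : (((n - 1 : ℕ) : ZMod n) + 2) = 1 := by
          rw [Nat.cast_sub (by omega)]; simp; ring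
        rw [this]; simpa using cne 1 (by omega) (by omega))
    have h2 : (((n - 1 : ℕ) : ZMod n) + 2) = 1 := by
      rw [Nat.cast_sub (by omega)]; simp; ring
    have h3 := fm 2 (by omega) (by omega)
    rw [h2, fm (n - 1) (by omega) (by omega)] at h1
    push_cast at h3
    rw [h3, ← add_smul, show n - 1 + 2 = n + 1 by omega, add_smul, one_smul] at h1
    exact left_eq_add.1 (by rwa [add_comm] at h1)
  let φ : ZMod n →+ A := ZMod.lift n ⟨zmultiplesHom A (f 1), by simpa using na⟩
  have hφ : ∀ m : ℕ, φ m = m • f 1 := by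
    intro m
    have := ZMod.lift_coe n (⟨zmultiplesHom A (f 1), by simpa using na⟩ :
        {f : ℤ →+ A // f n = 0}) m
    simpa [φ] using this
  have fφ : ∀ x, x ≠ 0 → f x = φ x := by
    intro x hx
    have h1 : ((x.val : ℕ) : ZMod n) = x := ZMod.natCast_zmod_val x
    rw [← h1, hφ, ← fm _ (Nat.pos_of_ne_zero (by rwa [Ne, ZMod.val_eq_zero])) (ZMod.val_lt x)]
  refine ⟨φ, fun i j k => G i j j (ell j k), ?_, ?_⟩
  · intro i j k c
    simp only [ell_shift, Gshift]
  · intro i j k l h1 h2 h3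
    have e1 := GE i j k k (ell k l) h1 h2 h3
    rw [ell_cast, add_sub_cancel, hZ i j k h1 h2 h3, sub_zero] at e1
    have e2 := Gadd i j j (ell j k) (ell k l)
    rw [ee_eq, ell_cast, add_sub_cancel] at e2
    have e3 : G i j j (ell j l + n * ee j k l) = G i j j (ell j l) + φ (cc i j k l) := by
      unfold ee cc ee
      split_ifs
      · simp
      · rw [mul_one, Gadd, Lf, fφ _ (sub_ne_zero.2 (Ne.symm h1))]; simp
    rw [e3] at e2
    rw [← e1]
    simp only
    have e4 : G i j k (ell k l) = G i j j (ell j l) + φ (cc i j k l) - G i j j (ell j k) := by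
      rw [e2]; abel
    rw [e4]; abel

end Cyc


theorem tw_ft1 {F A : Type*} [Field F] [AddCommGroup A] {b : F → A} (h : Tw (1 : F →*₀ ℤ) b)
    (x y : F) (hx : x ≠ 0) (hx1 : x ≠ 1) (hy : y ≠ 0) (hy1 : y ≠ 1) :
    b x - b y + b (y / x) - b ((1 - x⁻¹) / (1 - y⁻¹)) + b ((1 - x) / (1 - y)) = 0 := by
  have := h.ft x y hx hx1 hy hy1
  rw [MonoidWithZeroHom.one_apply_of_ne_zero hx,
    MonoidWithZeroHom.one_apply_of_ne_zero (sub_ne_zero.2 (Ne.symm hx1))] at this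
  simpa using this

section
variable {F A : Type*} [Field F] [AddCommGroup A] {b : F → A}

noncomputable def bb (b : F → A) (N D : F) : A :=
  if D = 0 then - b 2 else if N = 0 then b 2 else b (N / D)

theorem bb_scale (N D c : F) (hc : c ≠ 0) : bb b (c * N) (c * D) = bb b N D := by
  unfold bb
  by_cases hD : D = 0
  · simp [hD]
  · by_cases hN : N = 0
    · simp [hN, hD, hc]
    · rw [if_neg (mul_ne_zero hc hD), if_neg (mul_ne_zero hc hN), if_neg hD, if_neg hN,
        mul_div_mul_left _ _ hc]

theorem bb_swap (h : Tw (1 : F →*₀ ℤ) b) (N D : F) (hND : N ≠ 0 ∨ D ≠ 0) : bb b D N = - bb b N D := by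
  unfold bb
  by_cases hD : D = 0
  · have hN : N ≠ 0 := by tauto
    simp [hD, hN]
  · by_cases hN : N = 0
    · simp [hN, hD]
    · rw [if_neg hN, if_neg hD, if_neg hD, if_neg hN, ← h.binv _ (div_ne_zero hN hD), inv_div]

theorem bb_D0 (N : F) : bb b N 0 = - b 2 := by simp [bb]
theorem bb_N0 (D : F) (hD : D ≠ 0) : bb b 0 D = b 2 := by simp [bb, hD]
theorem bb_nn (N D : F) (hN : N ≠ 0) (hD : D ≠ 0) : bb b N D = b (N / D) := by simp [bb, hD, hN]
theorem bb_self (h : Tw (1 : F →*₀ ℤ) b) (N : F) (hN : N ≠ 0) : bb b N N = 0 := by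
  rw [bb_nn _ _ hN hN, div_self hN, h.b1]

theorem bbE (h : Tw (1 : F →*₀ ℤ) b) (h2 : (2 : F) ≠ 0) (X Y X' Y' : F) (hd : X * Y' - X' * Y ≠ 0) :
    bb b (Y' * (X - Y)) (Y * (X' - Y')) - bb b (X' * (X - Y)) (X * (X' - Y'))
      + bb b (X' * Y) (Y' * X) = bb b X' Y' - bb b X Y := by
  have c3 := h.c3 h2
  -- point at infinity
  have inf : ∀ y : F, - bb b y (y - 1) = bb b y 1 + b 2 := by
    intro y
    by_cases y0 : y = 0
    · subst y0
      rw [bb_N0 _ (by simp), bb_N0 _ one_ne_zero, ← sub_eq_zero, ← neg_eq_zero, ← c3]; abel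
    by_cases y1 : y = 1
    · subst y1
      rw [sub_self, bb_D0, bb_self h _ one_ne_zero]; abel
    have y2 : y - 1 ≠ 0 := sub_ne_zero.2 y1
    rw [bb_nn _ _ y0 y2, bb_nn _ _ y0 one_ne_zero, div_one, ← h.binv _ (div_ne_zero y0 y2), inv_div]
    have := h.bC h2 (y⁻¹) (inv_ne_zero y0) (by rwa [Ne, inv_eq_one])
    rw [h.binv _ y0, show 1 - y⁻¹ = (y - 1) / y by field_simp] at this
    rw [← this]; abel
  have fin : ∀ x y : F, x ≠ y → bb b (x - 1) (y - 1) - bb b (y * (x - 1)) (x * (y - 1)) + bb b y x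
      = bb b y 1 - bb b x 1 := by
    have one : ∀ x y : F, x ≠ y → x = 0 ∨ x = 1 → bb b (x - 1) (y - 1) - bb b (y * (x - 1)) (x * (y - 1)) + bb b y x
      = bb b y 1 - bb b x 1 := by
      rintro x y hxy (rfl | rfl)
      · have y0 : y ≠ 0 := Ne.symm hxy
        rw [zero_mul, bb_D0, bb_D0, bb_N0 _ one_ne_zero]
        by_cases y1 : y = 1
        · subst y1
          rw [sub_self, bb_D0, bb_self h _ one_ne_zero]; abel
        · have y2 : y - 1 ≠ 0 := sub_ne_zero.2 y1
          rw [bb_nn _ _ (by simp) y2, bb_nn _ _ y0 one_ne_zero, div_one, ← h.bC h2 y y0 y1]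
          rw [show (0 - 1) / (y - 1) = (1 - y)⁻¹ by rw [← neg_sub 1 y]; rw [zero_sub, neg_div_neg_eq, one_div], h.binv _ (sub_ne_zero.2 (Ne.symm y1))]
          abel
      · have y2 : y - 1 ≠ 0 := sub_ne_zero.2 (Ne.symm hxy)
        rw [sub_self, mul_zero, one_mul, bb_N0 _ y2, bb_self h _ one_ne_zero]; abel
    intro x y hxy
    by_cases hx : x = 0 ∨ x = 1
    · exact one x y hxy hx
    by_cases hy : y = 0 ∨ y = 1
    · have := one y x (Ne.symm hxy) hy
      push Not at hx
      have x2 : x - 1 ≠ 0 := sub_ne_zero.2 hx.2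
      rw [bb_swap h (x - 1) (y - 1) (Or.inl x2), bb_swap h y x (Or.inr hx.1)] at this
      by_cases y0 : y = 0
      · subst y0
        rw [zero_mul, bb_N0 _ (mul_ne_zero hx.1 (by simp))]
        rw [zero_mul, bb_D0] at this
        rw [← neg_inj]
        calc _ = _ := ?_
          _ = _ := this
          _ = _ := by abel
        abel
      · have y1 : y = 1 := by tauto
        subst y1
        rw [sub_self, mul_zero, one_mul, bb_D0]
        rw [sub_self, mul_zero, one_mul, bb_N0 _ x2, bb_D0] at this
        rw [← neg_inj]
        calc _ = _ := ?_
          _ = _ := this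
          _ = _ := by abel
        abel
    push Not at hx hy
    obtain ⟨x0, x1⟩ := hx
    obtain ⟨y0, y1⟩ := hy
    have x2 : x - 1 ≠ 0 := sub_ne_zero.2 x1
    have y2 : y - 1 ≠ 0 := sub_ne_zero.2 y1
    have := tw_ft1 h x y x0 x1 y0 y1
    rw [bb_nn _ _ x2 y2, bb_nn _ _ (mul_ne_zero y0 x2) (mul_ne_zero x0 y2), bb_nn _ _ y0 x0,
      bb_nn _ _ y0 one_ne_zero, bb_nn _ _ x0 one_ne_zero, div_one, div_one]
    rw [show (1 - x⁻¹) / (1 - y⁻¹) = (y * (x - 1)) / (x * (y - 1)) by field_simp,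
      show (1 - x) / (1 - y) = (x - 1) / (y - 1) by rw [← neg_sub x, ← neg_sub y, neg_div_neg_eq]] at this
    rw [← sub_eq_zero, ← this]; abel
  by_cases hY : Y = 0
  · subst hY
    have hX : X ≠ 0 := by rintro rfl; simp at hd
    have hY' : Y' ≠ 0 := by rintro rfl; simp at hd
    have e1 := inf (X' / Y')
    rw [← bb_scale _ _ Y' hY', ← bb_scale _ 1 Y' hY', mul_sub, mul_one, mul_div_cancel₀ _ hY'] at e1
    rw [zero_mul, bb_D0, mul_zero, bb_N0 _ (mul_ne_zero hY' hX), bb_D0, sub_zero, mul_comm X', bb_scale _ _ X hX,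
      sub_eq_add_neg, e1]
    abel
  by_cases hY' : Y' = 0
  · subst hY'
    have hX : X' ≠ 0 := by rintro rfl; simp at hd
    have e1 := inf (X / Y)
    rw [← bb_scale _ _ Y hY, ← bb_scale _ 1 Y hY, mul_sub, mul_one, mul_div_cancel₀ _ hY] at e1
    rw [zero_mul, zero_mul, sub_zero, bb_N0 _ (mul_ne_zero hY hX), bb_D0, bb_D0, mul_comm X, bb_scale _ _ X' hX]
    rw [bb_swap h X (X - Y)] at *
    · rw [e1]; abel
    · by_cases h0 : X = 0
      · subst h0; simp [hY]
      · exact Or.inl h0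
  have e1 := fin (X / Y) (X' / Y') (fun e => hd (by field_simp at e; linear_combination e))
  rw [← bb_scale (X / Y - 1) _ (Y * Y') (mul_ne_zero hY hY'),
    ← bb_scale (X' / Y' * _) _ (Y * Y') (mul_ne_zero hY hY'),
    ← bb_scale (X' / Y') (X / Y) (Y * Y') (mul_ne_zero hY hY'),
    ← bb_scale (X' / Y') 1 (Y') (hY'), ← bb_scale (X / Y) 1 (Y) (hY)] at e1
  rw [← bb_scale X' Y' 1 one_ne_zero]
  rw [show Y' * (X - Y) = Y * Y' * (X / Y - 1) by field_simp,
    show Y * (X' - Y') = Y * Y' * (X' / Y' - 1) by field_simp,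
    show X' * (X - Y) = Y * Y' * (X' / Y' * (X / Y - 1)) by field_simp,
    show X * (X' - Y') = Y * Y' * (X / Y * (X' / Y' - 1)) by field_simp,
    show X' * Y = Y * Y' * (X' / Y') by field_simp,
    show Y' * X = Y * Y' * (X / Y) by field_simp, e1, one_mul, one_mul, mul_div_cancel₀ _ hY',
    mul_div_cancel₀ _ hY, mul_one, mul_one]

def dt (v w : F × F) : F := v.1 * w.2 - v.2 * w.1

noncomputable def bk (b : F → A) (v0 v1 v2 v3 : F × F) : A :=
  bb b (dt v3 v0 * dt v2 v1) (dt v3 v1 * dt v2 v0)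

theorem bk_E (h : Tw (1 : F →*₀ ℤ) b) (h2 : (2 : F) ≠ 0) (v0 v1 v2 t t' : F × F)
    (h01 : dt v0 v1 ≠ 0) (h02 : dt v0 v2 ≠ 0) (h12 : dt v1 v2 ≠ 0) (ht : dt t t' ≠ 0) :
    bk b v1 v2 t t' - bk b v0 v2 t t' + bk b v0 v1 t t' = bk b v0 v1 v2 t' - bk b v0 v1 v2 t := by
  have h21 : dt v2 v1 ≠ 0 := by
    intro e; apply h12; unfold dt at *; linear_combination -e
  have h20 : dt v2 v0 ≠ 0 := by
    intro e; apply h02; unfold dt at *; linear_combination -e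
  have := bbE h h2 (dt t v0 * dt v2 v1) (dt t v1 * dt v2 v0) (dt t' v0 * dt v2 v1) (dt t' v1 * dt v2 v0)
    (by
      have e : dt t v0 * dt v2 v1 * (dt t' v1 * dt v2 v0) - dt t' v0 * dt v2 v1 * (dt t v1 * dt v2 v0)
        = dt t t' * dt v0 v1 * dt v2 v1 * dt v2 v0 := by unfold dt; ring
      rw [e]
      exact mul_ne_zero (mul_ne_zero (mul_ne_zero ht h01) h21) h20)
  unfold bk
  rw [← this]
  congr 1
  · congr 1
    · rw [← bb_scale _ _ (dt v2 v0 * dt v0 v1) (mul_ne_zero h20 h01)]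
      congr 1 <;> (unfold dt; ring)
    · rw [← bb_scale _ _ (dt v2 v1 * dt v0 v1) (mul_ne_zero h21 h01)]
      congr 1 <;> (unfold dt; ring)
  · rw [← bb_scale _ _ (dt v2 v1 * dt v2 v0) (mul_ne_zero h21 h20)]
    congr 1 <;> ring

theorem bk_T (T : F × F → F × F) (c : F) (hc : c ≠ 0) (hT : ∀ v w, dt (T v) (T w) = c * dt v w)
    (v0 v1 v2 v3 : F × F) : bk b (T v0) (T v1) (T v2) (T v3) = bk b v0 v1 v2 v3 := by
  unfold bk
  simp only [hT]
  rw [← bb_scale (dt v3 v0 * _) _ (c * c) (mul_ne_zero hc hc)]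
  congr 1 <;> ring

theorem bk_scal (a0 a1 a2 a3 : F) (h0 : a0 ≠ 0) (h1 : a1 ≠ 0) (h2 : a2 ≠ 0) (h3 : a3 ≠ 0)
    (v0 v1 v2 v3 : F × F) : bk b (a0 • v0) (a1 • v1) (a2 • v2) (a3 • v3) = bk b v0 v1 v2 v3 := by
  unfold bk
  rw [← bb_scale (dt v3 v0 * _) _ (a0 * a1 * a2 * a3) (by positivity)]
  congr 1 <;> (simp only [dt, Prod.smul_fst, Prod.smul_snd, smul_eq_mul]; ring)

theorem bk_Z (h : Tw (1 : F →*₀ ℤ) b) (v0 v1 v2 : F × F) (h02 : dt v0 v2 ≠ 0) (h12 : dt v1 v2 ≠ 0) :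
    bk b v0 v1 v2 v2 = 0 := by
  have h21 : dt v2 v1 ≠ 0 := by
    intro e; apply h12; unfold dt at *; linear_combination -e
  have h20 : dt v2 v0 ≠ 0 := by
    intro e; apply h02; unfold dt at *; linear_combination -e
  unfold bk
  rw [mul_comm (dt v2 v1)]
  exact bb_self h _ (mul_ne_zero h20 h21)

end

/-- the order bound -/
theorem n_kill {F A : Type*} [Field F] [Fintype F] [AddCommGroup A] {b : F → A}
    (h : Tw (1 : F →*₀ ℤ) b) (h2 : (2 : F) ≠ 0) (x : F) (hx : x ≠ 0) (hx1 : x ≠ 1) :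
    (Fintype.card F + 1) • b x = 0 := by
  let B : F → A := fun z => if z = 0 then 0 else b z
  have B0 : B 0 = 0 := if_pos rfl
  have Bn : ∀ z, z ≠ 0 → B z = b z := fun z hz => if_neg hz
  have B1 : B 1 = 0 := by rw [Bn _ one_ne_zero, h.b1]
  have T0 : ∑ z, B z = 0 := by
    apply h.nt
    have e : ∑ z, B z = ∑ z, B z⁻¹ := (Function.Bijective.sum_comp inv_involutive.bijective B).symm
    nth_rewrite 1 [e]
    rw [← Finset.sum_add_distrib]
    apply Finset.sum_eq_zero
    intro z _
    by_cases hz : z = 0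
    · subst hz; simp [B0]
    · rw [Bn _ hz, Bn _ (inv_ne_zero hz), h.binv _ hz]; abel
  have Ti : ∀ f : F → F, Function.Injective f → ∑ z, B (f z) = 0 := by
    intro f hf
    rw [← T0]
    exact Function.Bijective.sum_comp (Finite.injective_iff_bijective.1 hf) B
  let s : Finset F := ((Finset.univ.erase 0).erase 1).erase x
  have m1 : (1 : F) ∈ Finset.univ.erase (0 : F) := by simp
  have mx : x ∈ (Finset.univ.erase (0 : F)).erase 1 := by simp [hx, hx1]
  have hs : ∀ f : F → A, ∑ y ∈ s, f y = ∑ y, f y - f 0 - f 1 - f x := by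
    intro f
    rw [← Finset.add_sum_erase _ f (Finset.mem_univ 0), ← Finset.add_sum_erase _ f m1,
      ← Finset.add_sum_erase _ f mx]
    abel
  have cs : s.card + 3 = Fintype.card F := by
    have c1 := Finset.card_erase_add_one mx
    have c2 := Finset.card_erase_add_one m1
    have c3 := Finset.card_erase_add_one (Finset.mem_univ (0 : F))
    rw [Finset.card_univ] at c3
    show (((Finset.univ.erase 0).erase 1).erase x).card + 3 = _
    omega
  have x1' : 1 - x ≠ 0 := sub_ne_zero.2 (Ne.symm hx1)
  have x1i : 1 - x⁻¹ ≠ 0 := sub_ne_zero.2 (fun e => hx1 (by rw [eq_comm, inv_eq_one] at e; exact e))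
  have main : ∑ y ∈ s, (b x - B y + B (x⁻¹ * y) - B ((1 - x⁻¹) * (1 - y⁻¹)⁻¹) + B ((1 - x) * (1 - y)⁻¹)) = 0 := by
    apply Finset.sum_eq_zero
    intro y hy
    simp only [s, Finset.mem_erase, Finset.mem_univ, and_true] at hy
    obtain ⟨yx, y1, y0⟩ := hy
    have y1' : 1 - y ≠ 0 := sub_ne_zero.2 (Ne.symm y1)
    have y1i : 1 - y⁻¹ ≠ 0 := sub_ne_zero.2 (fun e => y1 (by rw [eq_comm, inv_eq_one] at e; exact e))
    rw [Bn _ y0, Bn _ (mul_ne_zero (inv_ne_zero hx) y0), Bn _ (mul_ne_zero x1i (inv_ne_zero y1i)),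
      Bn _ (mul_ne_zero x1' (inv_ne_zero y1'))]
    have := tw_ft1 h x y hx hx1 y0 y1
    rw [div_eq_inv_mul] at this
    simpa only [div_eq_mul_inv] using this
  rw [Finset.sum_add_distrib, Finset.sum_sub_distrib, Finset.sum_add_distrib, Finset.sum_sub_distrib,
    Finset.sum_const, hs, hs, hs, hs, T0, Ti (fun y => x⁻¹ * y), Ti (fun y => (1 - x⁻¹) * (1 - y⁻¹)⁻¹),
    Ti (fun y => (1 - x) * (1 - y)⁻¹)] at main
  · simp only [mul_zero, mul_one, inv_zero, sub_zero, inv_one, sub_self, B0, B1, inv_mul_cancel₀ hx,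
      mul_inv_cancel₀ x1i, mul_inv_cancel₀ x1'] at main
    rw [Bn _ hx, Bn _ (inv_ne_zero hx), Bn _ x1i, Bn _ x1', h.binv _ hx] at main
    have c1 := h.bC h2 x hx hx1
    have c2 := h.bC h2 x⁻¹ (inv_ne_zero hx) (by rwa [Ne, inv_eq_one])
    rw [h.binv _ hx] at c2
    rw [show b (1 - x⁻¹) = b 2 + b x by rw [← c2]; abel, show b (1 - x) = b 2 - b x by rw [← c1]; abel] at main
    rw [← cs, ← main, show s.card + 3 + 1 = s.card + 4 by ring, add_smul]
    abel
  · intro y z e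
    have := mul_left_cancel₀ x1' e
    have := inv_injective this
    linear_combination -this
  · intro y z e
    have := mul_left_cancel₀ x1i e
    have := inv_injective this
    apply inv_injective
    linear_combination -this
  · intro y z e
    exact mul_left_cancel₀ (inv_ne_zero hx) e


structure LG (k K : Type*) [Field k] [Field K] [Algebra k K] (n : ℕ) (lg : K → ZMod n) (θ : K) :
    Prop where
  mul : ∀ u v : K, u ≠ 0 → v ≠ 0 → lg (u * v) = lg u + lg v
  ker : ∀ u : K, u ≠ 0 → (lg u = 0 ↔ ∃ x : k, algebraMap k K x = u)
  th0 : θ ≠ 0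
  th : lg θ = 1

namespace LG

variable {k K : Type*} [Field k] [Field K] [Algebra k K] {n : ℕ} [NeZero n] {lg : K → ZMod n} {θ : K}

variable (k) in
def vec (ω : K) (v : k × k) : K := algebraMap k K v.1 - algebraMap k K v.2 * ω

variable (k K) in
noncomputable def Om [Fintype K] : Finset K := Finset.univ.filter (fun ω => ∀ x : k, algebraMap k K x ≠ ω)

theorem mem_Om [Fintype K] {ω : K} : ω ∈ Om k K ↔ ∀ x : k, algebraMap k K x ≠ ω := by simp [Om]

theorem vec_ne [Fintype K] {ω : K} (hω : ω ∈ Om k K) {v : k × k} (hv : v ≠ 0) : vec k ω v ≠ 0 := by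
  intro e
  unfold vec at e
  rw [mem_Om] at hω
  by_cases h2 : v.2 = 0
  · rw [h2, map_zero, zero_mul, sub_zero, map_eq_zero] at e
    exact hv (Prod.ext e h2)
  · apply hω (v.1 / v.2)
    have : algebraMap k K v.2 ≠ 0 := by rwa [Ne, map_eq_zero]
    rw [map_div₀]; field_simp; linear_combination e

theorem lgscal (h : LG k K n lg θ) (c : k) (hc : c ≠ 0) (u : K) (hu : u ≠ 0) :
    lg (algebraMap k K c * u) = lg u := by
  have h0 : algebraMap k K c ≠ 0 := by rwa [Ne, map_eq_zero]
  rw [h.mul _ _ h0 hu, (h.ker _ h0).2 ⟨c, rfl⟩, zero_add]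

theorem dt_ne_left {v w : k × k} (h : dt v w ≠ 0) : v ≠ 0 := by
  rintro rfl; simp [dt] at h

theorem dt_ne_right {v w : k × k} (h : dt v w ≠ 0) : w ≠ 0 := by
  rintro rfl; simp [dt] at h

theorem dt_ne_swap {v w : k × k} (h : dt v w ≠ 0) : dt w v ≠ 0 := by
  intro e; apply h; unfold dt at *; linear_combination -e

variable [Fintype K]

theorem TR (h : LG k K n lg θ) {A : Type*} [AddCommGroup A] (Ψ : ZMod n → ZMod n → ZMod n → ZMod n → A)
    (hΨ : ∀ i j l m c, Ψ (i + c) (j + c) (l + c) (m + c) = Ψ i j l m) (v0 v1 v2 v3 : k × k)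
    (h01 : dt v0 v1 ≠ 0) (h02 : dt v0 v2 ≠ 0) (h12 : dt v1 v2 ≠ 0) (h3 : v3 ≠ 0) :
    ∑ ω ∈ Om k K, Ψ (lg (vec k ω v0)) (lg (vec k ω v1)) (lg (vec k ω v2)) (lg (vec k ω v3)) =
    ∑ ω ∈ Om k K, Ψ (lg (vec k ω (0, 1))) (lg (vec k ω (1, 0))) (lg (vec k ω (1, 1)))
      (lg (vec k ω (dt v3 v0 * dt v2 v1, dt v3 v1 * dt v2 v0))) := by
  have h21 := dt_ne_swap h12
  have h20 := dt_ne_swap h02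
  let Fm : K → K := fun ω => - algebraMap k K (dt v2 v1 / dt v0 v2) * (vec k ω v0 / vec k ω v1)
  have hv0 := dt_ne_left h01
  have hv1 := dt_ne_right h01
  have hv2 := dt_ne_right h02
  have a1 : algebraMap k K (dt v2 v1) ≠ 0 := by rwa [Ne, map_eq_zero]
  have a2 : algebraMap k K (dt v0 v2) ≠ 0 := by rwa [Ne, map_eq_zero]
  have key : ∀ ω ∈ Om k K, ∀ (c : k) (v : k × k) (s r : k), c ≠ 0 → v ≠ 0 →
      c • v = (s * dt v0 v2) • v1 + (r * dt v2 v1) • v0 →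
      lg (vec k ω v) = lg (vec k (Fm ω) (s, r)) + lg (algebraMap k K (dt v0 v2) * vec k ω v1) := by
    intro ω hω c v s r hc hv e
    have n1 := vec_ne hω hv1
    have nv := vec_ne hω hv
    have e1 : algebraMap k K c * vec k ω v = vec k (Fm ω) (s, r) * (algebraMap k K (dt v0 v2) * vec k ω v1) := by
      have : vec k (Fm ω) (s, r) * (algebraMap k K (dt v0 v2) * vec k ω v1) =
        algebraMap k K (s * dt v0 v2) * vec k ω v1 + algebraMap k K (r * dt v2 v1) * vec k ω v0 := by
        conv_lhs => rw [vec]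
        simp only [Fm, map_div₀, map_mul]
        field_simp
        ring
      rw [this]
      have f1 := congrArg Prod.fst e
      have f2 := congrArg Prod.snd e
      simp only [Prod.smul_fst, Prod.smul_snd, Prod.fst_add, Prod.snd_add, smul_eq_mul] at f1 f2
      have f1 := congrArg (algebraMap k K) f1
      have f2 := congrArg (algebraMap k K) f2
      simp only [map_mul, map_add] at f1 f2 ⊢
      unfold vec
      linear_combination f1 - ω * f2
    have c0 : algebraMap k K c ≠ 0 := by rwa [Ne, map_eq_zero]
    have n2 : vec k (Fm ω) (s, r) ≠ 0 := by
      intro e2; rw [e2, zero_mul] at e1; exact mul_ne_zero c0 nv e1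
    rw [← h.lgscal c hc _ nv, e1, h.mul _ _ n2 (mul_ne_zero a2 n1)]
  have hmap : ∀ ω ∈ Om k K, Fm ω ∈ Om k K := by
    intro ω hω
    rw [mem_Om]
    intro x hx
    have n1 := vec_ne hω hv1
    have hz : vec k ω ((x * dt v0 v2) • v1 + (dt v2 v1) • v0) = 0 := by
      have : vec k ω ((x * dt v0 v2) • v1 + (dt v2 v1) • v0) =
        algebraMap k K (dt v0 v2) * algebraMap k K x * vec k ω v1 + algebraMap k K (dt v2 v1) * vec k ω v0 := by
        unfold vec; simp only [Prod.smul_fst, Prod.smul_snd, Prod.fst_add, Prod.snd_add, smul_eq_mul, map_add, map_mul]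
        ring
      rw [this, hx]
      simp only [Fm, map_div₀]
      field_simp
      ring
    by_contra
    refine vec_ne hω (v := (x * dt v0 v2) • v1 + (dt v2 v1) • v0) ?_ hz
    intro e0
    have f1 := congrArg Prod.fst e0
    have f2 := congrArg Prod.snd e0
    simp only [Prod.smul_fst, Prod.smul_snd, Prod.fst_add, Prod.snd_add, smul_eq_mul, Prod.fst_zero, Prod.snd_zero] at f1 f2
    have : dt v2 v1 * dt v0 v1 = 0 := by
      conv_lhs => rw [show dt v0 v1 = v0.1 * v1.2 - v0.2 * v1.1 from rfl]
      linear_combination v1.2 * f1 - v1.1 * f2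
    exact mul_ne_zero h21 h01 this
  have hinj : Set.InjOn Fm (Om k K : Set K) := by
    intro ω hω ω' hω' e
    have n1 := vec_ne hω hv1
    have n2 := vec_ne hω' hv1
    simp only [Fm] at e
    have e := mul_left_cancel₀ (neg_ne_zero.2 (by rw [Ne, map_eq_zero]; exact div_ne_zero h21 h02)) e
    rw [div_eq_div_iff n1 n2] at e
    unfold vec at e
    have d : algebraMap k K (dt v0 v1) * (ω - ω') = 0 := by
      unfold dt; simp only [map_sub, map_mul]
      linear_combination e
    rcases mul_eq_zero.1 d with d | d
    · rw [map_eq_zero] at d; exact absurd d h01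
    · exact sub_eq_zero.1 d
  refine Finset.sum_nbij Fm hmap hinj ?_ ?_
  · exact Finset.surjOn_of_injOn_of_card_le Fm hmap hinj le_rfl
  · intro ω hω
    rw [key ω hω (dt v2 v1) v0 0 1 h21 hv0 (by simp),
      key ω hω (dt v0 v2) v1 1 0 h02 hv1 (by simp),
      key ω hω (dt v0 v1) v2 1 1 h01 hv2 (by
        ext <;> simp only [Prod.smul_fst, Prod.smul_snd, Prod.fst_add, Prod.snd_add, smul_eq_mul, dt] <;> ring),
      key ω hω (dt v2 v1 * dt v2 v0 * dt v0 v1) v3 (dt v3 v0 * dt v2 v1) (dt v3 v1 * dt v2 v0) (mul_ne_zero (mul_ne_zero h21 h20) h01) h3 (by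
        ext <;> simp only [Prod.smul_fst, Prod.smul_snd, Prod.fst_add, Prod.snd_add, smul_eq_mul, dt] <;> ring)]
    exact hΨ _ _ _ _ _

variable (lg) in
noncomputable def Dt (v0 v1 v2 v3 : k × k) : ZMod n :=
  ∑ ω ∈ Om k K, Cyc.cc (lg (vec k ω v0)) (lg (vec k ω v1)) (lg (vec k ω v2)) (lg (vec k ω v3))

variable (lg) in
noncomputable def DD (x : k) : ZMod n := Dt lg (0, 1) (1, 0) (1, 1) (x, 1)

theorem Dt_cocycle (a b c d e : k × k) :
    Dt lg b c d e - Dt lg a c d e + Dt lg a b d e - Dt lg a b c e + Dt lg a b c d = 0 := by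
  unfold Dt
  simp only [← Finset.sum_sub_distrib, ← Finset.sum_add_distrib]
  exact Finset.sum_eq_zero fun ω _ => Cyc.cc_cocycle _ _ _ _ _

theorem Dt_eq (h : LG k K n lg θ) (v0 v1 v2 v3 : k × k)
    (h01 : dt v0 v1 ≠ 0) (h02 : dt v0 v2 ≠ 0) (h12 : dt v1 v2 ≠ 0) (h13 : dt v1 v3 ≠ 0) :
    Dt lg v0 v1 v2 v3 = DD lg ((dt v3 v0 * dt v2 v1) / (dt v3 v1 * dt v2 v0)) := by
  unfold DD Dt
  rw [h.TR Cyc.cc Cyc.cc_shift v0 v1 v2 v3 h01 h02 h12 (dt_ne_right h13)]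
  apply Finset.sum_congr rfl
  intro ω hω
  congr 1
  have hD : dt v3 v1 * dt v2 v0 ≠ 0 := mul_ne_zero (dt_ne_swap h13) (dt_ne_swap h02)
  rw [← h.lgscal _ hD _ (vec_ne hω (v := (_, 1)) (by simp))]
  congr 1
  have hD' : algebraMap k K (dt v3 v1) ≠ 0 := by rw [Ne, map_eq_zero]; exact dt_ne_swap h13
  have hD'' : algebraMap k K (dt v2 v0) ≠ 0 := by rw [Ne, map_eq_zero]; exact dt_ne_swap h02
  unfold vec
  simp only [map_div₀, map_mul, map_one]
  field_simp

theorem DD_one : DD lg (1 : k) = 0 := by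
  unfold DD Dt
  apply Finset.sum_eq_zero
  intro ω _
  unfold Cyc.cc; rw [Cyc.ee_self_right]; simp

theorem DD_ft (h : LG k K n lg θ) (x y : k) (hx : x ≠ 0) (hx1 : x ≠ 1) (hy : y ≠ 0) (hy1 : y ≠ 1) :
    DD lg x - DD lg y + DD lg (y / x) - DD lg ((1 - x⁻¹) / (1 - y⁻¹)) + DD lg ((1 - x) / (1 - y)) = 0 := by
  have hx2 : 1 - x ≠ 0 := sub_ne_zero.2 (Ne.symm hx1)
  have hy2 : 1 - y ≠ 0 := sub_ne_zero.2 (Ne.symm hy1)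
  have hx3 : x - 1 ≠ 0 := sub_ne_zero.2 (hx1)
  have hy3 : y - 1 ≠ 0 := sub_ne_zero.2 (hy1)
  have e := Dt_cocycle (lg := lg) ((0, 1) : k × k) (1, 0) (1, 1) (x, 1) (y, 1)
  rw [h.Dt_eq (1, 0) (1, 1) (x, 1) (y, 1) (by simp [dt]) (by simp [dt])
      (by show (1:k) * 1 - 1 * x ≠ 0; simpa using hx2) (by show (1:k) * 1 - 1 * y ≠ 0; simpa using hy2),
    h.Dt_eq (0, 1) (1, 1) (x, 1) (y, 1) (by simp [dt]) (by simpa [dt])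
      (by show (1:k) * 1 - 1 * x ≠ 0; simpa using hx2) (by show (1:k) * 1 - 1 * y ≠ 0; simpa using hy2),
    h.Dt_eq (0, 1) (1, 0) (x, 1) (y, 1) (by simp [dt]) (by simpa [dt]) (by simp [dt]) (by simp [dt])] at e
  simp only [dt] at e
  have e1 : (y * 0 - 1 * 1) * (x * 1 - 1 * 1) / ((y * 1 - 1 * 1) * (x * 0 - 1 * 1)) = (1 - x) / (1 - y) := by
    rw [div_eq_div_iff (by simpa using hy2) hy2]; ring
  have e2 : (y * 1 - 1 * 0) * (x * 1 - 1 * 1) / ((y * 1 - 1 * 1) * (x * 1 - 1 * 0)) = (1 - x⁻¹) / (1 - y⁻¹) := by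
    field_simp; ring_nf
  have e3 : (y * 1 - 1 * 0) * (x * 0 - 1 * 1) / ((y * 0 - 1 * 1) * (x * 1 - 1 * 0)) = y / x := by
    field_simp; ring_nf
  rw [e1, e2, e3] at e
  unfold DD at *
  linear_combination e

end LG


theorem dt_lin {k : Type*} [Field k] (T : k × k →ₗ[k] k × k) (v w : k × k) :
    dt (T v) (T w) = dt (T (1, 0)) (T (0, 1)) * dt v w := by
  have hv : ∀ v : k × k, T v = v.1 • T (1, 0) + v.2 • T (0, 1) := by
    intro v
    rw [← map_smul, ← map_smul, ← map_add]
    congr 1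
    ext <;> simp
  rw [hv v, hv w]
  simp only [dt, Prod.smul_fst, Prod.smul_snd, Prod.fst_add, Prod.snd_add, smul_eq_mul]
  ring

theorem dt_dep {k : Type*} [Field k] (v w : k × k) (hw : w ≠ 0) (h : dt v w = 0) : ∃ c : k, v = c • w := by
  unfold dt at h
  by_cases h2 : w.2 = 0
  · have h1 : w.1 ≠ 0 := fun h1 => hw (Prod.ext h1 h2)
    refine ⟨v.1 / w.1, ?_⟩
    rw [h2] at h
    have : v.2 = 0 := by
      have : v.2 * w.1 = 0 := by linear_combination -h
      rcases mul_eq_zero.1 this with h | h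
      · exact h
      · exact absurd h h1
    ext
    · simp [h1]
    · simp [h2, this]
  · refine ⟨v.2 / w.2, ?_⟩
    ext
    · simp only [Prod.smul_fst, smul_eq_mul]; field_simp; linear_combination h
    · simp [h2]

theorem dt_inj {k : Type*} [Field k] (T : k × k →ₗ[k] k × k) (hT : Function.Injective T) :
    dt (T (1, 0)) (T (0, 1)) ≠ 0 := by
  intro e
  obtain ⟨c, hc⟩ := dt_dep _ _ (by
    intro h0
    have := hT (h0.trans (map_zero T).symm)
    simp at this) e
  rw [← map_smul] at hc
  have := hT hc
  simp at this

namespace LG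

variable {k K : Type*} [Field k] [Field K] [Algebra k K] {n : ℕ} [NeZero n] {lg : K → ZMod n} {θ : K}

theorem lg_one (h : LG k K n lg θ) : lg 1 = 0 := (h.ker 1 one_ne_zero).2 ⟨1, map_one _⟩

theorem lg_pow (h : LG k K n lg θ) (m : ℕ) : lg (θ ^ m) = m := by
  induction m with
  | zero => simp [h.lg_one]
  | succ m ih => rw [pow_succ, h.mul _ _ (pow_ne_zero _ h.th0) h.th0, ih, h.th]; push_cast; rfl

theorem lg_inv (h : LG k K n lg θ) (u : K) (hu : u ≠ 0) : lg u⁻¹ = - lg u := by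
  have := h.mul u u⁻¹ hu (inv_ne_zero hu)
  rw [mul_inv_cancel₀ hu, h.lg_one] at this
  linear_combination - this

theorem lg_eq (h : LG k K n lg θ) (u w : K) (hu : u ≠ 0) (hw : w ≠ 0) (e : lg u = lg w) :
    ∃ c : k, c ≠ 0 ∧ u = c • w := by
  have h1 : lg (u * w⁻¹) = 0 := by
    rw [h.mul _ _ hu (inv_ne_zero hw), h.lg_inv w hw, e]; ring
  obtain ⟨c, hc⟩ := (h.ker _ (mul_ne_zero hu (inv_ne_zero hw))).1 h1
  have e2 : u = c • w := by rw [Algebra.smul_def, hc, mul_assoc, inv_mul_cancel₀ hw, mul_one]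
  refine ⟨c, ?_, e2⟩
  rintro rfl
  rw [zero_smul] at e2; exact hu e2

theorem dt_pt (h : LG k K n lg θ) (pt : K ≃ₗ[k] k × k) (u w : K) (hu : u ≠ 0) (hw : w ≠ 0)
    (e : lg u ≠ lg w) : dt (pt u) (pt w) ≠ 0 := by
  intro e0
  obtain ⟨c, hc⟩ := dt_dep _ _ (by simpa using hw) e0
  rw [← map_smul] at hc
  have hc := pt.injective hc
  have c0 : c ≠ 0 := by rintro rfl; rw [zero_smul] at hc; exact hu hc
  apply e
  rw [hc, Algebra.smul_def, h.lgscal c c0 w hw]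

variable (k) in
def vecL (ω : K) : k × k →ₗ[k] K where
  toFun := vec k ω
  map_add' := by intro x y; simp only [vec, Prod.fst_add, Prod.snd_add, map_add]; ring
  map_smul' := by
    intro c x
    rw [RingHom.id_apply, Algebra.smul_def c (vec k ω x)]
    simp only [vec, Prod.smul_fst, Prod.smul_snd, smul_eq_mul, map_mul]; ring

variable [Fintype K]

theorem vecL_inj {ω : K} (hω : ω ∈ Om k K) : Function.Injective (vecL k ω) := by
  rw [injective_iff_map_eq_zero]
  intro v hv
  by_contra h0
  exact vec_ne hω h0 hv

theorem lg_vec_ne (h : LG k K n lg θ) {ω : K} (hω : ω ∈ Om k K) (v w : k × k) (hvw : dt v w ≠ 0) :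
    lg (vec k ω v) ≠ lg (vec k ω w) := by
  intro e
  obtain ⟨c, hc, e⟩ := h.lg_eq _ _ (vec_ne hω (dt_ne_left hvw)) (vec_ne hω (dt_ne_right hvw)) e
  have e : vecL k ω v = vecL k ω (c • w) := by rw [map_smul]; exact e
  have := vecL_inj hω e
  apply hvw
  rw [this]; simp only [dt, Prod.smul_fst, Prod.smul_snd, smul_eq_mul]; ring

theorem upper (h : LG k K n lg θ) [Fintype k] (pt : K ≃ₗ[k] k × k) (hn : n = Fintype.card k + 1) (h4 : 4 ≤ n)
    (h2 : (2 : k) ≠ 0) (hOm : (Om k K).card = Fintype.card k * Fintype.card k - Fintype.card k)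
    {A : Type*} [AddCommGroup A] {b : k → A} (hb : Tw (1 : k →*₀ ℤ) b) :
    ∃ φ : ZMod n →+ A, ∀ x, x ≠ 0 → x ≠ 1 → 2 • b x = φ (DD lg x) := by
  let P : ZMod n → K := fun i => θ ^ i.val
  have P0 : ∀ i, P i ≠ 0 := fun i => pow_ne_zero _ h.th0
  have Plg : ∀ i, lg (P i) = i := by intro i; simp only [P]; rw [h.lg_pow]; simp
  let B : ZMod n → ZMod n → ZMod n → ZMod n → A := fun i j l m => bk b (pt (P i)) (pt (P j)) (pt (P l)) (pt (P m))
  have hdt : ∀ i j, i ≠ j → dt (pt (P i)) (pt (P j)) ≠ 0 := by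
    intro i j hij
    apply h.dt_pt pt _ _ (P0 i) (P0 j)
    rwa [Plg, Plg]
  have hB : ∀ u0 u1 u2 u3 : K, u0 ≠ 0 → u1 ≠ 0 → u2 ≠ 0 → u3 ≠ 0 →
      bk b (pt u0) (pt u1) (pt u2) (pt u3) = B (lg u0) (lg u1) (lg u2) (lg u3) := by
    intro u0 u1 u2 u3 h0 h1 h2 h3
    obtain ⟨c0, n0, e0⟩ := h.lg_eq u0 (P (lg u0)) h0 (P0 _) (by rw [Plg])
    obtain ⟨c1, n1, e1⟩ := h.lg_eq u1 (P (lg u1)) h1 (P0 _) (by rw [Plg])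
    obtain ⟨c2, n2, e2⟩ := h.lg_eq u2 (P (lg u2)) h2 (P0 _) (by rw [Plg])
    obtain ⟨c3, n3, e3⟩ := h.lg_eq u3 (P (lg u3)) h3 (P0 _) (by rw [Plg])
    conv_lhs => rw [e0, e1, e2, e3]
    rw [map_smul, map_smul, map_smul, map_smul, bk_scal _ _ _ _ n0 n1 n2 n3]
  obtain ⟨φ, g, hg, hφ⟩ := Cyc.cyc_main h4 B
    (fun i0 i1 i2 t t' h01 h02 h12 ht => bk_E hb h2 _ _ _ _ _ (hdt _ _ h01) (hdt _ _ h02) (hdt _ _ h12) (hdt _ _ ht))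
    (by
      intro i j l m c
      let T : k × k →ₗ[k] k × k := pt.toLinearMap ∘ₗ (LinearMap.mulRight k (P c)) ∘ₗ pt.symm.toLinearMap
      have Tp : ∀ u, T (pt u) = pt (u * P c) := by intro u; simp [T]
      have Ti : Function.Injective T := by
        intro x y hxy
        have := pt.injective hxy
        have := mul_right_cancel₀ (P0 c) this
        exact pt.symm.injective this
      have := bk_T (b := b) T _ (dt_inj T Ti) (dt_lin T) (pt (P i)) (pt (P j)) (pt (P l)) (pt (P m))
      rw [Tp, Tp, Tp, Tp, hB _ _ _ _ (mul_ne_zero (P0 _) (P0 _)) (mul_ne_zero (P0 _) (P0 _)) (mul_ne_zero (P0 _) (P0 _)) (mul_ne_zero (P0 _) (P0 _)),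
        h.mul _ _ (P0 _) (P0 _), h.mul _ _ (P0 _) (P0 _), h.mul _ _ (P0 _) (P0 _), h.mul _ _ (P0 _) (P0 _)] at this
      simpa only [Plg] using this)
    (fun i j l _ h2 h3 => bk_Z hb _ _ _ (hdt _ _ h2) (hdt _ _ h3))
  refine ⟨φ, ?_⟩
  intro x hx hx1
  have hx2 : 1 - x ≠ 0 := sub_ne_zero.2 (Ne.symm hx1)
  have each : ∀ ω ∈ Om k K, b x = g (lg (vec k ω (1, 0))) (lg (vec k ω (1, 1))) (lg (vec k ω (x, 1)))
      - g (lg (vec k ω (0, 1))) (lg (vec k ω (1, 1))) (lg (vec k ω (x, 1)))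
      + g (lg (vec k ω (0, 1))) (lg (vec k ω (1, 0))) (lg (vec k ω (x, 1)))
      - g (lg (vec k ω (0, 1))) (lg (vec k ω (1, 0))) (lg (vec k ω (1, 1)))
      + φ (Cyc.cc (lg (vec k ω (0, 1))) (lg (vec k ω (1, 0))) (lg (vec k ω (1, 1))) (lg (vec k ω (x, 1)))) := by
    intro ω hω
    rw [← hφ _ _ _ _ (h.lg_vec_ne hω _ _ (by simp [dt])) (h.lg_vec_ne hω _ _ (by simp [dt])) (h.lg_vec_ne hω _ _ (by simp [dt])),
      ← hB _ _ _ _ (vec_ne hω (by simp)) (vec_ne hω (by simp)) (vec_ne hω (by simp)) (vec_ne hω (by simp))]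
    have := bk_T (b := b) (pt.toLinearMap ∘ₗ vecL k ω) _ (dt_inj _ (pt.injective.comp (vecL_inj hω))) (dt_lin _) (0, 1) (1, 0) (1, 1) (x, 1)
    refine Eq.trans ?_ this.symm
    unfold bk
    rw [bb_nn _ _ (by simpa [dt]) (by simp [dt])]
    congr 1
    simp [dt]
  have hγ : ∀ v0 v1 v2 : k × k, dt v0 v1 ≠ 0 → dt v0 v2 ≠ 0 → dt v1 v2 ≠ 0 →
      ∑ ω ∈ Om k K, g (lg (vec k ω v0)) (lg (vec k ω v1)) (lg (vec k ω v2)) =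
      ∑ ω ∈ Om k K, g (lg (vec k ω (0, 1))) (lg (vec k ω (1, 0))) (lg (vec k ω (1, 1))) := by
    intro v0 v1 v2 h01 h02 h12
    exact h.TR (fun i j l _ => g i j l) (fun i j l _ c => hg i j l c) v0 v1 v2 v0 h01 h02 h12 (dt_ne_left h01)
  have S := Finset.sum_congr rfl each
  rw [Finset.sum_const, Finset.sum_add_distrib, Finset.sum_sub_distrib, Finset.sum_add_distrib, Finset.sum_sub_distrib,
    hγ (1, 0) (1, 1) (x, 1) (by simp [dt]) (by simp [dt]) (by simpa [dt] using hx2),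
    hγ (0, 1) (1, 1) (x, 1) (by simp [dt]) (by simpa [dt] using hx) (by simpa [dt] using hx2),
    hγ (0, 1) (1, 0) (x, 1) (by simp [dt]) (by simpa [dt] using hx) (by simp [dt]), ← map_sum] at S
  have S2 : (Om k K).card • b x = φ (DD lg x) := by
    rw [S]; unfold DD Dt; abel
  rw [← S2, hOm]
  have nk := n_kill hb h2 x hx hx1
  have : Fintype.card k * Fintype.card k - Fintype.card k = (Fintype.card k - 2) * (Fintype.card k + 1) + 2 := by
    obtain ⟨q, hq⟩ : ∃ q, Fintype.card k = q + 2 := ⟨Fintype.card k - 2, by omega⟩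
    rw [hq]
    apply Nat.sub_eq_of_eq_add
    simp only [Nat.add_sub_cancel]; ring
  rw [this, add_smul, mul_smul, nk, smul_zero, zero_add]

end LG


namespace Cyc
variable {n : ℕ} [NeZero n]

theorem wsum (A : ℕ → ZMod n) (hA : A n = A 0) (c : ZMod n) :
    n * ∑ i ∈ Finset.range n, ee c (A i) (A (i + 1)) = ∑ i ∈ Finset.range n, ell (A i) (A (i + 1)) := by
  have key : ∀ m : ℕ, ell c (A 0) + ∑ i ∈ Finset.range m, ell (A i) (A (i + 1)) =
      ell c (A m) + n * ∑ i ∈ Finset.range m, ee c (A i) (A (i + 1)) := by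
    intro m
    induction m with
    | zero => simp
    | succ m ih =>
      rw [Finset.sum_range_succ, Finset.sum_range_succ, mul_add]
      have := ee_eq c (A m) (A (m + 1))
      linarith
  have := key n
  rw [hA] at this
  linarith

theorem ell_neg (i j c : ZMod n) (h : i ≠ j) : ell i j + ell (c - i) (c - j) = n := by
  unfold ell
  have : c - j - (c - i) = -(j - i) := by ring
  rw [this, ZMod.neg_val, if_neg (sub_ne_zero.2 (Ne.symm h))]
  have := ZMod.val_lt (j - i)
  omega

theorem ell_one (hn : 2 ≤ n) (i : ZMod n) : ell i (i + 1) = 1 := by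
  unfold ell
  have : Fact (1 < n) := ⟨by omega⟩
  rw [add_sub_cancel_left, ZMod.val_one]
end Cyc

namespace LG

variable {k K : Type*} [Field k] [Field K] [Algebra k K] {n : ℕ} [NeZero n] {lg : K → ZMod n} {θ : K} [Fintype K]

theorem Dt_uvuv (h : LG k K n lg θ) (u v w : k × k)
    (h01 : dt u v ≠ 0) (h02 : dt u w ≠ 0) (h12 : dt v w ≠ 0) : Dt lg u v u v = 0 := by
  have e1 := h.TR (fun i j _ _ => j - i) (fun i j _ _ c => by ring) u v w u h01 h02 h12 (dt_ne_left h01)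
  have e2 := h.TR (fun i j _ _ => j - i) (fun i j _ _ c => by ring) v w u u h12 (dt_ne_swap h01) (dt_ne_swap h02) (dt_ne_left h01)
  have e3 := h.TR (fun i j _ _ => j - i) (fun i j _ _ c => by ring) u w v u h02 h01 (dt_ne_swap h12) (dt_ne_left h01)
  simp only [Finset.sum_sub_distrib] at e1 e2 e3
  have : Dt lg u v u v = ∑ ω ∈ Om k K, (lg (vec k ω v) - lg (vec k ω u)) := by
    unfold Dt Cyc.cc
    apply Finset.sum_congr rfl
    intro ω hω
    rw [Cyc.ee_round _ _ (h.lg_vec_ne hω _ _ (dt_ne_swap h01))]; simp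
  rw [this, Finset.sum_sub_distrib]
  linear_combination e3 - e2

theorem DD_zero_mem (h : LG k K n lg θ) (x0 : k) (hx0 : x0 ≠ 0) (hx1 : x0 ≠ 1) (H : AddSubgroup (ZMod n))
    (hH : ∀ x : k, x ≠ 0 → DD lg x ∈ H) : DD lg (0 : k) ∈ H := by
  have hx2 : 1 - x0 ≠ 0 := sub_ne_zero.2 (Ne.symm hx1)
  have hx3 : x0 - 1 ≠ 0 := sub_ne_zero.2 hx1
  have e := Dt_cocycle (lg := lg) ((0, 1) : k × k) (1, 0) (1, 1) (0, 1) (x0, 1)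
  have d01 : dt ((0, 1) : k × k) (1, 0) ≠ 0 := by simp [dt]
  have d02 : dt ((0, 1) : k × k) (1, 1) ≠ 0 := by simp [dt]
  have d03 : dt ((0, 1) : k × k) (x0, 1) ≠ 0 := by simpa [dt]
  have d12 : dt ((1, 0) : k × k) (1, 1) ≠ 0 := by simp [dt]
  have d13 : dt ((1, 0) : k × k) (x0, 1) ≠ 0 := by simp [dt]
  have d23 : dt ((1, 1) : k × k) (x0, 1) ≠ 0 := by simpa [dt] using hx2
  have e1 := h.TR (fun i j l _ => Cyc.cc i j i l) (fun i j l _ c => Cyc.cc_shift _ _ _ _ _) (0, 1) (1, 0) (x0, 1) (0, 1)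
    d01 d03 d13 (by simp)
  have e2 := h.TR (fun i j l _ => Cyc.cc i j i l) (fun i j l _ c => Cyc.cc_shift _ _ _ _ _) (0, 1) (1, 1) (x0, 1) (0, 1)
    d02 d03 d23 (by simp)
  have e3 : Dt lg ((0, 1) : k × k) (1, 0) (0, 1) (x0, 1) = Dt lg ((0, 1) : k × k) (1, 1) (0, 1) (x0, 1) :=
    e1.trans e2.symm
  have e4 := h.Dt_eq (1, 0) (1, 1) (0, 1) (x0, 1) d12 (dt_ne_swap d01) (dt_ne_swap d02) d23
  have m4 := hH ((dt (x0, 1) (1, 0) * dt (0, 1) (1, 1)) / (dt (x0, 1) (1, 1) * dt (0, 1) (1, 0)))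
    (div_ne_zero (mul_ne_zero (dt_ne_swap d13) d02) (mul_ne_zero (dt_ne_swap d23) d01))
  rw [← e4] at m4
  have := H.sub_mem (hH x0 hx0) m4
  convert this using 1
  unfold DD
  linear_combination e - e3

theorem lower (h : LG k K n lg θ) (hn : 4 ≤ n) (cj : K →+* K) (hcj : ∀ u, cj u = u ↔ ∃ x : k, algebraMap k K x = u)
    (hcc : ∀ u, cj (cj u) = u) (ω0 : K) (hω0 : ω0 ∈ Om k K) (pt : K → k × k) (hpt : ∀ u, vec k ω0 (pt u) = u)
    (x0 : k) (hx0 : x0 ≠ 0) (hx1 : x0 ≠ 1) (H : AddSubgroup (ZMod n))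
    (hH : ∀ x : k, x ≠ 0 → DD lg x ∈ H) : (4 : ZMod n) ∈ H := by
  have hD0 := h.DD_zero_mem x0 hx0 hx1 H hH
  have memO : ∀ ω, ω ∈ Om k K ↔ cj ω ≠ ω := by
    intro ω; rw [mem_Om, Ne, hcj]; push Not; rfl
  have cja : ∀ x : k, cj (algebraMap k K x) = algebraMap k K x := fun x => (hcj _).2 ⟨x, rfl⟩
  have cj0 : ∀ u, u ≠ 0 → cj u ≠ 0 := fun u hu => by rwa [Ne, map_eq_zero]
  have lgcj : ∀ u, u ≠ 0 → lg (cj u) = - lg u := by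
    intro u hu
    have : lg (u * cj u) = 0 := by
      rw [h.ker _ (mul_ne_zero hu (cj0 u hu)), ← hcj, map_mul, hcc, mul_comm]
    rw [h.mul _ _ hu (cj0 u hu)] at this
    linear_combination this
  have D0 : ω0 - cj ω0 ≠ 0 := sub_ne_zero.2 (Ne.symm ((memO _).1 hω0))
  have hform : ∀ ω u, vec k ω (pt u) * (ω0 - cj ω0) = (ω - cj ω0) * u - (ω - ω0) * cj u := by
    intro ω u
    have e1 := hpt u
    have e2 := congrArg cj e1
    unfold vec at e1 e2 ⊢
    rw [map_sub, map_mul, cja, cja] at e2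
    rw [← e2]
    nth_rw 3 [← e1]
    ring
  let v : ℕ → k × k := fun i => pt (θ ^ i)
  have t0 : ∀ i : ℕ, θ ^ i ≠ 0 := fun i => pow_ne_zero _ h.th0
  have v0 : ∀ i, v i ≠ 0 := by
    intro i e
    have := hpt (θ ^ i)
    rw [show pt (θ ^ i) = 0 from e] at this
    simp [vec] at this
    exact t0 i this.symm
  have dv : ∀ i j : ℕ, (i : ZMod n) ≠ j → dt (v i) (v j) ≠ 0 := by
    intro i j hij e
    obtain ⟨c, hc⟩ := dt_dep _ _ (v0 j) e
    have h1 : vecL k ω0 (v i) = c • vecL k ω0 (v j) := by rw [hc, map_smul]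
    have h1 : θ ^ i = c • θ ^ j := by
      rw [← hpt (θ ^ i), ← hpt (θ ^ j)]; exact h1
    have c0 : c ≠ 0 := by rintro rfl; rw [zero_smul] at h1; exact t0 i h1
    apply hij
    rw [← h.lg_pow, ← h.lg_pow, h1, Algebra.smul_def, h.lgscal c c0 _ (t0 j)]
  have cne : ∀ i j : ℕ, i < n → j < n → i ≠ j → (i : ZMod n) ≠ j := by
    intro i j hi hj hij e
    rw [ZMod.natCast_eq_natCast_iff', Nat.mod_eq_of_lt hi, Nat.mod_eq_of_lt hj] at e
    exact hij e
  -- membership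
  have hW : ∑ i ∈ Finset.range n, Dt lg (v 0) (v 1) (v i) (v (i + 1)) ∈ H := by
    apply H.sum_mem
    intro i hi
    rw [Finset.mem_range] at hi
    by_cases i0 : i = 0
    · subst i0
      rw [h.Dt_uvuv (v 0) (v 1) (v 2) (dv _ _ (cne _ _ (by omega) (by omega) (by omega)))
        (dv _ _ (cne _ _ (by omega) (by omega) (by omega))) (dv _ _ (cne _ _ (by omega) (by omega) (by omega)))]
      exact H.zero_mem
    by_cases i1 : i = 1
    · subst i1
      have : Dt lg (v 0) (v 1) (v 1) (v (1 + 1)) = 0 := by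
        unfold Dt Cyc.cc
        apply Finset.sum_eq_zero
        intro ω _
        rw [Cyc.ee_self_left]; simp
      rw [this]; exact H.zero_mem
    rw [h.Dt_eq (v 0) (v 1) (v i) (v (i + 1)) (dv _ _ (cne _ _ (by omega) (by omega) (by omega)))
        (dv _ _ (cne _ _ (by omega) (by omega) (by omega))) (dv _ _ (cne _ _ (by omega) (by omega) (by omega)))
        (dv _ _ (by
          have := cne 0 i (by omega) (by omega) (by omega)
          intro e; apply this; push_cast at e ⊢; linear_combination e))]
    by_cases hz : (dt (v (i + 1)) (v 0) * dt (v i) (v 1)) / (dt (v (i + 1)) (v 1) * dt (v i) (v 0)) = 0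
    · rw [hz]; exact hD0
    · exact hH _ hz
  -- computation
  let a : K → ℕ → ZMod n := fun z i => lg (θ ^ i - z * cj θ ^ i)
  let w : K → ℕ := fun z => ∑ i ∈ Finset.range n, Cyc.ee (a z 1) (a z i) (a z (i + 1))
  have hθn : cj θ ^ n = θ ^ n := by
    rw [← map_pow, hcj, ← h.ker _ (t0 n), h.lg_pow]; simp
  have nz : ∀ z, z * cj z ≠ 1 → ∀ u, u ≠ 0 → u - z * cj u ≠ 0 := by
    intro z hz u hu e
    apply hz
    have e2 := congrArg cj e
    rw [map_sub, map_mul, hcc, map_zero] at e2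
    have : u * (1 - z * cj z) = 0 := by linear_combination e + z * e2
    rcases mul_eq_zero.1 this with h | h
    · exact absurd h hu
    · linear_combination -h
  have anz : ∀ z, z * cj z ≠ 1 → ∀ i : ℕ, θ ^ i - z * cj θ ^ i ≠ 0 := by
    intro z hz i; rw [← map_pow]; exact nz z hz _ (t0 i)
  have aper : ∀ z, z * cj z ≠ 1 → ∀ i, a z (n + i) = a z i := by
    intro z hz i
    simp only [a]
    rw [pow_add, pow_add, hθn, show θ ^ n * θ ^ i - z * (θ ^ n * cj θ ^ i) = θ ^ n * (θ ^ i - z * cj θ ^ i) by ring,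
      h.mul _ _ (t0 n) (anz z hz i), h.lg_pow]
    simp
  have wn : ∀ z, z * cj z ≠ 1 → n * w z = ∑ i ∈ Finset.range n, Cyc.ell (a z i) (a z (i + 1)) := by
    intro z hz
    exact Cyc.wsum (a z) (aper z hz 0) _
  let ζ : K := cj θ / θ
  have ζ0 : ζ ≠ 0 := div_ne_zero (cj0 _ h.th0) h.th0
  have ζn : ζ * cj ζ = 1 := by
    simp only [ζ]; rw [map_div₀, hcc]
    have := h.th0; have := cj0 _ h.th0
    field_simp
  have ζz : ∀ z, z * cj z ≠ 1 → z * ζ * cj (z * ζ) ≠ 1 := by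
    intro z hz
    rw [map_mul, show z * ζ * (cj z * cj ζ) = z * cj z * (ζ * cj ζ) by ring, ζn, mul_one]; exact hz
  have arot : ∀ z, z * cj z ≠ 1 → ∀ i, a z (i + 1) = a (z * ζ) i + 1 := by
    intro z hz i
    simp only [a]
    rw [← h.th, ← h.mul _ _ (anz _ (ζz z hz) i) h.th0]
    congr 1
    simp only [ζ]
    have := h.th0
    field_simp
    ring
  have npos : 0 < n := by omega
  have wrot : ∀ z, z * cj z ≠ 1 → w (z * ζ) = w z := by
    intro z hz
    apply Nat.eq_of_mul_eq_mul_left npos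
    rw [wn z hz, wn _ (ζz z hz)]
    have e1 : ∀ i, Cyc.ell (a (z * ζ) i) (a (z * ζ) (i + 1)) = Cyc.ell (a z (i + 1)) (a z (i + 1 + 1)) := by
      intro i
      rw [arot z hz i, arot z hz (i + 1), Cyc.ell_shift]
    simp only [e1]
    have e2 := Finset.sum_range_succ (fun i => Cyc.ell (a z i) (a z (i + 1))) n
    have e3 := Finset.sum_range_succ' (fun i => Cyc.ell (a z i) (a z (i + 1))) n
    have e4 : a z n = a z 0 := aper z hz 0
    rw [aper z hz 1, e4] at e2
    simp only [zero_add] at e3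
    omega
  have ainj : ∀ z, z * cj z ≠ 1 → ∀ i, a z i ≠ a z (i + 1) := by
    intro z hz i e
    obtain ⟨c, c0, hc⟩ := h.lg_eq _ _ (anz z hz i) (anz z hz (i + 1)) e
    have : θ ^ i - algebraMap k K c * θ ^ (i + 1) = 0 := by
      by_contra hne
      apply nz z hz _ hne
      rw [map_sub, map_mul, cja, map_pow, map_pow]
      rw [Algebra.smul_def] at hc
      linear_combination hc
    have e2 : lg (θ ^ i) = lg (θ ^ (i + 1)) := by
      rw [sub_eq_zero.1 this, h.lgscal c c0 _ (t0 _)]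
    rw [h.lg_pow, h.lg_pow] at e2
    have := cne 0 1 (by omega) (by omega) (by omega)
    apply this
    push_cast at e2 ⊢; linear_combination e2
  have wconj : ∀ z, z ≠ 0 → z * cj z ≠ 1 → ((w z : ℕ) : ZMod n) + (w ((cj z)⁻¹) : ℕ) = 0 := by
    intro z z0 hz
    have hz0 := cj0 z z0
    have hz' : (cj z)⁻¹ * cj ((cj z)⁻¹) ≠ 1 := by
      rw [map_inv₀, hcc, ← mul_inv, Ne, inv_eq_one, mul_comm]; exact hz
    have ea : ∀ i, a (cj z)⁻¹ i = lg (-(cj z)⁻¹) - a z i := by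
      intro i
      simp only [a]
      rw [sub_eq_add_neg (lg _), ← lgcj _ (anz z hz i), ← h.mul _ _ (by simpa using hz0) (cj0 _ (anz z hz i))]
      congr 1
      rw [map_sub, map_mul, map_pow, map_pow, hcc]
      field_simp
      ring
    have : n * (w z + w ((cj z)⁻¹)) = n * n := by
      rw [mul_add, wn z hz, wn _ hz', ← Finset.sum_add_distrib]
      rw [Finset.sum_congr rfl (g := fun _ => n)]
      · simp
      · intro i _
        rw [ea, ea]
        exact Cyc.ell_neg _ _ _ (ainj z hz i)
    have := Nat.eq_of_mul_eq_mul_left npos this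
    rw [← Nat.cast_add, this]; simp
  let S : Finset K := Finset.univ.filter (fun z => z ≠ 0 ∧ z * cj z ≠ 1)
  have memS : ∀ z, z ∈ S ↔ z ≠ 0 ∧ z * cj z ≠ 1 := by intro z; simp [S]
  have sw : (2 : ZMod n) * ∑ z ∈ S, (w z : ZMod n) = 0 := by
    have : ∑ z ∈ S, ((w z : ℕ) : ZMod n) = ∑ z ∈ S, ((w ((cj z)⁻¹) : ℕ) : ZMod n) := by
      have hm : ∀ z ∈ S, (cj z)⁻¹ ∈ S := by
        intro z hz
        rw [memS] at hz ⊢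
        refine ⟨inv_ne_zero (cj0 _ hz.1), ?_⟩
        rw [map_inv₀, hcc, ← mul_inv, Ne, inv_eq_one, mul_comm]; exact hz.2
      refine Finset.sum_nbij' (fun z => (cj z)⁻¹) (fun z => (cj z)⁻¹) hm hm ?_ ?_ ?_
      · intro z _; simp [hcc]
      · intro z _; simp [hcc]
      · intro z _; simp [hcc]
    rw [two_mul]
    nth_rw 2 [this]
    rw [← Finset.sum_add_distrib]
    apply Finset.sum_eq_zero
    intro z hz
    exact wconj z ((memS z).1 hz).1 ((memS z).1 hz).2
  have rotS : ∀ f : K → ZMod n, ∑ z ∈ S, f (z * ζ) = ∑ z ∈ S, f z := by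
    intro f
    have hi : Set.InjOn (fun z => z * ζ) (S : Set K) := fun x _ y _ e => mul_right_cancel₀ ζ0 e
    have hm : ∀ z ∈ S, z * ζ ∈ S := by
      intro z hz; rw [memS] at hz ⊢; exact ⟨mul_ne_zero hz.1 ζ0, ζz z hz.2⟩
    refine Finset.sum_nbij (fun z => z * ζ) hm hi ?_ (fun _ _ => rfl)
    exact Finset.surjOn_of_injOn_of_card_le _ hm hi le_rfl
  have sS : ∑ z ∈ S, (a z 1 - a z 0) * (w z : ZMod n) = ∑ z ∈ S, (w z : ZMod n) := by
    have := rotS (fun z => a z 0 * (w z : ZMod n))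
    rw [← sub_eq_zero, ← Finset.sum_sub_distrib] at this ⊢
    rw [← this]
    apply Finset.sum_congr rfl
    intro z hz
    have hz := ((memS z).1 hz).2
    have e := arot z hz 0
    rw [zero_add] at e
    simp only [wrot z hz]
    rw [e]; ring
  -- relate
  let Q : K → ZMod n := fun ω => (lg (vec k ω (v 1)) - lg (vec k ω (v 0))) *
    ((∑ i ∈ Finset.range n, Cyc.ee (lg (vec k ω (v 1))) (lg (vec k ω (v i))) (lg (vec k ω (v (i + 1)))) : ℕ) : ZMod n)
  have WQ : ∑ i ∈ Finset.range n, Dt lg (v 0) (v 1) (v i) (v (i + 1)) = ∑ ω ∈ Om k K, Q ω := by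
    unfold Dt Cyc.cc
    rw [Finset.sum_comm]
    apply Finset.sum_congr rfl
    intro ω _
    simp only [Q]
    rw [Nat.cast_sum, Finset.mul_sum]
  have hc0 : cj ω0 ∈ Om k K := by rw [memO, hcc]; exact Ne.symm ((memO _).1 hω0)
  have Qc : Q (cj ω0) = 1 := by
    have e : ∀ i : ℕ, lg (vec k (cj ω0) (v i)) = -(i : ZMod n) := by
      intro i
      have := hform (cj ω0) (θ ^ i)
      have e2 : vec k (cj ω0) (v i) = cj (θ ^ i) := by
        apply mul_right_cancel₀ D0; rw [this]; ring
      rw [e2, lgcj _ (t0 i), h.lg_pow]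
    have key := Cyc.wsum (fun i : ℕ => -(i : ZMod n)) (by simp) (-((1 : ℕ) : ZMod n))
    have : ∀ i : ℕ, Cyc.ell (-(i : ZMod n)) (-((i + 1 : ℕ) : ZMod n)) = n - 1 := by
      intro i
      have e1 := Cyc.ell_neg (i : ZMod n) (i + 1) 0 (by
        intro e; apply cne 0 1 (by omega) (by omega) (by omega); push_cast; linear_combination e)
      rw [Cyc.ell_one (by omega)] at e1
      rw [zero_sub, zero_sub] at e1
      push_cast; omega
    simp only [this, Finset.sum_const, Finset.card_range, smul_eq_mul] at key
    have key := Nat.eq_of_mul_eq_mul_left npos key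
    simp only [Q, e]
    rw [key, Nat.cast_sub (by omega)]
    simp
  have Qz : ∀ ω ∈ Om k K, ω ≠ cj ω0 → Q ω =
      (a ((ω - ω0) / (ω - cj ω0)) 1 - a ((ω - ω0) / (ω - cj ω0)) 0) * (w ((ω - ω0) / (ω - cj ω0)) : ZMod n) ∧
      ((ω - ω0) / (ω - cj ω0)) * cj ((ω - ω0) / (ω - cj ω0)) ≠ 1 := by
    intro ω hω hne
    have n1 : ω - cj ω0 ≠ 0 := sub_ne_zero.2 hne
    have n2 : cj ω - ω0 ≠ 0 := by
      intro e
      apply n1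
      have := congrArg cj e
      rwa [map_sub, hcc, map_zero] at this
    have hz : ((ω - ω0) / (ω - cj ω0)) * cj ((ω - ω0) / (ω - cj ω0)) ≠ 1 := by
      rw [map_div₀, map_sub, map_sub, hcc]
      intro e
      rw [div_mul_div_comm, div_eq_one_iff_eq (mul_ne_zero n1 n2)] at e
      have : (cj ω - ω) * (ω0 - cj ω0) = 0 := by linear_combination -e
      rcases mul_eq_zero.1 this with e | e
      · exact (memO ω).1 hω (sub_eq_zero.1 e)
      · exact D0 e
    refine ⟨?_, hz⟩
    have nn : (ω - cj ω0) / (ω0 - cj ω0) ≠ 0 := div_ne_zero n1 D0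
    have e : ∀ i : ℕ, lg (vec k ω (v i)) = a ((ω - ω0) / (ω - cj ω0)) i + lg ((ω - cj ω0) / (ω0 - cj ω0)) := by
      intro i
      simp only [a]
      rw [← h.mul _ _ (anz _ hz i) nn]
      congr 1
      have := hform ω (θ ^ i)
      rw [map_pow] at this
      apply mul_right_cancel₀ D0; rw [this]
      field_simp
    simp only [Q, e, Cyc.ee_shift, w]
    ring
  have Q0 : (a 0 1 - a 0 0) * (w 0 : ZMod n) = 1 := by
    have e : ∀ i : ℕ, a 0 i = i := by intro i; simp only [a]; rw [zero_mul, sub_zero, h.lg_pow]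
    have key := wn 0 (by simp)
    have : ∀ i : ℕ, Cyc.ell (a 0 i) (a 0 (i + 1)) = 1 := by
      intro i; rw [e, e]; push_cast; exact Cyc.ell_one (by omega) _
    simp only [this, Finset.sum_const, Finset.card_range, smul_eq_mul] at key
    rw [Nat.eq_of_mul_eq_mul_left npos key, e, e]; simp
  have Wtot : ∑ ω ∈ Om k K, Q ω = 1 + (1 + ∑ z ∈ S, (w z : ZMod n)) := by
    rw [← Finset.add_sum_erase _ _ hc0, Qc, ← sS]
    have : (1 : ZMod n) + ∑ z ∈ S, (a z 1 - a z 0) * (w z : ZMod n) = ∑ z ∈ insert 0 S, (a z 1 - a z 0) * (w z : ZMod n) := by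
      rw [Finset.sum_insert (by rw [memS]; simp), Q0]
    rw [this]
    congr 1
    have mI : ∀ z, z ∈ insert 0 S ↔ z * cj z ≠ 1 := by
      intro z
      rw [Finset.mem_insert, memS]
      by_cases z0 : z = 0
      · simp [z0]
      · simp [z0]
    refine Finset.sum_nbij' (fun ω => (ω - ω0) / (ω - cj ω0)) (fun z => (ω0 - z * cj ω0) / (1 - z)) ?_ ?_ ?_ ?_ ?_
    · intro ω hω
      rw [Finset.mem_erase] at hω
      rw [mI]; exact (Qz ω hω.2 hω.1).2
    · intro z hz
      rw [mI] at hz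
      have z1 : 1 - z ≠ 0 := by
        intro e; apply hz; rw [← sub_eq_zero.1 e]; simp
      have z2 : 1 - cj z ≠ 0 := by
        have := cj0 _ z1
        rwa [map_sub, map_one] at this
      rw [Finset.mem_erase]
      constructor
      · intro e
        rw [div_eq_iff z1] at e
        apply D0; linear_combination e
      · rw [memO, map_div₀, map_sub, map_sub, map_mul, hcc, map_one]
        intro e
        rw [div_eq_div_iff z2 z1] at e
        have : (ω0 - cj ω0) * (1 - z * cj z) = 0 := by linear_combination -e
        rcases mul_eq_zero.1 this with e | e
        · exact D0 e
        · exact hz (sub_eq_zero.1 e).symm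
    · intro ω hω
      rw [Finset.mem_erase] at hω
      have n1 : ω - cj ω0 ≠ 0 := sub_ne_zero.2 hω.1
      have : 1 - (ω - ω0) / (ω - cj ω0) = (ω0 - cj ω0) / (ω - cj ω0) := by field_simp; ring
      rw [this]
      field_simp
      ring
    · intro z hz
      rw [mI] at hz
      have z1 : 1 - z ≠ 0 := by
        intro e; apply hz; rw [← sub_eq_zero.1 e]; simp
      have e1 : (ω0 - z * cj ω0) / (1 - z) - ω0 = z * (ω0 - cj ω0) / (1 - z) := by field_simp; ring
      have e2 : (ω0 - z * cj ω0) / (1 - z) - cj ω0 = (ω0 - cj ω0) / (1 - z) := by field_simp; ring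
      rw [e1, e2]
      field_simp
    · intro ω hω
      rw [Finset.mem_erase] at hω
      exact (Qz ω hω.2 hω.1).1
  rw [WQ, Wtot] at hW
  have := H.add_mem hW hW
  convert this using 1
  linear_combination -sw

end LG


theorem gf_mem (p : ℕ) [Fact p.Prime] (u : GaloisField p 2) :
    u ^ p = u ↔ ∃ x : ZMod p, algebraMap (ZMod p) (GaloisField p 2) x = u := by
  rw [← Subfield.mem_bot_iff_pow_eq_self, ← ZMod.fieldRange_castHom_eq_bot p, RingHom.mem_fieldRange]
  rw [Subsingleton.elim (ZMod.castHom (dvd_refl p) (GaloisField p 2)) (algebraMap (ZMod p) (GaloisField p 2))]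

theorem exists_LG (p : ℕ) [Fact p.Prime] :
    ∃ (lg : GaloisField p 2 → ZMod (p + 1)) (θ : GaloisField p 2), LG (ZMod p) (GaloisField p 2) (p + 1) lg θ := by
  have hp : p.Prime := Fact.out
  have hp2 := hp.two_le
  have cK : Nat.card (GaloisField p 2)ˣ = (p - 1) * (p + 1) := by
    rw [Nat.card_units, GaloisField.card p 2 two_ne_zero]
    obtain ⟨q, rfl⟩ : ∃ q, p = q + 1 := ⟨p - 1, by omega⟩
    simp only [Nat.add_sub_cancel]
    apply Nat.sub_eq_of_eq_add; ring
  have dv : (p + 1) ∣ Nat.card (GaloisField p 2)ˣ := by rw [cK]; exact dvd_mul_left _ _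
  have hne : NeZero (Nat.card (GaloisField p 2)ˣ) := ⟨Nat.card_pos.ne'⟩
  let e := (zmodCyclicMulEquiv (inferInstance : IsCyclic (GaloisField p 2)ˣ)).symm
  let f := ZMod.castHom dv (ZMod (p + 1))
  let lg : GaloisField p 2 → ZMod (p + 1) := fun u => if h : u = 0 then 0 else f (Multiplicative.toAdd (e (Units.mk0 u h)))
  have hlg : ∀ (u : GaloisField p 2) (h : u ≠ 0), lg u = f (Multiplicative.toAdd (e (Units.mk0 u h))) :=
    fun u h => dif_neg h
  refine ⟨lg, (e.symm (Multiplicative.ofAdd 1) : (GaloisField p 2)ˣ), ?_, ?_, ?_, ?_⟩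
  · intro u v hu hv
    rw [hlg _ (mul_ne_zero hu hv), hlg _ hu, hlg _ hv, ← map_add f, ← toAdd_mul, ← map_mul]
    congr 3
    exact Units.ext rfl
  · intro u hu
    rw [hlg _ hu, ← gf_mem]
    set x : ZMod (Nat.card (GaloisField p 2)ˣ) := Multiplicative.toAdd (e (Units.mk0 u hu)) with hx
    have h1 : f x = 0 ↔ (p - 1) • x = 0 := by
      rw [← ZMod.natCast_zmod_val x, map_natCast, nsmul_eq_mul, ← Nat.cast_mul, ZMod.natCast_eq_zero_iff, ZMod.natCast_eq_zero_iff]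
      generalize x.val = m
      rw [cK, Nat.mul_dvd_mul_iff_left (by omega)]
    rw [h1, hx, ← toAdd_pow, ← map_pow, toAdd_eq_zero, map_eq_one_iff e e.injective, Units.ext_iff]
    rw [Units.val_pow_eq_pow_val, Units.val_mk0, Units.val_one]
    have : u ^ p = u ^ (p - 1) * u := by rw [← pow_succ]; congr 1; omega
    rw [this]
    constructor
    · intro h; rw [h, one_mul]
    · intro h; exact mul_right_cancel₀ hu (by rw [h, one_mul])
  · exact Units.ne_zero _
  · rw [hlg _ (Units.ne_zero _), Units.mk0_val]
    simp

theorem fin_data (p : ℕ) [Fact p.Prime] (hp5 : 5 ≤ p) : ∃ D : ZMod p → ZMod (p + 1), D 1 = 0 ∧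
    (∀ x y : ZMod p, x ≠ 0 → x ≠ 1 → y ≠ 0 → y ≠ 1 →
      D x - D y + D (y / x) - D ((1 - x⁻¹) / (1 - y⁻¹)) + D ((1 - x) / (1 - y)) = 0) ∧
    (∀ (A : Type) [AddCommGroup A] (b : ZMod p → A), Tw (1 : ZMod p →*₀ ℤ) b →
      ∃ φ : ZMod (p + 1) →+ A, ∀ x, x ≠ 0 → x ≠ 1 → 2 • b x = φ (D x)) ∧
    (∀ H : AddSubgroup (ZMod (p + 1)), (∀ x : ZMod p, x ≠ 0 → D x ∈ H) → (4 : ZMod (p + 1)) ∈ H) := by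
  obtain ⟨lg, θ, h⟩ := exists_LG p
  let : Fintype (GaloisField p 2) := Fintype.ofFinite _
  have h2 : (2 : ZMod p) ≠ 0 := by
    intro e
    have : ((2 : ℕ) : ZMod p) = 0 := by exact_mod_cast e
    rw [ZMod.natCast_eq_zero_iff] at this
    have := Nat.le_of_dvd (by norm_num) this
    omega
  have fr : Module.finrank (ZMod p) (GaloisField p 2) = Module.finrank (ZMod p) (ZMod p × ZMod p) := by
    rw [GaloisField.finrank p two_ne_zero]; simp
  let pt := LinearEquiv.ofFinrankEq _ _ fr
  have cK : Fintype.card (GaloisField p 2) = p * p := by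
    rw [← Nat.card_eq_fintype_card, GaloisField.card p 2 two_ne_zero, pow_two]
  have hOm : (LG.Om (ZMod p) (GaloisField p 2)).card = Fintype.card (ZMod p) * Fintype.card (ZMod p) - Fintype.card (ZMod p) := by
    rw [ZMod.card]
    have : LG.Om (ZMod p) (GaloisField p 2) = (Finset.univ.image (algebraMap (ZMod p) (GaloisField p 2)))ᶜ := by
      ext ω; simp [LG.mem_Om]
    rw [this, Finset.card_compl, cK, Finset.card_image_of_injective _ (algebraMap (ZMod p) (GaloisField p 2)).injective,
      Finset.card_univ, ZMod.card]
  refine ⟨LG.DD lg, LG.DD_one, fun x y hx hx1 hy hy1 => h.DD_ft x y hx hx1 hy hy1, ?_, ?_⟩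
  · intro A _ b hb
    exact h.upper pt (by rw [ZMod.card]) (by omega) h2 hOm (by convert hb)
  · intro H hH
    have hne : (LG.Om (ZMod p) (GaloisField p 2)).Nonempty := by
      rw [← Finset.card_pos, hOm, ZMod.card]
      apply Nat.sub_pos_of_lt
      nlinarith
    obtain ⟨ω0, hω0⟩ := hne
    have sj : ∀ u, ∃ v, LG.vec (ZMod p) ω0 v = u := by
      have inj : Function.Injective (pt ∘ LG.vecL (ZMod p) ω0) := pt.injective.comp (LG.vecL_inj hω0)
      have := Finite.injective_iff_surjective.1 inj
      intro u
      obtain ⟨v, hv⟩ := this (pt u)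
      exact ⟨v, pt.injective hv⟩
    choose pt' hpt' using sj
    have n21 : (2 : ZMod p) ≠ 1 := by
      intro e; exact one_ne_zero (α := ZMod p) (by linear_combination e)
    refine h.lower (by omega) (frobenius (GaloisField p 2) p) ?_ ?_ ω0 hω0 pt' hpt' 2 h2 n21 H hH
    · intro u; rw [frobenius_def, gf_mem]
    · intro u
      rw [frobenius_def, frobenius_def, ← pow_mul, ← cK, FiniteField.pow_card]


theorem oddPart_spec (m : ℕ) (hm : m ≠ 0) : Nat.Coprime 2 (oddPart m) ∧ ∃ e, m = 2 ^ e * oddPart m := by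
  unfold oddPart
  exact ⟨Nat.coprime_ordCompl Nat.prime_two hm, m.factorization 2, (Nat.ordProj_mul_ordCompl_eq_self m 2).symm⟩

def tors2 (M : Type) [AddCommGroup M] : AddSubgroup M where
  carrier := {y | ∃ k : ℕ, (2 ^ k : ℕ) • y = 0}
  zero_mem' := ⟨0, by simp⟩
  add_mem' := by
    rintro a b ⟨i, hi⟩ ⟨j, hj⟩
    refine ⟨i + j, ?_⟩
    rw [smul_add]
    nth_rw 1 [pow_add, mul_comm]
    rw [pow_add, mul_smul, hi, mul_smul, hj]; simp
  neg_mem' := by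
    rintro a ⟨i, hi⟩
    exact ⟨i, by rw [smul_neg, hi, neg_zero]⟩

theorem pb_tw (p : ℕ) [Fact p.Prime] (hp5 : 5 ≤ p) :
    Tw (1 : ZMod p →*₀ ℤ) (fun x => if h : x ≠ 0 then
      (QuotientAddGroup.mk (pb (ZMod p) (Units.mk0 x h)) : PBloch (ZMod p) ⧸ tors2 (PBloch (ZMod p))) else 0) := by
  set b : ZMod p → PBloch (ZMod p) ⧸ tors2 (PBloch (ZMod p)) := (fun x => if h : x ≠ 0 then
      (QuotientAddGroup.mk (pb (ZMod p) (Units.mk0 x h)) : PBloch (ZMod p) ⧸ tors2 (PBloch (ZMod p))) else 0) with hb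
  have bu : ∀ x (h : x ≠ 0), b x = QuotientAddGroup.mk (pb (ZMod p) (Units.mk0 x h)) := fun x h => dif_pos h
  have nt : ∀ a : PBloch (ZMod p) ⧸ tors2 (PBloch (ZMod p)), a + a = 0 → a = 0 := by
    intro a
    induction a using QuotientAddGroup.induction_on with
    | H y =>
      intro h
      rw [← QuotientAddGroup.mk_add, QuotientAddGroup.eq_zero_iff] at h
      obtain ⟨k, hk⟩ := h
      rw [QuotientAddGroup.eq_zero_iff]
      refine ⟨k + 1, ?_⟩
      rw [pow_succ, mul_smul, two_smul]; exact hk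
  have b1 : b 1 = 0 := by
    rw [bu 1 one_ne_zero, Units.mk0_one, pb_one]; rfl
  have ft : ∀ x y : ZMod p, x ≠ 0 → x ≠ 1 → y ≠ 0 → y ≠ 1 →
      b x - b y + b (y / x) - b ((1 - x⁻¹) / (1 - y⁻¹)) + b ((1 - x) / (1 - y)) = 0 := by
    intro x y hx hx1 hy hy1
    have := pb_ft (Units.mk0 x hx) (Units.mk0 y hy) hx1 hy1
    have := congrArg (QuotientAddGroup.mk' (tors2 (PBloch (ZMod p)))) this
    simp only [map_add, map_sub, map_zero, QuotientAddGroup.mk'_apply] at this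
    have hx2 : 1 - x ≠ 0 := sub_ne_zero.2 (Ne.symm hx1)
    have hy2 : 1 - y ≠ 0 := sub_ne_zero.2 (Ne.symm hy1)
    have hx3 : 1 - x⁻¹ ≠ 0 := one_sub_inv_ne (x := Units.mk0 x hx) hx1
    have hy3 : 1 - y⁻¹ ≠ 0 := one_sub_inv_ne (x := Units.mk0 y hy) hy1
    rw [bu x hx, bu y hy, bu (y / x) (div_ne_zero hy hx), bu _ (div_ne_zero hx3 hy3), bu _ (div_ne_zero hx2 hy2)]
    rw [show Units.mk0 (y / x) (div_ne_zero hy hx) = Units.mk0 y hy * (Units.mk0 x hx)⁻¹ from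
      Units.ext (by simp [div_eq_mul_inv])]
    exact this
  let ψ : ZMod p → PBloch (ZMod p) ⧸ tors2 (PBloch (ZMod p)) := fun z => b z + b z⁻¹
  have ψ1 : ψ 1 = 0 := by simp only [ψ]; rw [inv_one, b1, add_zero]
  have ψm : ∀ s w : ZMod p, s ≠ 0 → w ≠ 0 → s * w ≠ 1 → ψ (s * w) = ψ s + ψ w := by
    intro s w hs hw hsw
    by_cases s1 : s = 1
    · rw [s1, one_mul, ψ1, zero_add]
    by_cases w1 : w = 1
    · rw [w1, mul_one, ψ1, add_zero]
    have d : s * w - 1 ≠ 0 := sub_ne_zero.2 hsw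
    have d' : w * s - 1 ≠ 0 := by rwa [mul_comm]
    have ws : w - 1 ≠ 0 := sub_ne_zero.2 w1
    have ss : s - 1 ≠ 0 := sub_ne_zero.2 s1
    obtain ⟨x, hx⟩ : ∃ x, x = (w - 1) / (s * w - 1) := ⟨_, rfl⟩
    obtain ⟨y, hy⟩ : ∃ y, y = s * (w - 1) / (s * w - 1) := ⟨_, rfl⟩
    have x0 : x ≠ 0 := by rw [hx]; exact div_ne_zero ws d
    have y0 : y ≠ 0 := by rw [hy]; exact div_ne_zero (mul_ne_zero hs ws) d
    have ex : 1 - x = w * (s - 1) / (s * w - 1) := by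
      rw [hx, eq_div_iff d, sub_mul, div_mul_cancel₀ _ d]; ring
    have ey : 1 - y = (s - 1) / (s * w - 1) := by
      rw [hy, eq_div_iff d, sub_mul, div_mul_cancel₀ _ d]; ring
    have x2 : 1 - x ≠ 0 := by rw [ex]; exact div_ne_zero (mul_ne_zero hw ss) d
    have y2 : 1 - y ≠ 0 := by rw [ey]; exact div_ne_zero ss d
    have x1 : x ≠ 1 := fun e => x2 (by rw [e, sub_self])
    have y1 : y ≠ 1 := fun e => y2 (by rw [e, sub_self])
    have es : y / x = s := by rw [hx, hy]; field_simp
    have ew : (1 - x) / (1 - y) = w := by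
      rw [ex, ey, div_div_div_cancel_right₀ d, mul_div_cancel_right₀ _ ss]
    have esw : (1 - x⁻¹) / (1 - y⁻¹) = s * w := by
      rw [← es, ← ew]
      rw [show 1 - x⁻¹ = -(1 - x) / x by field_simp; ring, show 1 - y⁻¹ = -(1 - y) / y by field_simp; ring]
      field_simp
    have r1 := ft x y x0 x1 y0 y1
    have r2 := ft y x y0 y1 x0 x1
    rw [← inv_div y x, ← inv_div (1 - x⁻¹), ← inv_div (1 - x)] at r2
    rw [es, ew, esw] at r1 r2
    simp only [ψ]
    rw [← sub_eq_zero, ← neg_eq_zero, ← add_zero (0 : PBloch (ZMod p) ⧸ tors2 (PBloch (ZMod p)))]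
    nth_rw 1 [← r1]
    rw [← r2]
    abel
  have ψi : ∀ w, ψ w⁻¹ = ψ w := by intro w; simp only [ψ]; rw [inv_inv, add_comm]
  have small : ∀ m : ℕ, 0 < m → m < 5 → (m : ZMod p) ≠ 0 := by
    intro m h0 h5 e
    rw [ZMod.natCast_eq_zero_iff] at e
    have := Nat.le_of_dvd h0 e
    omega
  have ψ0 : ∀ w, w ≠ 0 → ψ w = 0 := by
    intro w hw
    obtain ⟨s, s0, s1, sw⟩ : ∃ s : ZMod p, s ≠ 0 ∧ s ≠ 1 ∧ s * w ≠ 1 := by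
      have h2 := small 2 (by omega) (by omega)
      have h3 := small 3 (by omega) (by omega)
      push_cast at h2 h3
      by_cases h : (2 : ZMod p) * w = 1
      · refine ⟨3, h3, ?_, ?_⟩
        · intro e; apply h2; linear_combination e
        · intro e; apply hw; linear_combination e - h
      · refine ⟨2, h2, ?_, h⟩
        intro e; exact one_ne_zero (α := ZMod p) (by linear_combination e)
    have e1 := ψm s w s0 hw sw
    have e2 := ψm (s * w) w⁻¹ (mul_ne_zero s0 hw) (inv_ne_zero hw) (by rwa [mul_assoc, mul_inv_cancel₀ hw, mul_one])
    rw [mul_assoc, mul_inv_cancel₀ hw, mul_one, ψi, e1, add_assoc] at e2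
    exact nt _ (by simpa using e2)
  have c1 : ∀ x : ZMod p, x ≠ 0 → (1 : ZMod p →*₀ ℤ) x = 1 := fun x hx => MonoidWithZeroHom.one_apply_of_ne_zero hx
  refine ⟨nt, fun x hx => Or.inl (c1 x hx), c1 _ (by simp), b1, ?_, ?_⟩
  · intro x hx
    have := ψ0 x hx
    exact eq_neg_of_add_eq_zero_right this
  · intro x y hx hx1 hy hy1
    rw [c1 x hx, c1 _ (sub_ne_zero.2 (Ne.symm hx1))]
    simpa using ft x y hx hx1 hy hy1

theorem pbloch_fin (p : ℕ) [Fact p.Prime] (hp5 : 5 ≤ p) :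
    ∃ D : PBloch (ZMod p) →+ ZMod (oddPart (p + 1)), Function.Surjective D ∧
      ∀ y, D y = 0 → ∃ k : ℕ, (2 ^ k : ℕ) • y = 0 := by
  obtain ⟨D, D1, Dft, Dup, Dlow⟩ := fin_data p hp5
  obtain ⟨Dh, hDh⟩ := PBloch_lift (k := ZMod p) (fun u => D (u : ZMod p)) (by simpa using D1) (by
    intro x y hx hy
    have := Dft x y x.ne_zero hx y.ne_zero hy
    simp only [U, Units.val_mk0, Units.val_mul, Units.val_inv_eq_inv_val]
    simpa only [div_eq_mul_inv] using this)
  obtain ⟨φ, hφ⟩ := Dup _ _ (pb_tw p hp5)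
  have key : ∀ y : PBloch (ZMod p), (2 : ℕ) • (QuotientAddGroup.mk' (tors2 (PBloch (ZMod p))) y) = φ (Dh y) := by
    intro y
    induction y using PBloch_ind with
    | h0 => simp
    | ha x y hx hy => rw [map_add, smul_add, hx, hy, map_add, map_add]
    | hn x hx => rw [map_neg, smul_neg, hx, map_neg, map_neg]
    | hg x =>
      rw [hDh]
      by_cases x1 : (x : ZMod p) = 1
      · have : x = 1 := Units.ext x1
        rw [this, pb_one]; simp [D1]
      · rw [← hφ _ x.ne_zero x1, dif_pos x.ne_zero, Units.mk0_val]; rfl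
  obtain ⟨cop, e, he⟩ := oddPart_spec (p + 1) (by omega)
  set N := oddPart (p + 1) with hN
  have dv : N ∣ p + 1 := ⟨2 ^ e, by rw [mul_comm]; exact he⟩
  have N0 : NeZero N := ⟨by rintro h; rw [h] at he; simp at he⟩
  let c := ZMod.castHom dv (ZMod N)
  refine ⟨c.toAddMonoidHom.comp Dh, ?_, ?_⟩
  · have h4 : (4 : ZMod (p + 1)) ∈ Dh.range := by
      apply Dlow
      intro x hx
      exact ⟨pb _ (Units.mk0 x hx), by rw [hDh]; rfl⟩
    obtain ⟨y, hy⟩ := h4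
    intro t
    have cop4 : Nat.Coprime 4 N := by
      have := Nat.Coprime.pow_left 2 cop; simpa using this
    have u4 := ZMod.coe_mul_inv_eq_one 4 cop4
    refine ⟨(t * ((4 : ℕ) : ZMod N)⁻¹).val • y, ?_⟩
    rw [map_nsmul]
    show _ • c (Dh y) = t
    rw [hy, map_ofNat, nsmul_eq_mul, ZMod.natCast_zmod_val]
    push_cast at u4
    push_cast
    linear_combination t * u4
  · intro y hy
    have hy : c (Dh y) = 0 := hy
    have h1 : (2 ^ e : ℕ) • Dh y = 0 := by
      revert hy
      generalize Dh y = t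
      intro hy
      rw [← ZMod.natCast_zmod_val t, map_natCast, ZMod.natCast_eq_zero_iff] at hy
      rw [← ZMod.natCast_zmod_val t, nsmul_eq_mul, ← Nat.cast_mul, ZMod.natCast_eq_zero_iff]
      exact (dvd_of_eq he).trans (Nat.mul_dvd_mul_left _ hy)
    have h2 : QuotientAddGroup.mk' (tors2 (PBloch (ZMod p))) ((2 ^ e * 2 : ℕ) • y) = 0 := by
      rw [map_nsmul, mul_smul, key, ← map_nsmul, h1, map_zero]
    rw [QuotientAddGroup.mk'_apply, QuotientAddGroup.eq_zero_iff] at h2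
    obtain ⟨j, hj⟩ := h2
    refine ⟨j + (e + 1), ?_⟩
    rw [pow_add, mul_smul, pow_succ]; exact hj

theorem tw_cyc (p : Nat.Primes) (N : ℕ) (hN : Nat.Coprime 2 N) (D : PBp p →+ ZMod N)
    (hs : Function.Surjective D) (hk : ∀ y, D y = 0 → ∃ k : ℕ, (2 ^ k : ℕ) • y = 0) :
    Nonempty (Twist p ≃+ ZMod N) := by
  have u2 : IsUnit ((2 : ℕ) : ZMod N) := (ZMod.isUnit_iff_coprime 2 N).2 hN
  have hu : ∀ x : Submonoid.powers (2 : ℤ), IsUnit ((algebraMap ℤ (Module.End ℤ (ZMod N))) x) := by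
    rintro ⟨_, k, rfl⟩
    rw [Module.End.isUnit_iff]
    have uk : IsUnit ((2 : ZMod N) ^ k) := by simpa using u2.pow k
    have : ∀ t : ZMod N, (algebraMap ℤ (Module.End ℤ (ZMod N)) (2 ^ k)) t = 2 ^ k * t := by
      intro t; rw [Module.algebraMap_end_apply, zsmul_eq_mul]; push_cast; rfl
    constructor
    · intro a b hab
      simp only [this] at hab
      exact uk.mul_left_cancel hab
    · intro b
      obtain ⟨v, hv⟩ := uk
      refine ⟨(v⁻¹ : (ZMod N)ˣ) * b, ?_⟩
      simp only [this]
      rw [← hv, Units.mul_inv_cancel_left]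
  let L0 := LocalizedModule.lift (Submonoid.powers (2 : ℤ)) D.toIntLinearMap hu
  let L : Twist p →+ ZMod N := L0.toAddMonoidHom
  have hL : ∀ y, L (toTw p y) = D y := by
    intro y
    exact LinearMap.congr_fun (LocalizedModule.lift_comp (Submonoid.powers (2 : ℤ)) D.toIntLinearMap hu) y
  have uinj : ∀ (k : ℕ) (t : ZMod N), (2 ^ k : ℤ) • t = 0 → t = 0 := by
    intro k t h
    have uk : IsUnit ((2 : ZMod N) ^ k) := by simpa using u2.pow k
    rw [zsmul_eq_mul] at h
    push_cast at h
    exact (uk.mul_right_eq_zero).1 h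
  refine ⟨AddEquiv.ofBijective L ⟨?_, ?_⟩⟩
  · rw [injective_iff_map_eq_zero]
    intro t ht
    obtain ⟨k, y, hy⟩ := tw_surj p t
    have h1 : D y = 0 := by rw [← hL, ← hy, map_zsmul, ht, smul_zero]
    obtain ⟨j, hj⟩ := hk y h1
    apply tw_two_inj p (j + k)
    rw [pow_add, mul_smul, hy, ← toTw_zsmul]
    have : (2 ^ j : ℤ) • y = 0 := by rw [← hj, ← natCast_zsmul]; push_cast; rfl
    rw [this, toTw_zero]
  · intro t
    obtain ⟨y, hy⟩ := hs t
    exact ⟨toTw p y, by rw [hL, hy]⟩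

theorem tw_all (p : Nat.Primes) : Nonempty (Twist p ≃+ ZMod (oddPart ((p : ℕ) + 1))) := by
  haveI : Fact (p : ℕ).Prime := ⟨p.2⟩
  obtain ⟨cop, e0, he0⟩ := oddPart_spec ((p : ℕ) + 1) (by omega)
  by_cases h2 : (p : ℕ) = 2
  · obtain ⟨e, -⟩ := PBp_two p h2
    have o3 : oddPart ((p : ℕ) + 1) = 3 := by
      rw [h2]; unfold oddPart
      rw [Nat.factorization_eq_zero_of_not_dvd (by norm_num)]
      norm_num
    rw [o3] at cop ⊢
    exact tw_cyc p 3 cop e.toAddMonoidHom e.surjective (fun y hy => ⟨0, by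
      rw [(map_eq_zero_iff e e.injective).1 hy, smul_zero]⟩)
  by_cases h3 : (p : ℕ) = 3
  · obtain ⟨e⟩ := PBp_three p h3
    have o3 : oddPart ((p : ℕ) + 1) = 1 := by
      rw [h3]; unfold oddPart
      rw [show 3 + 1 = 2 ^ 2 by norm_num, Nat.Prime.factorization_pow Nat.prime_two]; simp
    rw [o3] at cop ⊢
    refine tw_cyc p 1 cop 0 (fun t => ⟨0, Subsingleton.elim _ _⟩) (fun y _ => ⟨2, ?_⟩)
    apply e.injective
    rw [map_nsmul, map_zero]
    generalize e y = t
    revert t; decide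
  · obtain ⟨e, -⟩ := PBp_five p h2 h3
    have hp := p.2.two_le
    have h4 : (p : ℕ) ≠ 4 := by
      intro h; have := p.2; rw [h] at this; exact absurd this (by norm_num)
    obtain ⟨D, hs, hk⟩ := pbloch_fin p (by omega)
    refine tw_cyc p _ cop (D.comp e.toAddMonoidHom) (hs.comp e.surjective) ?_
    intro y hy
    obtain ⟨k, hk⟩ := hk (e y) hy
    refine ⟨k, e.injective ?_⟩
    rw [map_nsmul, hk, map_zero]

theorem second {M : Type*} [AddCommGroup M] (S : M →+ DirectSum Nat.Primes Twist) (hS : Function.Bijective S) :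
    Nonempty (M ≃+ DirectSum Nat.Primes fun p => ZMod (oddPart ((p : ℕ) + 1))) := by
  exact ⟨(AddEquiv.ofBijective S hS).trans (DFinsupp.mapRange.addEquiv fun p => (tw_all p).some)⟩

/-- The `R_ℚ`-module homomorphism
`S̄ = (S̄_p)_p : I_ℚ·RP′(ℚ)[1/2] → ⊕_{p prime} P(F_p)[1/2]{p}` is an isomorphism of
`R_ℚ`-modules.  Consequently `I_ℚ·RP′(ℚ)[1/2] ≅ ⊕_{p prime} ℤ/(p+1)′` as abelian
groups.  Here `S̄_p : RP′(ℚ) → P(F_p){p}` is determined by `[x] ↦ [x mod p]` if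
`v_p(x) = 0`, `[x] ↦ C_{F_p}` if `v_p(x) > 0` and `[x] ↦ -C_{F_p}` if `v_p(x) < 0`;
the element `C = C_{F_p}` is characterized by the hypotheses `hCC` (namely
`C = [a] + [1-a]` for `a ≠ 0, 1`; for `p = 3` this gives `C = 2·[-1]`) and `hCC2`
(`C` is a generator of `P(F₂) = ℤ/3`), and `S̄` is the map induced on
`I_ℚ·RP′(ℚ)[1/2]` by the `S̄_p` (hypotheses `hS0`, `hSpos`, `hSneg`, `hSbar`). -/
theorem statement1
    (CC : ∀ p : Nat.Primes, PBp p)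
    (hCC : ∀ (p : Nat.Primes) (a : ZMod p), a ≠ 0 → a ≠ 1 →
      CC p = pbK p a + pbK p (1 - a))
    (hCC2 : ∀ p : Nat.Primes, (p : ℕ) = 2 → CC p ≠ 0)
    (Sfull : RP' ℚ →ₗ[RF ℚ] ∀ p : Nat.Primes, Twist p)
    (hS0 : ∀ (x : ℚˣ) (p : Nat.Primes), vP p x = 0 →
      Sfull (rp ℚ x) p = toTw p (pbK p (redQ p (x : ℚ))))
    (hSpos : ∀ (x : ℚˣ) (p : Nat.Primes), 0 < vP p x →
      Sfull (rp ℚ x) p = toTw p (CC p))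
    (hSneg : ∀ (x : ℚˣ) (p : Nat.Primes), vP p x < 0 →
      Sfull (rp ℚ x) p = -toTw p (CC p))
    (Sbar : ↥IRPhalf →ₗ[RF ℚ] DirectSum Nat.Primes Twist)
    (hSbar : ∀ (z : RP' ℚ) (hz : toLoc2 ℚ (M := RP' ℚ) z ∈ IRPhalf) (p : Nat.Primes),
      Sbar ⟨toLoc2 ℚ z, hz⟩ p = Sfull z p) :
    Function.Bijective Sbar ∧
      Nonempty (↥IRPhalf ≃+ DirectSum Nat.Primes fun p => ZMod (oddPart ((p : ℕ) + 1))) := by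
  have h := Sbar_bij CC hCC hCC2 Sfull hS0 hSpos hSneg Sbar hSbar
  exact ⟨h, second Sbar.toAddMonoidHom h⟩
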